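/- arXiv:2005.13824 — 2 statements merged into one kernel-verified Lean document; each statement's English description precedes it below -/
import Mathlib

section
/- If λ^{(n)} is a Plancherel-distributed random Young diagram with n boxes and λ^{(n)}_r denotes the length of its row with index r, then for each fixed r ∈ ℕ_0, liminf_{n→∞} 𝔼[λ^{(n)}_r]/√n ≥ 2. -/
open Filter

/-- The number of standard Young tableaux of shape `μ`: bijective fillings of the cells of `μ`
by `0, 1, …, μ.card - 1` that are strictly increasing along rows and columns. -/
noncomputable def sytCount (μ : YoungDiagram) : ℕ :=
  Nat.card {T : μ.cells → Fin μ.card //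
    Function.Bijective T ∧
      ∀ a b : μ.cells, (a : ℕ × ℕ).1 ≤ (b : ℕ × ℕ).1 → (a : ℕ × ℕ).2 ≤ (b : ℕ × ℕ).2 →
        a ≠ b → T a < T b}

/-- The Plancherel measure `Pl_n` on Young diagrams with `n` boxes: the probability of a
diagram `μ` with `μ.card = n` is `d_μ² / n!` (and `0` for diagrams with `μ.card ≠ n`). -/
noncomputable def plancherelProb (n : ℕ) (μ : YoungDiagram) : ℝ :=
  if μ.card = n then (sytCount μ : ℝ) ^ 2 / (Nat.factorial n : ℝ) else 0

namespace PL
open Finset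
open scoped Classical

lemma fst_lt_card (μ : YoungDiagram) {c : ℕ × ℕ} (h : c ∈ μ.cells) : c.1 < μ.card := by
  have : ((range (c.1+1)).image (fun i => (i, c.2))) ⊆ μ.cells := by
    intro x hx
    simp only [Finset.mem_image, Finset.mem_range] at hx
    obtain ⟨i, hi, rfl⟩ := hx
    exact μ.isLowerSet (show ((i, c.2) : ℕ × ℕ) ≤ c from ⟨by simpa using Nat.lt_succ_iff.mp hi, le_rfl⟩) h
  have h2 := Finset.card_le_card this
  rw [Finset.card_image_of_injective _ (fun a b hab => by simpa using hab), Finset.card_range] at h2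
  exact h2

lemma snd_lt_card (μ : YoungDiagram) {c : ℕ × ℕ} (h : c ∈ μ.cells) : c.2 < μ.card := by
  have : ((range (c.2+1)).image (fun i => (c.1, i))) ⊆ μ.cells := by
    intro x hx
    simp only [Finset.mem_image, Finset.mem_range] at hx
    obtain ⟨i, hi, rfl⟩ := hx
    exact μ.isLowerSet (show ((c.1, i) : ℕ × ℕ) ≤ c from ⟨le_rfl, by simpa using Nat.lt_succ_iff.mp hi⟩) h
  have h2 := Finset.card_le_card this
  rw [Finset.card_image_of_injective _ (fun a b hab => by simpa using hab), Finset.card_range] at h2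
  exact h2

lemma finite_card (n : ℕ) : {μ : YoungDiagram | μ.card = n}.Finite := by
  apply Set.Finite.of_finite_image (f := YoungDiagram.cells)
  · apply (Finset.finite_toSet ((range n ×ˢ range n).powerset)).subset
    rintro _ ⟨μ, hμ, rfl⟩
    simp only [Finset.coe_powerset, Set.mem_preimage, Set.mem_powerset_iff, Finset.coe_subset]
    intro c hc
    have h1 := fst_lt_card μ hc
    have h2 := snd_lt_card μ hc
    simp only [Set.mem_ofPred_eq] at hμ
    simp only [Finset.mem_product, Finset.mem_range]
    omega
  · intro a _ b _ h
    exact YoungDiagram.ext h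

noncomputable def Y (n : ℕ) : Finset YoungDiagram := (finite_card n).toFinset

lemma mem_Y {n : ℕ} {μ : YoungDiagram} : μ ∈ Y n ↔ μ.card = n := by simp [Y]

noncomputable def up (l : YoungDiagram) : Finset YoungDiagram :=
  (Y (l.card+1)).filter (fun m => l ≤ m)

noncomputable def lo (l : YoungDiagram) : Finset YoungDiagram :=
  (Y (l.card-1)).filter (fun m => m ≤ l ∧ l.card = m.card + 1)

lemma mem_up {l m : YoungDiagram} : m ∈ up l ↔ l ≤ m ∧ m.card = l.card + 1 := by
  simp [up, mem_Y, and_comm]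

lemma mem_lo {l m : YoungDiagram} : m ∈ lo l ↔ m ≤ l ∧ l.card = m.card + 1 := by
  simp only [lo, mem_Y, Finset.mem_filter]
  constructor
  · rintro ⟨_, h⟩; exact h
  · rintro ⟨h, h2⟩; exact ⟨by omega, h, h2⟩

lemma mem_lo_iff {l m : YoungDiagram} : m ∈ lo l ↔ l ∈ up m := by
  rw [mem_lo, mem_up]

noncomputable def S (φ : ℤ → ℝ) (l : YoungDiagram) : ℝ := ∑ c ∈ l.cells, φ ((c.2 : ℤ) - c.1)

lemma S_sup_inf (φ : ℤ → ℝ) (a b : YoungDiagram) : S φ (a ⊔ b) + S φ (a ⊓ b) = S φ a + S φ b := by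
  simp only [S, YoungDiagram.cells_sup, YoungDiagram.cells_inf]
  exact Finset.sum_union_inter

lemma card_sup_inf (a b : YoungDiagram) : (a ⊔ b).card + (a ⊓ b).card = a.card + b.card := by
  simp only [YoungDiagram.card, YoungDiagram.cells_sup, YoungDiagram.cells_inf]
  exact Finset.card_union_add_card_inter _ _

lemma eq_of_le_card {a b : YoungDiagram} (h : a ≤ b) (hc : b.card ≤ a.card) : a = b := by
  apply YoungDiagram.ext
  exact Finset.eq_of_subset_of_card_le (YoungDiagram.cells_subset_iff.mpr h) hc

/-- diamond exchange -/
lemma diamond (l : YoungDiagram) (F : YoungDiagram → YoungDiagram → YoungDiagram → ℝ) :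
    ∑ L ∈ up l, ∑ k ∈ (lo L).erase l, F L k (L ⊓ k ⊓ l) =
    ∑ m ∈ lo l, ∑ k ∈ (up m).erase l, F (k ⊔ l) k m := by
  rw [Finset.sum_sigma', Finset.sum_sigma']
  refine Finset.sum_bij' (fun x _ => ⟨x.2 ⊓ l, x.2⟩) (fun x _ => ⟨x.2 ⊔ l, x.2⟩) ?_ ?_ ?_ ?_ ?_
  all_goals (rintro ⟨x, k⟩ hx; simp only [Finset.mem_sigma, Finset.mem_erase, mem_up, mem_lo] at hx)
  · obtain ⟨⟨h1, h2⟩, h3, h4, h5⟩ := hx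
    have hs : k ⊔ l = x := by
      apply eq_of_le_card (sup_le h4 h1)
      by_contra hcon
      have : l = k ⊔ l := eq_of_le_card le_sup_right (by omega)
      have hk : k ≤ l := by rw [this]; exact le_sup_left
      exact h3 (eq_of_le_card hk (by omega))
    have := card_sup_inf k l
    rw [hs] at this
    simp only [Finset.mem_sigma, Finset.mem_erase, mem_up, mem_lo]
    refine ⟨⟨inf_le_right, by omega⟩, h3, inf_le_left, by omega⟩
  · obtain ⟨⟨h1, h2⟩, h3, h4, h5⟩ := hx
    have hs : x = k ⊓ l := by
      apply eq_of_le_card (le_inf h4 h1)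
      by_contra hcon
      have : k ⊓ l = l := eq_of_le_card inf_le_right (by omega)
      have hk : l ≤ k := by rw [← this]; exact inf_le_left
      exact h3 (eq_of_le_card hk (by omega)).symm
    have := card_sup_inf k l
    rw [← hs] at this
    simp only [Finset.mem_sigma, Finset.mem_erase, mem_up, mem_lo]
    refine ⟨⟨le_sup_right, by omega⟩, h3, le_sup_left, by omega⟩
  · obtain ⟨⟨h1, h2⟩, h3, h4, h5⟩ := hx
    have hs : k ⊔ l = x := by
      apply eq_of_le_card (sup_le h4 h1)
      by_contra hcon
      have : l = k ⊔ l := eq_of_le_card le_sup_right (by omega)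
      have hk : k ≤ l := by rw [this]; exact le_sup_left
      exact h3 (eq_of_le_card hk (by omega))
    simp [hs]
  · obtain ⟨⟨h1, h2⟩, h3, h4, h5⟩ := hx
    have hs : x = k ⊓ l := by
      apply eq_of_le_card (le_inf h4 h1)
      by_contra hcon
      have : k ⊓ l = l := eq_of_le_card inf_le_right (by omega)
      have hk : l ≤ k := by rw [← this]; exact inf_le_left
      exact h3 (eq_of_le_card hk (by omega)).symm
    simp [hs]
  · obtain ⟨⟨h1, h2⟩, h3, h4, h5⟩ := hx
    have hs : k ⊔ l = x := by
      apply eq_of_le_card (sup_le h4 h1)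
      by_contra hcon
      have : l = k ⊔ l := eq_of_le_card le_sup_right (by omega)
      have hk : k ≤ l := by rw [this]; exact le_sup_left
      exact h3 (eq_of_le_card hk (by omega))
    have h6 : x ⊓ k = k := inf_eq_right.mpr h4
    simp [hs, h6]

/-! rows -/
def Ad (l : YoungDiagram) (i : ℕ) : Prop := i = 0 ∨ l.rowLen i < l.rowLen (i-1)

lemma mem_cells_iff {l : YoungDiagram} {c : ℕ × ℕ} : c ∈ l.cells ↔ c.2 < l.rowLen c.1 := by
  rw [YoungDiagram.mem_cells, ← YoungDiagram.mem_iff_lt_rowLen]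

noncomputable def addRow (l : YoungDiagram) (i : ℕ) : YoungDiagram :=
  if h : Ad l i then ⟨insert (i, l.rowLen i) l.cells, by
    intro a b hba ha
    simp only [Finset.coe_insert, Set.mem_insert_iff, Finset.mem_coe] at ha ⊢
    rcases ha with rfl | ha
    · by_cases hb : b = (i, l.rowLen i)
      · exact Or.inl hb
      right
      rw [mem_cells_iff]
      obtain ⟨b1, b2⟩ := b
      obtain ⟨h1, h2⟩ := hba
      simp only at h1 h2 ⊢
      rcases h1.lt_or_eq with h1 | rfl
      · rcases h with rfl | h
        · omega
        · have := l.rowLen_anti b1 (i-1) (by omega)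
          omega
      · rcases h2.lt_or_eq with h2 | rfl
        · exact h2
        · exact absurd rfl hb
    · exact Or.inr (l.isLowerSet hba ha)⟩ else l

noncomputable def remRow (l : YoungDiagram) (i : ℕ) : YoungDiagram :=
  if h : Ad l (i+1) then ⟨l.cells.erase (i, l.rowLen i - 1), by
    intro a b hba ha
    simp only [Finset.coe_erase, Set.mem_sdiff, Finset.mem_coe, Set.mem_singleton_iff] at ha ⊢
    refine ⟨l.isLowerSet hba ha.1, ?_⟩
    rintro rfl
    obtain ⟨a1, a2⟩ := a
    obtain ⟨h1, h2⟩ := hba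
    have ha1 := ha.1
    rw [mem_cells_iff] at ha1
    simp only [Prod.mk.injEq] at h1 h2 ha1 ha
    simp only [Ad, Nat.add_sub_cancel] at h
    rcases h1.lt_or_eq with h1 | rfl
    · have := l.rowLen_anti (i+1) a1 (by omega)
      omega
    · omega⟩ else l

lemma addRow_cells {l : YoungDiagram} {i : ℕ} (h : Ad l i) :
    (addRow l i).cells = insert (i, l.rowLen i) l.cells := by
  rw [addRow, dif_pos h]

lemma remRow_cells {l : YoungDiagram} {i : ℕ} (h : Ad l (i+1)) :
    (remRow l i).cells = l.cells.erase (i, l.rowLen i - 1) := by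
  rw [remRow, dif_pos h]

lemma notMem_add (l : YoungDiagram) (i : ℕ) : (i, l.rowLen i) ∉ l.cells := by
  rw [mem_cells_iff]; simp

lemma mem_rem {l : YoungDiagram} {i : ℕ} (h : Ad l (i+1)) : (i, l.rowLen i - 1) ∈ l.cells := by
  rw [mem_cells_iff]; simp only [Ad, Nat.add_sub_cancel] at h ⊢; omega

lemma rowLen_pos_lt {l : YoungDiagram} {i : ℕ} (h : 0 < l.rowLen i) : i < l.card :=
  fst_lt_card l (c := (i, 0)) (by rw [mem_cells_iff]; exact h)

lemma exists_insert {l L : YoungDiagram} (h : L ∈ up l) :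
    ∃ c, c ∉ l.cells ∧ L.cells = insert c l.cells := by
  rw [mem_up] at h
  have hsub : l.cells ⊆ L.cells := YoungDiagram.cells_subset_iff.mpr h.1
  have h2 := Finset.card_sdiff_of_subset hsub
  have h3 : (L.cells \ l.cells).card = 1 := by
    have : L.cells.card = l.cells.card + 1 := h.2
    omega
  obtain ⟨c, hc⟩ := Finset.card_eq_one.mp h3
  refine ⟨c, ?_, ?_⟩
  · have : c ∈ L.cells \ l.cells := by rw [hc]; simp
    exact (Finset.mem_sdiff.mp this).2
  · rw [← Finset.sdiff_union_of_subset hsub, hc]; rfl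

lemma insert_is_add {l L : YoungDiagram} {c : ℕ × ℕ} (hc : c ∉ l.cells)
    (hL : L.cells = insert c l.cells) : c.2 = l.rowLen c.1 ∧ Ad l c.1 := by
  obtain ⟨i, j⟩ := c
  have hc' : (i, j) ∈ L.cells := by rw [hL]; simp
  have hlow : ∀ i' j', i' ≤ i → j' ≤ j → (i', j') ≠ (i, j) → j' < l.rowLen i' := by
    intro i' j' h1 h2 h3
    have : (i', j') ∈ L.cells := L.isLowerSet (show ((i', j') : ℕ × ℕ) ≤ (i, j) from ⟨h1, h2⟩) hc'
    rw [hL, Finset.mem_insert] at this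
    rcases this with h | h
    · exact absurd h h3
    · exact mem_cells_iff.mp h
  rw [mem_cells_iff] at hc
  simp only at hc ⊢
  have hj : j = l.rowLen i := by
    by_contra hne
    have := hlow i (l.rowLen i) le_rfl (by omega) (by simp; omega)
    omega
  refine ⟨hj, ?_⟩
  rcases Nat.eq_zero_or_pos i with h0 | h0
  · exact Or.inl h0
  · right
    have := hlow (i-1) j (by omega) le_rfl (by simp; omega)
    omega

lemma up_eq (l : YoungDiagram) (N : ℕ) (hN : l.card ≤ N) :
    up l = ((range (N+1)).filter (Ad l)).image (addRow l) := by
  ext L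
  simp only [Finset.mem_image, Finset.mem_filter, Finset.mem_range]
  constructor
  · intro h
    obtain ⟨c, hc, hL⟩ := exists_insert h
    obtain ⟨h1, h2⟩ := insert_is_add hc hL
    refine ⟨c.1, ⟨?_, h2⟩, ?_⟩
    · rcases h2 with h2 | h2
      · omega
      · have := rowLen_pos_lt (l := l) (i := c.1 - 1) (by omega)
        omega
    · apply YoungDiagram.ext
      rw [addRow_cells h2, hL, ← h1]
  · rintro ⟨i, ⟨_, hi⟩, rfl⟩
    rw [mem_up]
    constructor
    · rw [← YoungDiagram.cells_subset_iff, addRow_cells hi]; exact Finset.subset_insert _ _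
    · rw [YoungDiagram.card, addRow_cells hi, Finset.card_insert_of_notMem (notMem_add l i)]

lemma addRow_inj (l : YoungDiagram) {i k : ℕ} (hi : Ad l i) (hk : Ad l k) (h : addRow l i = addRow l k) :
    i = k := by
  have h1 : (i, l.rowLen i) ∈ (addRow l k).cells := by rw [← h, addRow_cells hi]; simp
  rw [addRow_cells hk, Finset.mem_insert] at h1
  rcases h1 with h1 | h1
  · simpa using congrArg Prod.fst h1
  · exact absurd h1 (notMem_add l i)

lemma S_add (φ : ℤ → ℝ) {l : YoungDiagram} {i : ℕ} (h : Ad l i) :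
    S φ (addRow l i) - S φ l = φ ((l.rowLen i : ℤ) - i) := by
  rw [S, addRow_cells h, Finset.sum_insert (notMem_add l i), S]; ring

lemma remRow_up {l : YoungDiagram} {i : ℕ} (h : Ad l (i+1)) : l ∈ up (remRow l i) := by
  rw [mem_up]
  constructor
  · rw [← YoungDiagram.cells_subset_iff, remRow_cells h]; exact Finset.erase_subset _ _
  · rw [YoungDiagram.card, YoungDiagram.card, remRow_cells h, Finset.card_erase_add_one (mem_rem h)]

lemma S_rem (φ : ℤ → ℝ) {l : YoungDiagram} {i : ℕ} (h : Ad l (i+1)) :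
    S φ l - S φ (remRow l i) = φ ((l.rowLen i : ℤ) - 1 - i) := by
  have := Finset.add_sum_erase l.cells (fun c => φ ((c.2 : ℤ) - c.1)) (mem_rem h)
  rw [S, ← this, S, remRow_cells h]
  have h2 : 0 < l.rowLen i := by simp only [Ad, Nat.add_sub_cancel] at h; omega
  simp only
  push_cast [Nat.cast_sub (show 1 ≤ l.rowLen i by omega)]
  ring

lemma remRow_inj (l : YoungDiagram) {i k : ℕ} (hi : Ad l (i+1)) (hk : Ad l (k+1))
    (h : remRow l i = remRow l k) : i = k := by
  by_contra hne
  have h1 : (i, l.rowLen i - 1) ∈ (remRow l k).cells := by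
    rw [remRow_cells hk, Finset.mem_erase]
    exact ⟨by simp [hne], mem_rem hi⟩
  rw [← h, remRow_cells hi] at h1
  simp at h1

lemma lo_eq (l : YoungDiagram) (N : ℕ) (hN : l.card ≤ N) :
    lo l = ((range N).filter (fun i => Ad l (i+1))).image (remRow l) := by
  ext L
  simp only [Finset.mem_image, Finset.mem_filter, Finset.mem_range]
  constructor
  · intro h
    rw [mem_lo_iff] at h
    obtain ⟨⟨i, j⟩, hc, hL⟩ := exists_insert h
    obtain ⟨h1, h2⟩ := insert_is_add hc hL
    have hmem : (i, j) ∈ l.cells := by rw [hL]; simp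
    have hlt := mem_cells_iff.mp hmem
    simp only at h1 h2 hlt
    have hni : (i, j+1) ∉ l.cells := by
      rw [hL, Finset.mem_insert, mem_cells_iff]; simp; omega
    rw [mem_cells_iff] at hni
    simp only at hni
    have hni2 : (i+1, j) ∉ l.cells := by
      rw [hL, Finset.mem_insert, mem_cells_iff]
      have := L.rowLen_anti i (i+1) (by omega)
      simp; omega
    rw [mem_cells_iff] at hni2
    simp only at hni2
    have hA : Ad l (i+1) := by right; simp only [Nat.add_sub_cancel]; omega
    refine ⟨i, ⟨?_, hA⟩, ?_⟩
    · have := rowLen_pos_lt (l := l) (i := i) (by omega); omega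
    · apply YoungDiagram.ext
      rw [remRow_cells hA, hL, show l.rowLen i - 1 = j by omega, Finset.erase_insert hc]
  · rintro ⟨i, ⟨_, hi⟩, rfl⟩
    rw [mem_lo_iff]; exact remRow_up hi

lemma sum_cells (l : YoungDiagram) (N : ℕ) (hN : l.card ≤ N) (g : ℕ × ℕ → ℝ) :
    ∑ c ∈ l.cells, g c = ∑ i ∈ range N, ∑ j ∈ range (l.rowLen i), g (i, j) := by
  apply Finset.sum_finset_product
  intro p
  rw [mem_cells_iff, Finset.mem_range, Finset.mem_range]
  constructor
  · intro h
    exact ⟨by have := rowLen_pos_lt (l := l) (i := p.1) (by omega); omega, h⟩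
  · exact fun h => h.2

def Dl (φ : ℤ → ℝ) : ℤ → ℝ := fun x => φ (x+1) + φ (x-1) - 2 * φ x

lemma row_tele (φ : ℤ → ℝ) (i : ℤ) (n : ℕ) :
    ∑ j ∈ range n, Dl φ ((j : ℤ) - i) = (φ (n - i) - φ (n - i - 1)) - (φ (-i) - φ (-i - 1)) := by
  induction n with
  | zero => simp
  | succ n ih =>
    rw [Finset.sum_range_succ, ih, Dl]
    push_cast
    rw [show (n : ℤ) + 1 - i = n - i + 1 by ring, show (n : ℤ) - i + 1 - 1 = n - i by ring]
    ring

lemma p_identity (φ : ℤ → ℝ) (l : YoungDiagram) :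
    ∑ L ∈ up l, (S φ L - S φ l) - ∑ m ∈ lo l, (S φ l - S φ m) = φ 0 + S (Dl φ) l := by
  set N := l.card with hN
  rw [up_eq l N le_rfl, lo_eq l N le_rfl, Finset.sum_image, Finset.sum_image]
  rotate_left
  · intro a ha b hb h
    simp only [Finset.coe_filter, Set.mem_ofPred_eq] at ha hb
    exact remRow_inj l ha.2 hb.2 h
  · intro a ha b hb h
    simp only [Finset.coe_filter, Set.mem_ofPred_eq] at ha hb
    exact addRow_inj l ha.2 hb.2 h
  have e1 : ∑ i ∈ (range (N+1)).filter (Ad l), (S φ (addRow l i) - S φ l) =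
      φ (l.rowLen 0) + ∑ i ∈ range N, if Ad l (i+1) then φ ((l.rowLen (i+1) : ℤ) - (i+1)) else 0 := by
    rw [Finset.sum_congr rfl (g := fun i : ℕ => φ ((l.rowLen i : ℤ) - i))
      (fun i hi => S_add φ (Finset.mem_filter.mp hi).2), Finset.sum_filter, Finset.sum_range_succ']
    simp [Ad, add_comm]
  have e2 : ∑ i ∈ (range N).filter (fun i => Ad l (i+1)), (S φ l - S φ (remRow l i)) =
      ∑ i ∈ range N, if Ad l (i+1) then φ ((l.rowLen i : ℤ) - 1 - i) else 0 := by
    rw [Finset.sum_congr rfl (g := fun i : ℕ => φ ((l.rowLen i : ℤ) - 1 - i))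
      (fun i hi => S_rem φ (Finset.mem_filter.mp hi).2), Finset.sum_filter]
  rw [e1, e2, add_sub_assoc, ← Finset.sum_sub_distrib, S, sum_cells l N le_rfl]
  have e3 : ∀ i ∈ range N, ((if Ad l (i+1) then φ ((l.rowLen (i+1) : ℤ) - (i+1)) else 0) -
      if Ad l (i+1) then φ ((l.rowLen i : ℤ) - 1 - i) else 0) =
      φ ((l.rowLen (i+1) : ℤ) - (i+1)) - φ ((l.rowLen i : ℤ) - i - 1) := by
    intro i _
    split_ifs with h
    · rw [show (l.rowLen i : ℤ) - 1 - i = l.rowLen i - i - 1 by ring]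
    · have h2 : l.rowLen (i+1) = l.rowLen i := by
        have := l.rowLen_anti i (i+1) (by omega)
        simp only [Ad, Nat.add_sub_cancel] at h; omega
      rw [h2, show (l.rowLen i : ℤ) - (i+1) = l.rowLen i - i - 1 by ring]; ring
  rw [Finset.sum_congr rfl e3, Finset.sum_congr rfl (fun (i : ℕ) _ => row_tele φ (i : ℤ) (l.rowLen i))]
  have e4 : ∀ K : ℕ, φ (l.rowLen 0) + ∑ i ∈ range K, (φ ((l.rowLen (i+1) : ℤ) - (i+1)) - φ ((l.rowLen i : ℤ) - i - 1))
     = φ 0 + ∑ i ∈ range K, ((φ ((l.rowLen i : ℤ) - (i : ℕ)) - φ ((l.rowLen i : ℤ) - (i : ℕ) - 1)) - (φ (-(i : ℕ)) - φ (-(i : ℕ) - 1)))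
      + (φ ((l.rowLen K : ℤ) - K) - φ (-(K : ℤ))) := by
    intro K
    induction K with
    | zero => simp
    | succ K ih =>
      rw [Finset.sum_range_succ, Finset.sum_range_succ, ← add_assoc, ih]
      push_cast
      rw [show -((K : ℤ) + 1) = -K - 1 by ring]
      ring
  have e5 : l.rowLen N = 0 := by
    by_contra h
    have := rowLen_pos_lt (l := l) (i := N) (by omega); omega
  have := e4 N
  rw [e5] at this
  simpa using this
end PL

namespace PL
open Finset
open scoped Classical

def sy (μ : YoungDiagram) : Set (ℕ × ℕ → ℕ) :=
  {T | (∀ c, c ∉ μ.cells → T c = 0) ∧ (∀ c ∈ μ.cells, T c < μ.card) ∧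
    (∀ a ∈ μ.cells, ∀ b ∈ μ.cells, T a = T b → a = b) ∧
    (∀ a ∈ μ.cells, ∀ b ∈ μ.cells, a ≤ b → a ≠ b → T a < T b)}

noncomputable def syEquiv (μ : YoungDiagram) : {T : μ.cells → Fin μ.card //
    Function.Bijective T ∧
      ∀ a b : μ.cells, (a : ℕ × ℕ).1 ≤ (b : ℕ × ℕ).1 → (a : ℕ × ℕ).2 ≤ (b : ℕ × ℕ).2 →
        a ≠ b → T a < T b} ≃ sy μ where
  toFun T := ⟨fun c => if h : c ∈ μ.cells then (T.1 ⟨c, h⟩ : ℕ) else 0, by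
    refine ⟨fun c hc => dif_neg hc, fun c hc => ?_, fun a ha b hb hab => ?_, fun a ha b hb h1 h2 => ?_⟩
    · simp only [dif_pos hc]; exact (T.1 ⟨c, hc⟩).2
    · simp only [dif_pos ha, dif_pos hb] at hab
      have := T.2.1.1 (Fin.ext hab)
      simpa using this
    · simp only [dif_pos ha, dif_pos hb]
      exact T.2.2 ⟨a, ha⟩ ⟨b, hb⟩ h1.1 h1.2 (by simpa using h2)⟩
  invFun T := ⟨fun c => ⟨T.1 c, T.2.2.1 c c.2⟩, by
    constructor
    · rw [Fintype.bijective_iff_injective_and_card]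
      refine ⟨fun a b hab => ?_, by simp [YoungDiagram.card]⟩
      simp only [Fin.mk.injEq] at hab
      exact Subtype.ext (T.2.2.2.1 a a.2 b b.2 hab)
    · intro a b h1 h2 h3
      exact T.2.2.2.2 a a.2 b b.2 ⟨h1, h2⟩ (fun h => h3 (Subtype.ext h))⟩
  left_inv T := by
    apply Subtype.ext; funext c; apply Fin.ext; simp
  right_inv T := by
    apply Subtype.ext; funext c
    by_cases h : c ∈ μ.cells
    · simp [h]
    · simp [h, T.2.1 c h]

lemma sytCount_eq (μ : YoungDiagram) : sytCount μ = Nat.card (sy μ) := Nat.card_congr (syEquiv μ)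

instance (μ : YoungDiagram) : Finite (sy μ) := Finite.of_equiv _ (syEquiv μ)

lemma syt_bot : sytCount ⊥ = 1 := by
  rw [sytCount_eq, Nat.card_eq_one_iff_unique]
  constructor
  · constructor
    rintro ⟨T, h⟩ ⟨T', h'⟩
    apply Subtype.ext; funext c
    simp only
    rw [h.1 c (by simp), h'.1 c (by simp)]
  · exact ⟨⟨fun _ => 0, by simp [sy]⟩⟩

noncomputable def xc (L m : YoungDiagram) : ℕ × ℕ :=
  if h : L ∈ up m then (exists_insert h).choose else 0

lemma xc_spec {L m : YoungDiagram} (h : m ∈ lo L) :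
    xc L m ∉ m.cells ∧ L.cells = insert (xc L m) m.cells := by
  rw [mem_lo_iff] at h
  rw [xc, dif_pos h]
  exact (exists_insert h).choose_spec

noncomputable def syMap (L : YoungDiagram) : (Σ m : lo L, sy m.1) → sy L := fun p =>
  ⟨Function.update p.2.1 (xc L p.1) p.1.1.card, by
    obtain ⟨⟨m, hm⟩, T, h1, h2, h3, h4⟩ := p
    have h2 : ∀ c ∈ m.cells, T c < m.card := h2
    obtain ⟨hx, hL⟩ := xc_spec hm
    have hcard := (mem_lo.mp hm).2
    simp only
    set x := xc L m with hxd
    have hne : ∀ c ∈ m.cells, c ≠ x := fun c hc h => hx (h ▸ hc)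
    refine ⟨?_, ?_, ?_, ?_⟩
    · intro c hc
      rw [hL, Finset.mem_insert, not_or] at hc
      rw [Function.update_of_ne hc.1]
      exact h1 c hc.2
    · intro c hc
      rw [hL, Finset.mem_insert] at hc
      rcases hc with rfl | hc
      · rw [Function.update_self]; omega
      · rw [Function.update_of_ne (hne c hc)]
        have := h2 c hc; omega
    · intro a ha b hb hab
      rw [hL, Finset.mem_insert] at ha hb
      rcases ha with ha | ha <;> rcases hb with hb | hb
      · rw [ha, hb]
      · rw [ha, Function.update_self, Function.update_of_ne (hne b hb)] at hab
        have := h2 b hb; omega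
      · rw [hb, Function.update_self, Function.update_of_ne (hne a ha)] at hab
        have := h2 a ha; omega
      · rw [Function.update_of_ne (hne b hb), Function.update_of_ne (hne a ha)] at hab
        exact h3 a ha b hb hab
    · intro a ha b hb hab hne'
      rw [hL, Finset.mem_insert] at ha hb
      rcases ha with ha | ha <;> rcases hb with hb | hb
      · exact absurd (ha.trans hb.symm) hne'
      · exact absurd (m.isLowerSet hab hb) (by rw [ha]; exact hx)
      · rw [hb, Function.update_self, Function.update_of_ne (hne a ha)]
        exact h2 a ha
      · rw [Function.update_of_ne (hne b hb), Function.update_of_ne (hne a ha)]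
        exact h4 a ha b hb hab hne'⟩

lemma syMap_inj (L : YoungDiagram) : Function.Injective (syMap L) := by
  rintro ⟨⟨m, hm⟩, T, hT⟩ ⟨⟨m', hm'⟩, T', hT'⟩ h
  obtain ⟨hx, hL⟩ := xc_spec hm
  obtain ⟨hx', hL'⟩ := xc_spec hm'
  have hc := (mem_lo.mp hm).2
  have hc' := (mem_lo.mp hm').2
  have h0 : Function.update T (xc L m) m.card = Function.update T' (xc L m') m'.card :=
    congrArg Subtype.val h
  have hxx : xc L m = xc L m' := by
    by_contra hne
    have h1 := congrFun h0 (xc L m)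
    rw [Function.update_self, Function.update_of_ne hne] at h1
    have h2 : xc L m ∈ L.cells := by rw [hL]; simp
    rw [hL', Finset.mem_insert] at h2
    have : T' (xc L m) < m'.card := hT'.2.1 _ (h2.resolve_left hne)
    omega
  have hmm : m = m' := by
    apply YoungDiagram.ext
    rw [← Finset.erase_insert hx, ← hL, hL', hxx, Finset.erase_insert hx']
  subst hmm
  have : T = T' := by
    funext c
    by_cases hcx : c = xc L m
    · rw [hcx, hT.1 _ hx, hT'.1 _ hx]
    · have := congrFun h0 c
      rwa [Function.update_of_ne hcx, Function.update_of_ne hcx] at this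
  subst this
  rfl

lemma syMap_surj (L : YoungDiagram) (hL0 : 0 < L.card) : Function.Surjective (syMap L) := by
  rintro ⟨T, h1, h2, h3, h4⟩
  have himg : L.cells.image T = range L.card := by
    apply Finset.eq_of_subset_of_card_le
    · intro y hy
      obtain ⟨c, hc, rfl⟩ := Finset.mem_image.mp hy
      exact Finset.mem_range.mpr (h2 c hc)
    · rw [Finset.card_image_of_injOn (fun a ha b hb hab => h3 a ha b hb hab), Finset.card_range]
  have hl : L.card - 1 ∈ L.cells.image T := by rw [himg, Finset.mem_range]; omega
  obtain ⟨x, hx, hTx⟩ := Finset.mem_image.mp hl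
  let m : YoungDiagram := ⟨L.cells.erase x, by
    intro a b hba ha
    simp only [Finset.coe_erase, Set.mem_sdiff, Finset.mem_coe, Set.mem_singleton_iff] at ha ⊢
    refine ⟨L.isLowerSet hba ha.1, ?_⟩
    rintro rfl
    have h5 := h4 b hx a ha.1 hba (Ne.symm ha.2)
    have h6 := h2 a ha.1
    omega⟩
  have hmc : m.cells = L.cells.erase x := rfl
  have hmcard : L.card = m.card + 1 := by
    rw [YoungDiagram.card, YoungDiagram.card, hmc, Finset.card_erase_add_one hx]
  have hm : m ∈ lo L := mem_lo.mpr ⟨by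
    rw [← YoungDiagram.cells_subset_iff, hmc]; exact Finset.erase_subset _ _, hmcard⟩
  have hxx : xc L m = x := by
    obtain ⟨ha, hb⟩ := xc_spec hm
    by_contra hne
    have : xc L m ∈ L.cells := by rw [hb]; simp
    apply ha
    rw [hmc, Finset.mem_erase]
    exact ⟨hne, this⟩
  have hsub : ∀ c ∈ m.cells, c ∈ L.cells ∧ c ≠ x := by
    intro c hc
    rw [hmc, Finset.mem_erase] at hc
    exact ⟨hc.2, hc.1⟩
  refine ⟨⟨⟨m, hm⟩, Function.update T x 0, ?_, ?_, ?_, ?_⟩, ?_⟩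
  · intro c hc
    by_cases hcx : c = x
    · rw [hcx, Function.update_self]
    · rw [Function.update_of_ne hcx]
      apply h1
      intro h
      exact hc (by rw [hmc, Finset.mem_erase]; exact ⟨hcx, h⟩)
  · intro c hc
    obtain ⟨ha, hb⟩ := hsub c hc
    rw [Function.update_of_ne hb]
    have e1 := h2 c ha
    have e2 : T c ≠ T x := fun h => hb (h3 c ha x hx h)
    simp only
    omega
  · intro a ha b hb hab
    rw [Function.update_of_ne (hsub a ha).2, Function.update_of_ne (hsub b hb).2] at hab
    exact h3 a (hsub a ha).1 b (hsub b hb).1 hab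
  · intro a ha b hb hab hne
    rw [Function.update_of_ne (hsub a ha).2, Function.update_of_ne (hsub b hb).2]
    exact h4 a (hsub a ha).1 b (hsub b hb).1 hab hne
  · apply Subtype.ext
    simp only [syMap]
    rw [hxx, Function.update_idem]
    rw [show m.card = T x by omega, Function.update_eq_self]

noncomputable def d (μ : YoungDiagram) : ℝ := sytCount μ

lemma d_rec (L : YoungDiagram) (h : 0 < L.card) : d L = ∑ m ∈ lo L, d m := by
  have : sytCount L = ∑ m : lo L, sytCount m.1 := by
    rw [sytCount_eq, ← Nat.card_congr (Equiv.ofBijective _ ⟨syMap_inj L, syMap_surj L h⟩), Nat.card_sigma]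
    simp only [sytCount_eq]
  rw [d, this]
  push_cast
  exact Finset.sum_coe_sort (lo L) (fun m => (sytCount m : ℝ))

lemma d_bot : d ⊥ = 1 := by simp [d, syt_bot]

lemma d_nonneg (L : YoungDiagram) : 0 ≤ d L := by simp [d]

lemma card_eq_zero {L : YoungDiagram} (h : L.card = 0) : L = ⊥ := by
  apply YoungDiagram.ext
  rw [YoungDiagram.cells_bot]
  exact Finset.card_eq_zero.mp h

lemma d_pos (L : YoungDiagram) : 0 < d L := by
  induction hn : L.card generalizing L with
  | zero => rw [card_eq_zero hn, d_bot]; exact one_pos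
  | succ n ih =>
    obtain ⟨x, hx, hmax⟩ : ∃ x ∈ L.cells, ∀ y ∈ L.cells, x ≤ y → x = y := by
      have hne : L.cells.Nonempty := Finset.card_pos.mp (by
        have : L.cells.card = n + 1 := hn
        omega)
      obtain ⟨x, hx, h⟩ := Finset.exists_max_image L.cells (fun c => c.1 + c.2) hne
      refine ⟨x, hx, fun y hy hxy => ?_⟩
      have := h y hy
      have h1 : x.1 ≤ y.1 := hxy.1
      have h2 : x.2 ≤ y.2 := hxy.2
      ext <;> omega
    let m : YoungDiagram := ⟨L.cells.erase x, by
      intro a b hba ha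
      simp only [Finset.coe_erase, Set.mem_sdiff, Finset.mem_coe, Set.mem_singleton_iff] at ha ⊢
      refine ⟨L.isLowerSet hba ha.1, ?_⟩
      rintro rfl
      exact ha.2 (hmax a ha.1 hba).symm⟩
    have hmc : m.cells = L.cells.erase x := rfl
    have hmcard : L.card = m.card + 1 := by
      rw [YoungDiagram.card, YoungDiagram.card, hmc, Finset.card_erase_add_one hx]
    have hm : m ∈ lo L := mem_lo.mpr ⟨by
      rw [← YoungDiagram.cells_subset_iff, hmc]; exact Finset.erase_subset _ _, hmcard⟩
    rw [d_rec L (by omega)]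
    exact Finset.sum_pos' (fun i _ => d_nonneg i) ⟨m, hm, ih m (by omega)⟩

/-- weighted up sum -/
noncomputable def f (φ : ℤ → ℝ) (l : YoungDiagram) : ℝ := ∑ L ∈ up l, d L * (S φ L - S φ l)

lemma f_rec (φ : ℤ → ℝ) (l : YoungDiagram) :
    f φ l = d l * (φ 0 + S (Dl φ) l) + ∑ m ∈ lo l, f φ m := by
  have h1 : f φ l = ∑ L ∈ up l, (d l * (S φ L - S φ l) +
      ∑ k ∈ (lo L).erase l, d k * (S φ L - S φ l)) := by
    apply Finset.sum_congr rfl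
    intro L hL
    have hl : l ∈ lo L := mem_lo_iff.mpr hL
    rw [d_rec L (by rw [mem_up] at hL; omega), ← Finset.add_sum_erase _ _ hl, add_mul, Finset.sum_mul]
  have h2 : ∑ m ∈ lo l, f φ m = ∑ m ∈ lo l, (d l * (S φ l - S φ m) +
      ∑ k ∈ (up m).erase l, d k * (S φ (k ⊔ l) - S φ l)) := by
    apply Finset.sum_congr rfl
    intro m hm
    rw [f, ← Finset.add_sum_erase _ _ (mem_lo_iff.mp hm)]
    congr 1
    apply Finset.sum_congr rfl
    intro k hk
    simp only [Finset.mem_erase, mem_up] at hk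
    obtain ⟨h3, h4, h5⟩ := hk
    rw [mem_lo] at hm
    have hs : m = k ⊓ l := by
      apply eq_of_le_card (le_inf h4 hm.1)
      by_contra hcon
      have : k ⊓ l = l := eq_of_le_card inf_le_right (by omega)
      have hk : l ≤ k := by rw [← this]; exact inf_le_left
      exact h3 (eq_of_le_card hk (by omega)).symm
    have := S_sup_inf φ k l
    rw [← hs] at this
    congr 1
    linarith
  have h3 := diamond l (fun L k _ => d k * (S φ L - S φ l))
  rw [h1, h2, Finset.sum_add_distrib, Finset.sum_add_distrib, h3, ← p_identity, ← Finset.mul_sum,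
    ← Finset.mul_sum]
  ring

lemma S_one (l : YoungDiagram) : S (fun _ => 1) l = l.card := by
  simp [S, YoungDiagram.card]

lemma S_zero (l : YoungDiagram) : S (fun _ => 0) l = 0 := by
  simp [S]

lemma f_one (l : YoungDiagram) : f (fun _ => 1) l = ∑ L ∈ up l, d L := by
  apply Finset.sum_congr rfl
  intro L hL
  rw [S_one, S_one, (mem_up.mp hL).2]; push_cast; ring

lemma up_sum (l : YoungDiagram) : ∑ L ∈ up l, d L = (l.card + 1) * d l := by
  induction hn : l.card generalizing l with
  | zero =>
    rw [← f_one, f_rec, show lo l = ∅ by ext m; rw [mem_lo]; simp; omega]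
    have : Dl (fun _ => (1:ℝ)) = fun _ => 0 := by funext x; simp [Dl]; norm_num
    rw [this, S_zero]; simp
  | succ n ih =>
    rw [← f_one, f_rec]
    have : Dl (fun _ => (1:ℝ)) = fun _ => 0 := by funext x; simp [Dl]; norm_num
    rw [this, S_zero, Finset.sum_congr rfl (g := fun m => (n+1 : ℝ) * d m), ← Finset.mul_sum,
      ← d_rec l (by omega)]
    · push_cast; ring
    · intro m hm
      rw [f_one, ih m (by have := (mem_lo.mp hm).2; omega)]

end PL

namespace PL
open Finset
open scoped Classical

noncomputable def E (n : ℕ) (g : YoungDiagram → ℝ) : ℝ := ∑ l ∈ Y n, d l ^ 2 / (n.factorial : ℝ) * g l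

lemma E_add (n : ℕ) (g h : YoungDiagram → ℝ) : E n (fun l => g l + h l) = E n g + E n h := by
  simp only [E, mul_add, Finset.sum_add_distrib]

lemma E_sub (n : ℕ) (g h : YoungDiagram → ℝ) : E n (fun l => g l - h l) = E n g - E n h := by
  simp only [E, mul_sub, Finset.sum_sub_distrib]

lemma E_mul (n : ℕ) (c : ℝ) (g : YoungDiagram → ℝ) : E n (fun l => c * g l) = c * E n g := by
  simp only [E, Finset.mul_sum]
  exact Finset.sum_congr rfl (fun i _ => by ring)

lemma E_sum {ι : Type*} (n : ℕ) (s : Finset ι) (g : ι → YoungDiagram → ℝ) :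
    E n (fun l => ∑ i ∈ s, g i l) = ∑ i ∈ s, E n (g i) := by
  simp only [E, Finset.mul_sum]
  exact Finset.sum_comm

lemma E_mono {n : ℕ} {g h : YoungDiagram → ℝ} (H : ∀ l, l.card = n → g l ≤ h l) : E n g ≤ E n h := by
  apply Finset.sum_le_sum
  intro l hl
  exact mul_le_mul_of_nonneg_left (H l (mem_Y.mp hl)) (by positivity)

lemma E_congr {n : ℕ} {g h : YoungDiagram → ℝ} (H : ∀ l, l.card = n → g l = h l) : E n g = E n h :=
  le_antisymm (E_mono fun l hl => (H l hl).le) (E_mono fun l hl => (H l hl).ge)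

lemma edge_swap (n : ℕ) (G : YoungDiagram → YoungDiagram → ℝ) :
    ∑ L ∈ Y (n+1), ∑ m ∈ lo L, G m L = ∑ m ∈ Y n, ∑ L ∈ up m, G m L := by
  apply Finset.sum_comm'
  intro L m
  rw [mem_Y, mem_lo, mem_up, mem_Y]
  constructor
  · rintro ⟨h1, h2, h3⟩; exact ⟨⟨h2, h3⟩, by omega⟩
  · rintro ⟨⟨h2, h3⟩, h1⟩; exact ⟨by omega, h2, h3⟩

lemma fact_succ (n : ℕ) : ((n+1).factorial : ℝ) = (n+1) * n.factorial := by
  rw [Nat.factorial_succ]; push_cast; ring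

lemma E_succ (n : ℕ) (g : YoungDiagram → ℝ) :
    E (n+1) g = E n (fun m => (∑ L ∈ up m, d L * g L) / ((n+1) * d m)) := by
  have : E (n+1) g = ∑ L ∈ Y (n+1), ∑ m ∈ lo L, d m * (d L * g L) / ((n+1).factorial : ℝ) := by
    apply Finset.sum_congr rfl
    intro L hL
    have h := d_rec L (by rw [mem_Y] at hL; omega)
    rw [← Finset.sum_div, ← Finset.sum_mul, ← h]; ring
  rw [this, edge_swap]
  apply Finset.sum_congr rfl
  intro m hm
  rw [← Finset.sum_div, ← Finset.mul_sum, fact_succ]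
  have := d_pos m
  field_simp

lemma E_one (n : ℕ) : E n (fun _ => 1) = 1 := by
  induction n with
  | zero =>
    have : Y 0 = {⊥} := by
      ext l; rw [mem_Y, Finset.mem_singleton]
      exact ⟨card_eq_zero, by rintro rfl; simp [YoungDiagram.card]⟩
    simp [E, this, d_bot]
  | succ n ih =>
    rw [E_succ]
    refine Eq.trans (E_congr ?_) ih
    intro l hl
    simp only [mul_one]
    rw [up_sum, hl]
    have := d_pos l
    field_simp

lemma E_const (n : ℕ) (c : ℝ) : E n (fun _ => c) = c := by
  have := E_mul n c (fun _ => 1)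
  rw [E_one] at this
  simpa using this

noncomputable def a (φ : ℤ → ℝ) (l : YoungDiagram) : ℝ := f φ l / d l

noncomputable def T (g : YoungDiagram → ℝ) (l : YoungDiagram) : ℝ := (∑ m ∈ lo l, d m * g m) / d l

noncomputable def p (φ : ℤ → ℝ) (l : YoungDiagram) : ℝ := φ 0 + S (Dl φ) l

lemma a_rec (φ : ℤ → ℝ) (l : YoungDiagram) : a φ l = p φ l + T (a φ) l := by
  have h : ∑ m ∈ lo l, d m * a φ m = ∑ m ∈ lo l, f φ m := by
    apply Finset.sum_congr rfl
    intro m _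
    have := d_pos m
    rw [a]
    field_simp
  rw [T, h, a, f_rec, p]
  have := d_pos l
  field_simp

lemma E_T (n : ℕ) (g : YoungDiagram → ℝ) : E (n+1) (T g) = E n g := by
  have : E (n+1) (T g) = ∑ L ∈ Y (n+1), ∑ m ∈ lo L, d m * g m / ((n+1).factorial : ℝ) * d L := by
    apply Finset.sum_congr rfl
    intro L hL
    rw [T, ← Finset.sum_mul, ← Finset.sum_div]
    have := d_pos L
    field_simp
  rw [this, edge_swap]
  apply Finset.sum_congr rfl
  intro m hm
  rw [← Finset.mul_sum, up_sum, fact_succ, mem_Y.mp hm]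
  field_simp

lemma T_sq (g : YoungDiagram → ℝ) (l : YoungDiagram) (h : 0 < l.card) :
    T g l ^ 2 ≤ T (fun m => g m ^ 2) l := by
  rw [T, T, div_pow, div_le_div_iff₀ (by have := d_pos l; positivity) (d_pos l)]
  have h1 : (∑ m ∈ lo l, d m * g m) ^ 2 ≤ (∑ m ∈ lo l, d m) * ∑ m ∈ lo l, d m * g m ^ 2 := by
    apply Finset.sum_sq_le_sum_mul_sum_of_sq_le_mul
    · intro i _; exact d_nonneg i
    · intro i _; have := d_nonneg i; positivity
    · intro i _; exact le_of_eq (by ring)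
  rw [← d_rec l h] at h1
  have := d_pos l
  nlinarith

lemma T_sub (g : YoungDiagram → ℝ) (c : ℝ) (l : YoungDiagram) (h : 0 < l.card) :
    T (fun m => g m - c) l = T g l - c := by
  rw [T, T]
  simp only [mul_sub, Finset.sum_sub_distrib, ← Finset.sum_mul]
  rw [← d_rec l h]
  have := d_pos l
  field_simp

lemma gronwall (Z : ℕ → ℝ) (C : ℝ) (e : ℕ) (hC : 0 ≤ C) (h0 : Z 0 ≤ C)
    (h : ∀ n : ℕ, Z (n+1) ≤ (n+2) / (n+1) * Z n + C * (n+2)^(e+1)) (n : ℕ) :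
    Z n ≤ C * (n+1)^(e+2) := by
  induction n with
  | zero => simpa using h0
  | succ n ih =>
    push_cast
    rw [show (n:ℝ) + 1 + 1 = n + 2 by ring]
    have hn : (0:ℝ) ≤ n := Nat.cast_nonneg n
    calc Z (n+1) ≤ (n+2) / (n+1) * Z n + C * (n+2)^(e+1) := h n
      _ ≤ (n+2) / (n+1) * (C * (n+1)^(e+2)) + C * (n+2)^(e+1) := by gcongr
      _ = C * (n+2) * ((n+1)^(e+1) + (n+2)^e) := by field_simp; ring
      _ ≤ C * (n+2) * (n+2)^(e+1) := by
        gcongr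
        have : ((n:ℝ)+1)^e ≤ (n+2)^e := by gcongr; norm_num
        calc ((n:ℝ)+1)^(e+1) + (n+2)^e = (n+1) * (n+1)^e + (n+2)^e := by ring
          _ ≤ (n+1) * (n+2)^e + (n+2)^e := by gcongr
          _ = (n+2)^(e+1) := by ring
      _ = C * (n+2)^(e+2) := by ring

lemma card_bot' : (⊥ : YoungDiagram).card = 0 := by simp [YoungDiagram.card]

lemma E_zero (g : YoungDiagram → ℝ) : E 0 g = g ⊥ := by
  have : Y 0 = {⊥} := by
    ext l; rw [mem_Y, Finset.mem_singleton]
    exact ⟨card_eq_zero, by rintro rfl; exact card_bot'⟩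
  simp [E, this, d_bot]

lemma T_bot (g : YoungDiagram → ℝ) : T g ⊥ = 0 := by
  have : lo ⊥ = ∅ := by ext m; rw [mem_lo, card_bot']; simp
  simp [T, this]

lemma S_bot (φ : ℤ → ℝ) : S φ ⊥ = 0 := by simp [S]

lemma edge_sq (φ : ℤ → ℝ) {l L : YoungDiagram} (h : L ∈ up l) :
    (S φ L - S φ l)^2 = S (fun x => φ x ^ 2) L - S (fun x => φ x ^ 2) l := by
  obtain ⟨c, hc, hL⟩ := exists_insert h
  simp only [S, hL, Finset.sum_insert hc]
  ring

lemma E_S_succ (φ : ℤ → ℝ) (n : ℕ) : E (n+1) (S φ) = E n (S φ) + E n (a φ) / (n+1) := by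
  rw [E_succ, div_eq_inv_mul, ← E_mul, ← E_add]
  apply E_congr
  intro l hl
  have : ∑ L ∈ up l, d L * S φ L = f φ l + ((n:ℝ)+1) * d l * S φ l := by
    rw [← hl, ← up_sum, f, Finset.sum_mul, ← Finset.sum_add_distrib]
    exact Finset.sum_congr rfl (fun i _ => by ring)
  rw [this, a]
  have := d_pos l
  field_simp
  ring

lemma E_a_succ (φ : ℤ → ℝ) (n : ℕ) : E (n+1) (a φ) = E (n+1) (p φ) + E n (a φ) := by
  rw [← E_T n (a φ), ← E_add]
  exact E_congr (fun l _ => a_rec φ l)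

lemma Z_step (φ : ℤ → ℝ) (n : ℕ) (s b : ℝ) :
    E (n+1) (fun l => (S φ l - (s + b/(n+1)))^2) ≤
      (n+2)/(n+1) * E n (fun l => (S φ l - s)^2) + (E n (fun l => (a φ l - b)^2)
        + 2 * E n (a (fun x => φ x ^ 2)) + 2 * (b^2/(n+1))) / (n+1) := by
  rw [E_succ]
  have hn : (0:ℝ) < (n:ℝ)+1 := by positivity
  have key : ∀ l : YoungDiagram, l.card = n → (∑ L ∈ up l, d L * (S φ L - (s + b/(n+1)))^2) / ((n+1) * d l)
      ≤ (n+2)/(n+1) * (S φ l - s)^2 + ((n:ℝ)+1)⁻¹ * ((a φ l - b)^2 + (2 * a (fun x => φ x ^ 2) l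
        + 2 * (b^2/(n+1)))) := by
    intro l hl
    have hd := d_pos l
    set β := b/((n:ℝ)+1) with hβ
    have hb : b = (n+1) * β := by rw [hβ]; field_simp
    have h1 : ∑ L ∈ up l, d L * (S φ L - (s + β))^2 ≤
        ∑ L ∈ up l, (d L * ((S φ l - s)^2 - 2 * (S φ l - s) * β + 2 * β^2)
          + 2 * (S φ l - s) * (d L * (S φ L - S φ l))
          + 2 * (d L * (S (fun x => φ x ^ 2) L - S (fun x => φ x ^ 2) l))) := by
      apply Finset.sum_le_sum
      intro L hL
      rw [← edge_sq φ hL]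
      have := d_nonneg L
      nlinarith [mul_nonneg this (sq_nonneg (S φ L - S φ l + β))]
    rw [Finset.sum_add_distrib, Finset.sum_add_distrib, ← Finset.sum_mul, ← Finset.mul_sum,
      ← Finset.mul_sum, up_sum, hl] at h1
    change _ ≤ _ + 2 * (S φ l - s) * f φ l + 2 * f (fun x => φ x ^ 2) l at h1
    have e1 : f φ l = a φ l * d l := by rw [a]; field_simp
    have e2 : f (fun x => φ x ^ 2) l = a (fun x => φ x ^ 2) l * d l := by rw [a]; field_simp
    rw [e1, e2] at h1
    rw [div_le_iff₀ (by positivity)]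
    refine h1.trans ?_
    have e3 : ((n+2)/(n+1) * (S φ l - s)^2 + ((n:ℝ)+1)⁻¹ * ((a φ l - b)^2 + (2 * a (fun x => φ x ^ 2) l
        + 2 * (b^2/(n+1))))) * ((n+1) * d l) = d l * ((n+2) * (S φ l - s)^2 + (a φ l - b)^2 +
          2 * a (fun x => φ x ^ 2) l + 2 * ((n+1) * β^2)) := by
      rw [hb]; field_simp; ring
    rw [e3, hb]
    nlinarith [mul_nonneg hd.le (sq_nonneg ((S φ l - s) - (a φ l - (n+1)*β)))]
  refine (E_mono key).trans (le_of_eq ?_)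
  rw [E_add, E_mul, E_mul, E_add, E_add, E_mul, E_const]
  field_simp
  ring

lemma step (φ : ℤ → ℝ) (e : ℕ) (q b s : ℕ → ℝ) (C : ℝ) (hC : 0 ≤ C)
    (hb0 : b 0 = q 0) (hb : ∀ n, b (n+1) = b n + q (n+1)) (hs0 : s 0 = 0)
    (hs : ∀ n : ℕ, s (n+1) = s n + b n / (n+1))
    (h1 : ∀ n : ℕ, E n (fun l => (p φ l - q n)^2) ≤ C * (n+1)^e)
    (h2 : ∀ n : ℕ, E n (a (fun x => φ x ^ 2)) ≤ C * (n+1)^(e+2))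
    (h3 : ∀ n : ℕ, (b n)^2 ≤ C * (n+1)^(e+3)) :
    ∃ C', 0 ≤ C' ∧ ∀ n : ℕ, E n (fun l => (S φ l - s n)^2) ≤ C' * (n+1)^(e+2) := by
  have hW : ∀ n : ℕ, E n (fun l => (a φ l - b n)^2) ≤ C * (n+1)^(e+2) := by
    apply gronwall (fun n => E n (fun l => (a φ l - b n)^2)) C e hC
    · have := h1 0
      rw [E_zero] at this ⊢
      rw [a_rec, T_bot, hb0]
      simpa using this
    · intro n
      have hn : (0:ℝ) < (n:ℝ)+1 := by positivity
      have key : ∀ l : YoungDiagram, l.card = n+1 → (a φ l - b (n+1))^2 ≤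
          (n+2)/(n+1) * T (fun m => (a φ m - b n)^2) l + (n+2) * (p φ l - q (n+1))^2 := by
        intro l hl
        have e1 := T_sq (fun m => a φ m - b n) l (by omega)
        have e2 := T_sub (a φ) (b n) l (by omega)
        set x := T (fun m => a φ m - b n) l
        have e3 : a φ l - b (n+1) = x + (p φ l - q (n+1)) := by
          rw [a_rec, hb, e2]; ring
        rw [e3]
        set y := p φ l - q (n+1)
        refine le_trans ?_ (add_le_add_left (mul_le_mul_of_nonneg_left e1 (by positivity)) _)
        have : ((n:ℝ)+2)/(n+1) * x^2 + (n+2) * y^2 - (x+y)^2 = (x/(n+1) - y)^2 * (n+1) := by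
          field_simp; ring
        nlinarith [mul_nonneg (sq_nonneg (x/(n+1) - y)) hn.le]
      refine (E_mono key).trans ?_
      rw [E_add, E_mul, E_mul, E_T]
      have := h1 (n+1)
      push_cast at this
      rw [show (n:ℝ)+1+1 = n+2 by ring] at this
      have h4 : ((n:ℝ)+2) * E (n+1) (fun l => (p φ l - q (n+1))^2) ≤ (n+2) * (C * (n+2)^e) := by gcongr
      calc _ ≤ _ + ((n:ℝ)+2) * (C * (n+2)^e) := add_le_add_right h4 _
        _ = _ := by ring
  refine ⟨5 * C, by positivity, ?_⟩
  apply gronwall (fun n => E n (fun l => (S φ l - s n)^2)) (5 * C) e (by positivity)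
  · rw [E_zero, S_bot, hs0]; simpa using hC
  · intro n
    have hn : (0:ℝ) < (n:ℝ)+1 := by positivity
    rw [hs]
    refine (Z_step φ n (s n) (b n)).trans ?_
    gcongr
    rw [div_le_iff₀ hn]
    have h5 : (b n)^2/((n:ℝ)+1) ≤ C * (n+1)^(e+2) := by
      rw [div_le_iff₀ hn]; refine (h3 n).trans (le_of_eq (by ring))
    have h6 : ((n:ℝ)+1)^(e+2) ≤ (n+2)^(e+1) * (n+1) := by
      rw [pow_succ]; gcongr; norm_num
    have := hW n
    have := h2 n
    nlinarith

end PL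

namespace PL
open Finset
open scoped Classical

def mo (k : ℕ) : ℤ → ℝ := fun x => (x : ℝ)^k

noncomputable def co (k j : ℕ) : ℝ := (1 + (-1)^(k+2-j)) * ((k+2).choose j : ℝ)

lemma Dl_mo (k : ℕ) (x : ℤ) : Dl (mo (k+2)) x = ∑ j ∈ range (k+1), co k j * mo j x := by
  simp only [Dl, mo]
  push_cast
  rw [show (x:ℝ) - 1 = x + (-1) by ring, add_pow, add_pow, ← Finset.sum_add_distrib,
    Finset.sum_range_succ, Finset.sum_range_succ]
  simp only [co]
  have h1 : k + 2 - (k+1) = 1 := by omega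
  have h2 : k + 2 - (k+2) = 0 := by omega
  rw [h1, h2]
  simp only [one_pow, Nat.choose_self]
  rw [Finset.sum_congr rfl (g := fun j => (1 + (-1:ℝ)^(k+2-j)) * ((k+2).choose j : ℝ) * (x:ℝ)^j)]
  · push_cast; ring
  · intro j _; ring

lemma co_self (k : ℕ) : co k k = (k+2)*(k+1) := by
  rw [co, show k + 2 - k = 2 by omega, Nat.choose_symm_add, Nat.cast_choose_two]
  push_cast; ring

lemma p_mo (k : ℕ) (l : YoungDiagram) : p (mo (k+2)) l = ∑ j ∈ range (k+1), co k j * S (mo j) l := by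
  rw [p]
  have : mo (k+2) 0 = 0 := by simp [mo]
  rw [this, zero_add, S]
  simp only [Dl_mo]
  rw [Finset.sum_comm]
  simp only [S, Finset.mul_sum]

lemma p_mo_zero (l : YoungDiagram) : p (mo 0) l = 1 := by
  simp [p, S, Dl, mo]; ring

lemma p_mo_one (l : YoungDiagram) : p (mo 1) l = 0 := by
  have : Dl (mo 1) = fun _ => 0 := by funext x; simp [Dl, mo]; ring
  rw [p, this, S_zero]; simp [mo]

lemma fm_step (φ : ℤ → ℝ) (k : ℕ) (C : ℝ) (hC : 0 ≤ C)
    (h : ∀ n : ℕ, |E n (p φ)| ≤ C * √(n+1)^k) (n : ℕ) :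
    |E n (a φ)| ≤ C * √(n+1)^(k+2) ∧ |E n (S φ)| ≤ C * √(n+1)^(k+2) := by
  induction n with
  | zero =>
    have := h 0
    rw [E_zero] at this
    rw [E_zero, E_zero, a_rec, T_bot, S_bot]
    simp at this ⊢
    exact ⟨this, hC⟩
  | succ n ih =>
    obtain ⟨h1, h2⟩ := ih
    have hp := h (n+1)
    rw [E_a_succ, E_S_succ]
    push_cast at hp ⊢
    rw [show (n:ℝ)+1+1 = n+2 by ring] at hp ⊢
    have hn : (0:ℝ) < (n:ℝ)+1 := by positivity
    set ρ := √((n:ℝ)+1) with hρ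
    set σ := √((n:ℝ)+2) with hσ
    have hρ2 : ρ^2 = n+1 := Real.sq_sqrt (by positivity)
    have hσ2 : σ^2 = n+2 := Real.sq_sqrt (by positivity)
    have hρ0 : 0 ≤ ρ := Real.sqrt_nonneg _
    have hle : ρ^k ≤ σ^k := pow_le_pow_left₀ hρ0 (Real.sqrt_le_sqrt (by linarith)) k
    rw [pow_add, hρ2] at h1 h2
    rw [pow_add, hσ2]
    constructor
    · calc |E (n+1) (p φ) + E n (a φ)| ≤ |E (n+1) (p φ)| + |E n (a φ)| := abs_add_le _ _
        _ ≤ C * σ^k + C * (σ^k * (n+1)) := add_le_add hp (h1.trans (by gcongr))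
        _ = C * (σ^k * (n+2)) := by ring
    · calc |E n (S φ) + E n (a φ) / (n+1)| ≤ |E n (S φ)| + |E n (a φ) / (n+1)| := abs_add_le _ _
        _ ≤ C * (σ^k * (n+1)) + C * σ^k := by
          apply add_le_add (h2.trans (by gcongr))
          rw [abs_div, abs_of_pos hn, div_le_iff₀ hn]
          exact h1.trans (by rw [mul_assoc]; gcongr)
        _ = C * (σ^k * (n+2)) := by ring

lemma one_le_rho (n : ℕ) : 1 ≤ √((n:ℝ)+1) := by
  rw [Real.one_le_sqrt]; linarith [Nat.cast_nonneg (α := ℝ) n]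

lemma fm (k : ℕ) : ∃ C, 0 ≤ C ∧ ∀ n : ℕ, |E n (a (mo k))| ≤ C * √(n+1)^(k+2) ∧
    |E n (S (mo k))| ≤ C * √(n+1)^(k+2) := by
  induction k using Nat.strong_induction_on with
  | _ k ih =>
    match k, ih with
    | 0, _ =>
      refine ⟨1, zero_le_one, fm_step (mo 0) 0 1 zero_le_one ?_⟩
      intro n
      rw [show p (mo 0) = fun _ => 1 from funext p_mo_zero, E_one]; simp
    | 1, _ =>
      refine ⟨0, le_rfl, fm_step (mo 1) 1 0 le_rfl ?_⟩
      intro n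
      rw [show p (mo 1) = fun _ => 0 from funext p_mo_one, E_const]; simp
    | k+2, ih =>
      choose! C hC0 hC using ih
      refine ⟨∑ j ∈ range (k+1), |co k j| * C j, ?_, ?_⟩
      · apply Finset.sum_nonneg
        intro j hj
        exact mul_nonneg (abs_nonneg _) (hC0 j (by rw [Finset.mem_range] at hj; omega))
      · apply fm_step (mo (k+2)) (k+2)
        · apply Finset.sum_nonneg
          intro j hj
          exact mul_nonneg (abs_nonneg _) (hC0 j (by rw [Finset.mem_range] at hj; omega))
        · intro n
          rw [show p (mo (k+2)) = _ from funext (p_mo k), E_sum, Finset.sum_mul]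
          refine (Finset.abs_sum_le_sum_abs _ _).trans (Finset.sum_le_sum ?_)
          intro j hj
          rw [Finset.mem_range] at hj
          rw [E_mul, abs_mul, mul_assoc]
          refine mul_le_mul_of_nonneg_left ?_ (abs_nonneg _)
          refine ((hC j (by omega) n).2).trans ?_
          exact mul_le_mul_of_nonneg_left (pow_le_pow_right₀ (one_le_rho n) (by omega)) (hC0 j (by omega))

noncomputable def M : ℕ → ℝ
  | 0 => 1
  | 1 => 0
  | (k+2) => (k+2)*(k+1) / ((k/2 : ℕ) + 2)^2 * M k

noncomputable def t (k n : ℕ) : ℝ := M k * (n.descFactorial (k/2+1) : ℝ)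

lemma df_succ (n m : ℕ) : (n.descFactorial (m+1) : ℝ) = ((n:ℝ) - m) * n.descFactorial m := by
  rw [Nat.descFactorial_succ]
  rcases le_or_gt m n with h | h
  · push_cast [Nat.cast_sub h]; ring
  · rw [Nat.descFactorial_of_lt h]; simp

lemma df_succ_succ (n m : ℕ) : ((n+1).descFactorial (m+1) : ℝ) = ((n:ℝ) + 1) * n.descFactorial m := by
  rw [Nat.succ_descFactorial_succ]; push_cast; ring

lemma t_sq (k : ℕ) (n : ℕ) : (t k n)^2 ≤ (M k)^2 * (n+1)^(k+2) := by
  rw [t, mul_pow]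
  gcongr
  have h1 : (n.descFactorial (k/2+1) : ℝ) ≤ (n+1)^(k/2+1) := by
    have := Nat.descFactorial_le_pow n (k/2+1)
    calc (n.descFactorial (k/2+1) : ℝ) ≤ (n:ℝ)^(k/2+1) := by exact_mod_cast this
      _ ≤ _ := by gcongr; norm_num
  calc (n.descFactorial (k/2+1) : ℝ)^2 ≤ ((n+1)^(k/2+1))^2 := by gcongr
    _ = ((n:ℝ)+1)^(2*(k/2+1)) := by rw [← pow_mul]; ring_nf
    _ ≤ _ := pow_le_pow_right₀ (by linarith [Nat.cast_nonneg (α := ℝ) n]) (by omega)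

lemma sq_bd {k : ℕ} {C : ℝ} (hC : 0 ≤ C)
    (h : ∀ n : ℕ, E n (fun l => (S (mo k) l - t k n)^2) ≤ C * (n+1)^(k+1)) (n : ℕ) :
    E n (fun l => (S (mo k) l)^2) ≤ (2 * C + 2 * (M k)^2) * (n+1)^(k+2) := by
  have h1 : E n (fun l => (S (mo k) l)^2) ≤ E n (fun l => 2 * (S (mo k) l - t k n)^2 + 2 * (t k n)^2) := by
    apply E_mono
    intro l _
    nlinarith [sq_nonneg (S (mo k) l - 2 * t k n)]
  rw [E_add, E_mul, E_const] at h1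
  have h2 : C * ((n:ℝ)+1)^(k+1) ≤ C * (n+1)^(k+2) := by
    gcongr
    · linarith [Nat.cast_nonneg (α := ℝ) n]
    · omega
  have := t_sq k n
  have := h n
  linarith

lemma sq_eq_mo (k : ℕ) : (fun x => mo k x ^ 2) = mo (2*k) := by
  funext x; simp only [mo]; rw [← pow_mul, mul_comm]

lemma fm_sq (k : ℕ) : ∃ C, 0 ≤ C ∧ ∀ n : ℕ, E n (a (fun x => mo k x ^ 2)) ≤ C * (n+1)^(k+1) := by
  obtain ⟨C, hC, h⟩ := fm (2*k)
  refine ⟨C, hC, fun n => ?_⟩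
  rw [sq_eq_mo]
  refine (le_abs_self _).trans ((h n).1.trans (le_of_eq ?_))
  rw [show 2*k+2 = 2*(k+1) by ring, pow_mul, Real.sq_sqrt (by positivity)]

lemma main_L2 (k : ℕ) : ∃ C, 0 ≤ C ∧ ∀ n : ℕ,
    E n (fun l => (S (mo k) l - t k n)^2) ≤ C * (n+1)^(k+1) := by
  induction k using Nat.strong_induction_on with
  | _ k ih =>
    match k, ih with
    | 0, _ =>
      refine ⟨0, le_rfl, fun n => ?_⟩
      have : E n (fun l => (S (mo 0) l - t 0 n)^2) = E n (fun _ => 0) := by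
        apply E_congr
        intro l hl
        have h0 : mo 0 = fun _ => 1 := by funext x; simp [mo]
        rw [h0, S_one, t, M, hl]; simp
      rw [this, E_const]; simp
    | 1, _ =>
      obtain ⟨C, hC, h⟩ := fm_sq 1
      have := step (mo 1) 0 (fun _ => 0) (fun _ => 0) (fun _ => 0) C hC rfl (by simp) rfl (by simp)
        (by intro n; simp only [p_mo_one]; rw [E_const]; simp; positivity) (by simpa using h)
        (by intro n; simp; positivity)
      obtain ⟨C', hC', h'⟩ := this
      refine ⟨C', hC', fun n => ?_⟩
      simpa [t, M] using h' n
    | k+2, ih =>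
      have ih' : ∀ j, ∃ C, 0 ≤ C ∧ (j ≤ k → ∀ n : ℕ,
          E n (fun l => (S (mo j) l - t j n)^2) ≤ C * (n+1)^(j+1)) := by
        intro j
        by_cases hj : j ≤ k
        · obtain ⟨C, hC, h⟩ := ih j (by omega)
          exact ⟨C, hC, fun _ => h⟩
        · exact ⟨0, le_rfl, fun h => absurd h hj⟩
      choose C hC0 hC using ih'
      obtain ⟨C2, hC2, hf⟩ := fm_sq (k+2)
      set Q : ℝ := (k+2)*(k+1) * M k with hQ
      set h := k/2 with hh
      set C1 : ℝ := 2 * ((co k k)^2 * C k) + 2 * (k * ∑ j ∈ range k, (co k j)^2 * (2 * C j + 2 * (M j)^2)) with hC1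
      have hC1' : 0 ≤ C1 := by
        have : 0 ≤ ∑ j ∈ range k, (co k j)^2 * (2 * C j + 2 * (M j)^2) := by
          apply Finset.sum_nonneg
          intro j _
          have := hC0 j
          positivity
        have := hC0 k
        positivity
      have hst := step (mo (k+2)) (k+1) (fun n => (k+2)*(k+1) * t k n)
        (fun n => Q * ((n+1).descFactorial (h+2) : ℝ) / (h+2)) (t (k+2)) (C1 + C2 + Q^2) (by positivity)
        ?_ ?_ ?_ ?_ ?_ ?_ ?_
      · obtain ⟨C', hC', h'⟩ := hst
        exact ⟨C', hC', h'⟩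
      · simp only [t, ← hh]
        rw [df_succ_succ]
        simp
      · intro n
        simp only [t, ← hh]
        rw [df_succ_succ, df_succ_succ, df_succ, hQ]
        push_cast
        field_simp
        rw [df_succ_succ n h]
        ring
      · simp only [t]; simp
      · intro n
        simp only [t, M, ← hh]
        rw [show (k+2)/2 + 1 = h + 2 by omega, df_succ_succ, df_succ n (h+1), hQ]
        push_cast
        field_simp
        ring
      · intro n
        have key : ∀ l : YoungDiagram, l.card = n → (p (mo (k+2)) l - (k+2)*(k+1) * t k n)^2 ≤
            2 * ((co k k)^2 * (S (mo k) l - t k n)^2) +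
            2 * (k * ∑ j ∈ range k, (co k j)^2 * (S (mo j) l)^2) := by
          intro l _
          rw [p_mo, Finset.sum_range_succ, ← co_self]
          have e1 := sq_sum_le_card_mul_sum_sq (s := range k) (f := fun j => co k j * S (mo j) l)
          simp only [mul_pow, Finset.card_range] at e1
          set A := ∑ j ∈ range k, co k j * S (mo j) l
          nlinarith [sq_nonneg (A - co k k * (S (mo k) l - t k n))]
        refine (E_mono key).trans ?_
        rw [E_add, E_mul, E_mul, E_mul, E_mul, E_sum]
        simp only [E_mul]
        have e2 : ∑ j ∈ range k, (co k j)^2 * E n (fun l => (S (mo j) l)^2) ≤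
            (∑ j ∈ range k, (co k j)^2 * (2 * C j + 2 * (M j)^2)) * (n+1)^(k+1) := by
          rw [Finset.sum_mul]
          apply Finset.sum_le_sum
          intro j hj
          rw [Finset.mem_range] at hj
          rw [mul_assoc]
          refine mul_le_mul_of_nonneg_left ((sq_bd (hC0 j) (hC j hj.le) n).trans ?_) (sq_nonneg _)
          have := hC0 j
          refine mul_le_mul_of_nonneg_left (pow_le_pow_right₀ ?_ (by omega)) (by positivity)
          linarith [Nat.cast_nonneg (α := ℝ) n]
        have e3 := hC k le_rfl n
        calc _ ≤ 2 * ((co k k)^2 * (C k * (n+1)^(k+1))) + 2 * (k * ((∑ j ∈ range k, (co k j)^2 * (2 * C j + 2 * (M j)^2)) * (n+1)^(k+1))) := by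
              gcongr
          _ = C1 * (n+1)^(k+1) := by rw [hC1]; ring
          _ ≤ _ := by
            have : 0 ≤ C2 + Q^2 := by positivity
            gcongr
            linarith
      · intro n
        refine (hf n).trans ?_
        gcongr
        have : 0 ≤ Q^2 := by positivity
        linarith
      · intro n
        have e1 : (((n+1).descFactorial (h+2) : ℕ) : ℝ) ≤ (n+1)^(h+2) := by
          exact_mod_cast Nat.descFactorial_le_pow (n+1) (h+2)
        have e2 : ((((n+1).descFactorial (h+2) : ℕ) : ℝ) / (h+2))^2 ≤ (n+1)^(k+1+3) := by
          have e3 : (((n+1).descFactorial (h+2) : ℕ) : ℝ) / (h+2) ≤ (n+1)^(h+2) := by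
            refine (div_le_self (by positivity) ?_).trans e1
            linarith [Nat.cast_nonneg (α := ℝ) h]
          calc _ ≤ (((n:ℝ)+1)^(h+2))^2 := by gcongr
            _ = ((n:ℝ)+1)^(2*(h+2)) := by rw [← pow_mul]; ring_nf
            _ ≤ _ := pow_le_pow_right₀ (by linarith [Nat.cast_nonneg (α := ℝ) n]) (by omega)
        rw [mul_div_assoc, mul_pow]
        calc Q^2 * ((((n+1).descFactorial (h+2) : ℕ) : ℝ) / (h+2))^2 ≤ Q^2 * (n+1)^(k+1+3) := by gcongr
          _ ≤ _ := by gcongr; linarith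

end PL

namespace PL
open Finset
open scoped Classical

lemma addRow_rowLen (l : YoungDiagram) (i : ℕ) (h : Ad l i) :
    (addRow l i).rowLen 0 = l.rowLen 0 + if i = 0 then 1 else 0 := by
  have hc := addRow_cells h
  have key : ∀ j, j < (addRow l i).rowLen 0 ↔ (i = 0 ∧ j = l.rowLen 0) ∨ j < l.rowLen 0 := by
    intro j
    have h1 : (0, j) ∈ (addRow l i).cells ↔ j < (addRow l i).rowLen 0 := mem_cells_iff
    have h2 : (0, j) ∈ l.cells ↔ j < l.rowLen 0 := mem_cells_iff
    rw [← h1, ← h2, hc, Finset.mem_insert, Prod.mk.injEq]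
    constructor
    · rintro (⟨a, b⟩ | a)
      · subst a; exact Or.inl ⟨rfl, b⟩
      · exact Or.inr a
    · rintro (⟨a, b⟩ | a)
      · subst a; exact Or.inl ⟨rfl, b⟩
      · exact Or.inr a
  have k1 := key (l.rowLen 0)
  have k2 := key (l.rowLen 0 + 1)
  have k3 := key ((addRow l i).rowLen 0)
  have k4 := key ((addRow l i).rowLen 0 - 1)
  split_ifs with hi <;> simp only [hi, true_and, false_and, false_or] at k1 k2 k3 k4 <;> (try rw [hi] at *) <;> omega

lemma Ad_zero (l : YoungDiagram) : Ad l 0 := Or.inl rfl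

lemma up_row_sum (l : YoungDiagram) : ∑ L ∈ up l, d L * (L.rowLen 0 : ℝ) =
    (l.card + 1) * d l * l.rowLen 0 + d (addRow l 0) := by
  have h0 : addRow l 0 ∈ up l := by
    rw [up_eq l l.card le_rfl, Finset.mem_image]
    exact ⟨0, by simp [Ad_zero], rfl⟩
  have h1 : ∀ L ∈ up l, d L * (L.rowLen 0 : ℝ) = d L * l.rowLen 0 + if L = addRow l 0 then d L else 0 := by
    intro L hL
    rw [up_eq l l.card le_rfl, Finset.mem_image] at hL
    obtain ⟨i, hi, rfl⟩ := hL
    rw [Finset.mem_filter] at hi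
    rw [addRow_rowLen l i hi.2]
    by_cases h : i = 0
    · subst h; simp; ring
    · have : addRow l i ≠ addRow l 0 := by
        intro hh
        have e1 := addRow_rowLen l i hi.2
        have e2 := addRow_rowLen l 0 (Ad_zero l)
        rw [hh, e2] at e1
        simp [h] at e1
      simp [h, this]
  rw [Finset.sum_congr rfl h1, Finset.sum_add_distrib, ← Finset.sum_mul, up_sum, Finset.sum_ite_eq' , if_pos h0]

lemma add0_inj {l m : YoungDiagram} (h : addRow l 0 = addRow m 0) : l = m := by
  have e1 := addRow_rowLen l 0 (Ad_zero l)
  have e2 := addRow_rowLen m 0 (Ad_zero m)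
  have h0 : l.rowLen 0 = m.rowLen 0 := by rw [h] at e1; simp at e1 e2; omega
  have c1 := addRow_cells (Ad_zero l)
  have c2 := addRow_cells (Ad_zero m)
  have n1 : ((0:ℕ), l.rowLen 0) ∉ l.cells := by rw [mem_cells_iff]; simp
  have n2 : ((0:ℕ), m.rowLen 0) ∉ m.cells := by rw [mem_cells_iff]; simp
  apply YoungDiagram.ext
  rw [← Finset.erase_insert n1, ← Finset.erase_insert n2, ← c1, ← c2, h, h0]

lemma E_d_sum (n : ℕ) : ∑ l ∈ Y n, d l ^ 2 = (n.factorial : ℝ) := by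
  have h := E_one n
  simp only [E, mul_one] at h
  rw [← Finset.sum_div, div_eq_one_iff_eq (by positivity)] at h
  exact h

lemma E_row_succ (n : ℕ) : E (n+1) (fun l => (l.rowLen 0 : ℝ)) ≤
    E n (fun l => (l.rowLen 0 : ℝ)) + 1 / √((n:ℝ)+1) := by
  have hn : (0:ℝ) < (n:ℝ)+1 := by positivity
  set τ := √((n:ℝ)+1) with hτ
  have hτ0 : 0 < τ := Real.sqrt_pos.2 hn
  have hτ2 : τ^2 = n+1 := Real.sq_sqrt hn.le
  rw [E_succ]
  simp only [up_row_sum]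
  have h1 : E n (fun m => (((m.card:ℝ) + 1) * d m * m.rowLen 0 + d (addRow m 0)) / (((n:ℝ)+1) * d m)) =
      E n (fun m => (m.rowLen 0 : ℝ) + d (addRow m 0) / (((n:ℝ)+1) * d m)) := by
    apply E_congr
    intro m hm
    have := d_pos m
    rw [hm]; field_simp
  rw [h1, E_add]
  gcongr
  have h2 : E n (fun m => d (addRow m 0) / (((n:ℝ)+1) * d m)) ≤
      E n (fun m => 1 / (2 * τ) + (d (addRow m 0))^2 * (1 / (2 * τ * (n+1) * (d m)^2))) := by
    apply E_mono
    intro m _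
    have := d_pos m
    rw [← hτ2]
    have : 1 / (2 * τ) + (d (addRow m 0))^2 * (1 / (2 * τ * τ^2 * (d m)^2)) - d (addRow m 0) / (τ^2 * d m)
      = (d (addRow m 0) - τ * d m)^2 / (2 * τ^3 * (d m)^2) := by field_simp; ring
    have : 0 ≤ (d (addRow m 0) - τ * d m)^2 / (2 * τ^3 * (d m)^2) := by positivity
    linarith
  refine h2.trans ?_
  rw [E_add, E_const]
  have h3 : E n (fun m => (d (addRow m 0))^2 * (1 / (2 * τ * (n+1) * (d m)^2))) ≤ 1 / (2 * τ) := by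
    have e : E n (fun m => (d (addRow m 0))^2 * (1 / (2 * τ * (n+1) * (d m)^2))) =
       (∑ m ∈ Y n, (d (addRow m 0))^2) * (1 / (2 * τ * ((n+1) * n.factorial))) := by
      rw [E, Finset.sum_mul]
      apply Finset.sum_congr rfl
      intro m _
      have := d_pos m
      field_simp
    rw [e]
    have h4 : ∑ m ∈ Y n, (d (addRow m 0))^2 ≤ ((n+1) * n.factorial : ℝ) := by
      have : ((n+1) * n.factorial : ℝ) = ((n+1).factorial : ℝ) := by
        rw [Nat.factorial_succ]; push_cast; ring
      rw [this, ← E_d_sum, ← Finset.sum_image (s := Y n) (g := fun m => addRow m 0) (f := fun l => d l ^ 2)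
        (fun a _ b _ h => add0_inj h)]
      apply Finset.sum_le_sum_of_subset_of_nonneg
      · intro L hL
        obtain ⟨m, hm, rfl⟩ := Finset.mem_image.1 hL
        have h0 : addRow m 0 ∈ up m := by
          rw [up_eq m m.card le_rfl, Finset.mem_image]
          exact ⟨0, by simp [Ad_zero], rfl⟩
        rw [mem_Y] at hm ⊢
        rw [(mem_up.1 h0).2, hm]
      · intros; positivity
    calc _ ≤ ((n+1) * n.factorial : ℝ) * (1 / (2 * τ * ((n+1) * n.factorial))) := by gcongr
      _ = _ := by have : (n.factorial:ℝ) ≠ 0 := by positivity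
                  field_simp
  calc _ ≤ 1 / (2*τ) + 1/(2*τ) := by gcongr
    _ = 1/τ := by field_simp; norm_num

lemma E_row_le (n : ℕ) : E n (fun l => (l.rowLen 0 : ℝ)) ≤ 2 * √n := by
  induction n with
  | zero =>
    have : E 0 (fun l => (l.rowLen 0 : ℝ)) = 0 := by
      have hb : ¬ 0 < (⊥ : YoungDiagram).rowLen 0 := by
        intro h
        have : ((0:ℕ),(0:ℕ)) ∈ (⊥ : YoungDiagram).cells := mem_cells_iff.2 h
        simp at this
      rw [E_zero]; simp only [Nat.pos_iff_ne_zero, not_not] at hb; rw [hb]; simp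
    rw [this]; simp
  | succ n ih =>
    have h := E_row_succ n
    have h1 : 1 / √((n:ℝ)+1) ≤ 2 * (√((n:ℝ)+1) - √n) := by
      have hp : 0 < √((n:ℝ)+1) := Real.sqrt_pos.2 (by positivity)
      have s1 : √((n:ℝ)+1)^2 = n+1 := Real.sq_sqrt (by positivity)
      have s2 : √(n:ℝ)^2 = n := Real.sq_sqrt (by positivity)
      rw [div_le_iff₀ hp]
      nlinarith [sq_nonneg (√((n:ℝ)+1) - √n)]
    push_cast
    linarith

end PL

namespace PL
open Finset Filter Topology
open scoped Classical

lemma df_lim (m : ℕ) : Tendsto (fun n : ℕ => (n.descFactorial m : ℝ) / (n:ℝ)^m) atTop (𝓝 1) := by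
  induction m with
  | zero => simp
  | succ m ih =>
    have h1 : Tendsto (fun n : ℕ => 1 - (m:ℝ) / (n:ℝ)) atTop (𝓝 1) := by
      simpa using (tendsto_const_div_atTop_nhds_zero_nat (m:ℝ)).const_sub 1
    have h2 := h1.mul ih
    rw [one_mul] at h2
    refine h2.congr' ?_
    filter_upwards [eventually_gt_atTop 0] with n hn
    have : (n:ℝ) ≠ 0 := by positivity
    rw [df_succ]
    field_simp
    ring

lemma M_even_pos (m : ℕ) : 0 < M (2*m) := by
  induction m with
  | zero => simp [M]
  | succ m ih =>
    rw [show 2*(m+1) = 2*m+2 by ring, M]; positivity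

lemma M_odd (m : ℕ) : M (2*m+1) = 0 := by
  induction m with
  | zero => simp [M]
  | succ m ih =>
    rw [show 2*(m+1)+1 = 2*m+1+2 by ring, M, ih, mul_zero]

noncomputable def X (k n : ℕ) (l : YoungDiagram) : ℝ := S (mo k) l / √(n:ℝ)^(k+2)

lemma t_lim (k : ℕ) : Tendsto (fun n : ℕ => t k n / √(n:ℝ)^(k+2)) atTop (𝓝 (M k)) := by
  rcases Nat.even_or_odd' k with ⟨m, rfl | rfl⟩
  · have := (df_lim (m+1)).const_mul (M (2*m))
    rw [mul_one] at this
    refine this.congr ?_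
    intro n
    rw [t, show 2*m/2+1 = m+1 by omega, show 2*m+2 = 2*(m+1) by ring, pow_mul √(n:ℝ),
      Real.sq_sqrt (by positivity), mul_div_assoc]
  · simp [t, M_odd]

lemma X_lim (k : ℕ) : Tendsto (fun n : ℕ => E n (fun l => (X k n l - M k)^2)) atTop (𝓝 0) := by
  obtain ⟨C, hC, h⟩ := main_L2 k
  have h1 : Tendsto (fun n : ℕ => (2 * C * 2^(k+1)) / (n:ℝ) + 2 * (t k n / √(n:ℝ)^(k+2) - M k)^2) atTop (𝓝 0) := by
    have e1 := tendsto_const_div_atTop_nhds_zero_nat (2 * C * 2^(k+1) : ℝ)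
    have e2 := (((t_lim k).sub_const (M k)).pow 2).const_mul 2
    simpa using e1.add e2
  refine tendsto_of_tendsto_of_tendsto_of_le_of_le' tendsto_const_nhds h1 ?_ ?_
  · filter_upwards with n
    have := E_mono (n := n) (g := fun _ => 0) (h := fun l => (X k n l - M k)^2) (fun l _ => sq_nonneg _)
    rwa [E_const] at this
  · filter_upwards [eventually_gt_atTop 0] with n hn
    have hn' : (0:ℝ) < n := by exact_mod_cast hn
    have hs : 0 < √(n:ℝ) := Real.sqrt_pos.2 hn'
    have key : E n (fun l => (X k n l - M k)^2) ≤ E n (fun l =>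
        (2 / (n:ℝ)^(k+2)) * (S (mo k) l - t k n)^2 + 2 * (t k n / √(n:ℝ)^(k+2) - M k)^2) := by
      apply E_mono
      intro l _
      have e : (n:ℝ)^(k+2) = (√(n:ℝ)^(k+2))^2 := by
        rw [← pow_mul, mul_comm, pow_mul, Real.sq_sqrt hn'.le]
      have e2 : (2 / (n:ℝ)^(k+2)) * (S (mo k) l - t k n)^2 = 2 * (X k n l - t k n / √(n:ℝ)^(k+2))^2 := by
        rw [e, X]; field_simp
      rw [e2]
      nlinarith [sq_nonneg ((X k n l - t k n / √(n:ℝ)^(k+2)) - (t k n / √(n:ℝ)^(k+2) - M k))]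
    refine key.trans ?_
    rw [E_add, E_mul, E_const]
    gcongr
    calc (2 / (n:ℝ)^(k+2)) * E n (fun l => (S (mo k) l - t k n)^2)
        ≤ (2 / (n:ℝ)^(k+2)) * (C * (n+1)^(k+1)) := by gcongr; exact h n
      _ ≤ (2 / (n:ℝ)^(k+2)) * (C * (2*n)^(k+1)) := by
          have : (1:ℝ) ≤ n := by exact_mod_cast hn
          gcongr; linarith
      _ = _ := by rw [mul_pow, pow_succ (n:ℝ) (k+1)]; field_simp

noncomputable def q (m : ℕ) (a x : ℝ) : ℝ := x^(2*m) * (x+2)^2 * (x - a)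

lemma q_nonpos (m : ℕ) {a x : ℝ} (h : x ≤ a) : q m a x ≤ 0 := by
  apply mul_nonpos_of_nonneg_of_nonpos
  · have : 0 ≤ x^(2*m) := by rw [pow_mul]; positivity
    positivity
  · linarith

lemma q_le (m : ℕ) {a x K : ℝ} (ha : 0 ≤ a) (hK : 0 ≤ K) (h : x ≤ K) : q m a x ≤ q m 0 K := by
  rcases le_or_gt x a with h1 | h1
  · refine (q_nonpos m h1).trans ?_
    rw [q, sub_zero]; positivity
  · have hx : 0 ≤ x := by linarith
    have hxa : 0 ≤ x - a := by linarith
    rw [q, q]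
    gcongr

noncomputable def Z (m : ℕ) (a : ℝ) (n : ℕ) (l : YoungDiagram) : ℝ :=
  X (2*m+3) n l + (4-a) * X (2*m+2) n l + (4-4*a) * X (2*m+1) n l - 4*a * X (2*m) n l

lemma Z_eq (m : ℕ) (a : ℝ) {n : ℕ} (hn : 0 < n) (l : YoungDiagram) :
    Z m a n l = (∑ c ∈ l.cells, q m a ((((c.2:ℤ)-c.1 : ℤ):ℝ) / √n)) / n := by
  have hn' : (0:ℝ) < n := by exact_mod_cast hn
  have hs : 0 < √(n:ℝ) := Real.sqrt_pos.2 hn'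
  have hs2 : (n:ℝ) = √(n:ℝ)^2 := (Real.sq_sqrt hn'.le).symm
  have hX : ∀ k, X k n l = ∑ c ∈ l.cells, ((((c.2:ℤ)-c.1 : ℤ):ℝ) / √n)^k / n := by
    intro k
    rw [X, S, Finset.sum_div]
    apply Finset.sum_congr rfl
    intro c _
    rw [mo, div_pow, pow_add, Real.sq_sqrt hn'.le, div_div]
  rw [Z, hX, hX, hX, hX, Finset.mul_sum, Finset.mul_sum, Finset.mul_sum, Finset.sum_div,
    ← Finset.sum_add_distrib, ← Finset.sum_add_distrib, ← Finset.sum_sub_distrib]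
  apply Finset.sum_congr rfl
  intro c _
  rw [q]
  ring

noncomputable def LL (m : ℕ) (a : ℝ) : ℝ := (4-a) * M (2*m+2) - 4*a * M (2*m)

lemma Z_lim (m : ℕ) (a : ℝ) : Tendsto (fun n : ℕ => E n (fun l => (Z m a n l - LL m a)^2)) atTop (𝓝 0) := by
  have h1 : Tendsto (fun n : ℕ => 4 * E n (fun l => (X (2*m+3) n l - M (2*m+3))^2)
      + 4*(4-a)^2 * E n (fun l => (X (2*m+2) n l - M (2*m+2))^2)
      + 4*(4-4*a)^2 * E n (fun l => (X (2*m+1) n l - M (2*m+1))^2)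
      + 4*(4*a)^2 * E n (fun l => (X (2*m) n l - M (2*m))^2)) atTop (𝓝 0) := by
    have := ((((X_lim (2*m+3)).const_mul 4).add ((X_lim (2*m+2)).const_mul (4*(4-a)^2))).add
      ((X_lim (2*m+1)).const_mul (4*(4-4*a)^2))).add ((X_lim (2*m)).const_mul (4*(4*a)^2))
    simpa using this
  refine tendsto_of_tendsto_of_tendsto_of_le_of_le tendsto_const_nhds h1 ?_ ?_
  · intro n
    have := E_mono (n := n) (g := fun _ => 0) (h := fun l => (Z m a n l - LL m a)^2) (fun l _ => sq_nonneg _)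
    rwa [E_const] at this
  · intro n
    simp only []
    rw [← E_mul, ← E_mul, ← E_mul, ← E_mul, ← E_add, ← E_add, ← E_add]
    apply E_mono
    intro l _
    have o1 := M_odd m
    have o3 : M (2*m+3) = 0 := M_odd (m+1)
    rw [Z, LL, o1, o3]
    set x := X (2*m+3) n l
    set y := X (2*m+2) n l - M (2*m+2) with hy
    set z := X (2*m+1) n l
    set w := X (2*m) n l - M (2*m) with hw
    have : x + (4-a) * X (2*m+2) n l + (4-4*a) * z - 4*a * X (2*m) n l - ((4-a) * M (2*m+2) - 4*a * M (2*m))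
      = x + (4-a)*y + (4-4*a)*z - 4*a*w := by rw [hy, hw]; ring
    rw [this]
    have h4 : ∀ A B C D : ℝ, (A+B+C-D)^2 ≤ 4*A^2+4*B^2+4*C^2+4*D^2 := by
      intro A B C D
      nlinarith [sq_nonneg (A-B), sq_nonneg (A-C), sq_nonneg (A+D), sq_nonneg (B-C), sq_nonneg (B+D), sq_nonneg (C+D)]
    have := h4 x ((4-a)*y) ((4-4*a)*z) (4*a*w)
    refine this.trans (le_of_eq ?_)
    simp only [sub_zero]
    ring

lemma Z_small (m r : ℕ) {a K : ℝ} (ha : 0 ≤ a) (hK : 0 ≤ K) {n : ℕ} (hn : 0 < n) (l : YoungDiagram)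
    (hr : (l.rowLen r : ℝ) < a * √n) (h0 : (l.rowLen 0 : ℝ) ≤ K * √n) :
    Z m a n l ≤ (r * K * q m 0 K) / √n := by
  have hn' : (0:ℝ) < n := by exact_mod_cast hn
  have hs : 0 < √(n:ℝ) := Real.sqrt_pos.2 hn'
  have hs2 : (n:ℝ) = √(n:ℝ)^2 := (Real.sq_sqrt hn'.le).symm
  have hB : 0 ≤ q m 0 K := by rw [q, sub_zero]; positivity
  rw [Z_eq m a hn]
  have h1 : ∑ c ∈ l.cells, q m a ((((c.2:ℤ)-c.1 : ℤ):ℝ) / √n) ≤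
      ∑ c ∈ l.cells, if c.1 < r then q m 0 K else 0 := by
    apply Finset.sum_le_sum
    intro c hc
    have hc' := mem_cells_iff.1 hc
    have hxx : (((c.2:ℤ)-c.1 : ℤ):ℝ) ≤ l.rowLen c.1 := by
      push_cast
      have : (c.2:ℝ) ≤ l.rowLen c.1 := by exact_mod_cast hc'.le
      linarith [Nat.cast_nonneg (α := ℝ) c.1]
    split_ifs with h
    · apply q_le m ha hK
      rw [div_le_iff₀ hs]
      have : (l.rowLen c.1 : ℝ) ≤ l.rowLen 0 := by exact_mod_cast l.rowLen_anti _ _ (Nat.zero_le _)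
      linarith
    · apply q_nonpos
      rw [div_le_iff₀ hs]
      have : (l.rowLen c.1 : ℝ) ≤ l.rowLen r := by exact_mod_cast l.rowLen_anti _ _ (not_lt.1 h)
      linarith
  have h2 : (∑ c ∈ l.cells, if c.1 < r then q m 0 K else 0) ≤ (r * l.rowLen 0 : ℝ) * q m 0 K := by
    rw [← Finset.sum_filter, Finset.sum_const, nsmul_eq_mul]
    gcongr
    have : (l.cells.filter (fun c => c.1 < r)) ⊆ range r ×ˢ range (l.rowLen 0) := by
      intro c hc
      rw [Finset.mem_filter] at hc
      have hc' := mem_cells_iff.1 hc.1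
      have := l.rowLen_anti 0 c.1 (Nat.zero_le _)
      simp only [Finset.mem_product, Finset.mem_range]
      omega
    have := Finset.card_le_card this
    rw [Finset.card_product, Finset.card_range, Finset.card_range] at this
    exact_mod_cast this
  calc _ ≤ ((r * (K * √n) : ℝ) * q m 0 K) / n := by
        gcongr
        refine (h1.trans h2).trans ?_
        gcongr
    _ = _ := by
        nth_rewrite 2 [hs2]
        field_simp

lemma E_lower (m r : ℕ) {a K : ℝ} (ha : 0 ≤ a) (hK : 0 < K) (hL : 0 < LL m a) :
    ∀ᶠ n : ℕ in atTop, a * (1 - 2 / K - 4 / (LL m a)^2 * E n (fun l => (Z m a n l - LL m a)^2)) ≤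
      E n (fun l => (l.rowLen r : ℝ)) / √n := by
  have hsq : Tendsto (fun n : ℕ => √(n:ℝ)) atTop atTop :=
    Real.tendsto_sqrt_atTop.comp tendsto_natCast_atTop_atTop
  have h1 : Tendsto (fun n : ℕ => (r * K * q m 0 K) / √(n:ℝ)) atTop (𝓝 0) := hsq.const_div_atTop _
  filter_upwards [eventually_gt_atTop 0, h1.eventually (gt_mem_nhds (half_pos hL))] with n hn hlt
  have hn' : (0:ℝ) < n := by exact_mod_cast hn
  have hs : 0 < √(n:ℝ) := Real.sqrt_pos.2 hn'
  rw [le_div_iff₀ hs]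
  have key : E n (fun l => a * √n + (- (a / K)) * (l.rowLen 0 : ℝ) + (-(a * √n * (4 / (LL m a)^2))) * (Z m a n l - LL m a)^2)
      ≤ E n (fun l => (l.rowLen r : ℝ)) := by
    apply E_mono
    intro l _
    have hr0 : (0:ℝ) ≤ l.rowLen r := by positivity
    have t1 : 0 ≤ (a / K) * (l.rowLen 0 : ℝ) := by positivity
    have t2 : 0 ≤ (a * √n * (4 / (LL m a)^2)) * (Z m a n l - LL m a)^2 := by positivity
    by_cases c1 : a * √n ≤ l.rowLen r
    · linarith
    by_cases c2 : (l.rowLen 0 : ℝ) ≤ K * √n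
    · have hz := Z_small m r ha hK.le hn l (not_le.1 c1) c2
      have : 1 ≤ (4 / (LL m a)^2) * (Z m a n l - LL m a)^2 := by
        rw [div_mul_eq_mul_div, one_le_div (by positivity)]
        nlinarith
      have : a * √n * 1 ≤ a * √n * ((4 / (LL m a)^2) * (Z m a n l - LL m a)^2) := by gcongr
      linarith
    · have : a * √n ≤ (a / K) * (l.rowLen 0 : ℝ) := by
        calc a * √n = (a / K) * (K * √n) := by field_simp
          _ ≤ _ := by gcongr; exact (not_le.1 c2).le
      linarith
  rw [E_add, E_add, E_const, E_mul, E_mul] at key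
  have hE := E_row_le n
  have : (a / K) * E n (fun l => (l.rowLen 0 : ℝ)) ≤ (a/K) * (2 * √n) := by gcongr
  have e : a * (1 - 2 / K - 4 / (LL m a)^2 * E n (fun l => (Z m a n l - LL m a)^2)) * √n =
      a * √n - (a/K) * (2 * √n) - (a * √n * (4 / (LL m a)^2)) * E n (fun l => (Z m a n l - LL m a)^2) := by
    ring
  rw [e]
  linarith

lemma exists_m {ε : ℝ} (h0 : 0 < ε) (h1 : ε ≤ 1) : ∃ m : ℕ, 0 < LL m (2 - ε) := by
  obtain ⟨m, hm⟩ := exists_nat_gt (8 / ε)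
  refine ⟨m, ?_⟩
  rw [div_lt_iff₀ h0] at hm
  have hp := M_even_pos m
  have hm1 : (1:ℝ) ≤ m := by
    by_contra hh
    have : (m:ℝ) = 0 := by
      have : m = 0 := by
        by_contra h3
        exact hh (by exact_mod_cast Nat.one_le_iff_ne_zero.2 h3)
      simp [this]
    rw [this] at hm; linarith
  rw [LL, M, show 2*m/2 = m by omega]
  push_cast
  have : (4 - (2-ε)) * ((2*(m:ℝ)+2)*(2*m+1) / ((m:ℝ)+2)^2 * M (2*m)) - 4*(2-ε) * M (2*m)
    = M (2*m) * (((2+ε)*((2*(m:ℝ)+2)*(2*m+1)) - 4*(2-ε)*((m:ℝ)+2)^2) / ((m:ℝ)+2)^2) := by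
    field_simp; ring
  rw [this]
  have : 0 < (2+ε)*((2*(m:ℝ)+2)*(2*m+1)) - 4*(2-ε)*((m:ℝ)+2)^2 := by
    nlinarith [mul_le_mul_of_nonneg_right hm.le (by linarith : (0:ℝ) ≤ m)]
  positivity

lemma main_ev (r : ℕ) {ε : ℝ} (h0 : 0 < ε) (h1 : ε ≤ 1) :
    ∀ᶠ n : ℕ in atTop, 2 - 4 * ε ≤ E n (fun l => (l.rowLen r : ℝ)) / √n := by
  obtain ⟨m, hm⟩ := exists_m h0 h1
  have hl := E_lower m r (a := 2 - ε) (K := 2/ε) (by linarith) (by positivity) hm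
  have hz := ((Z_lim m (2-ε)).const_mul ((2-ε) * (4 / (LL m (2-ε))^2)))
  rw [mul_zero] at hz
  filter_upwards [hl, hz.eventually (gt_mem_nhds h0)] with n e1 e2
  refine le_trans ?_ e1
  have : 2 / (2/ε) = ε := by field_simp
  rw [this]
  nlinarith

lemma tsum_eq_E (n : ℕ) (g : YoungDiagram → ℝ) :
    (∑' μ : YoungDiagram, plancherelProb n μ * g μ) = E n g := by
  rw [tsum_eq_sum (s := Y n)]
  · rw [E]
    apply Finset.sum_congr rfl
    intro l hl
    rw [mem_Y] at hl
    rw [plancherelProb, if_pos hl, d]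
  · intro l hl
    rw [mem_Y] at hl
    rw [plancherelProb, if_neg hl, zero_mul]

end PL

/-- If `λ⁽ⁿ⁾` is a Plancherel-distributed random Young diagram with `n` boxes, then for each
fixed row index `r` we have `liminf_{n→∞} 𝔼[λ⁽ⁿ⁾_r] / √n ≥ 2`; the expectation of the length
of row `r` is written as `∑'_μ Pl_n(μ) · μ.rowLen r`. -/
theorem plancherel_expectation_row_liminf (r : ℕ) :
    2 ≤ Filter.liminf
      (fun n : ℕ => (∑' μ : YoungDiagram, plancherelProb n μ * (μ.rowLen r : ℝ)) / Real.sqrt n)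
      atTop := by
  simp only [PL.tsum_eq_E]
  have hub : ∀ n : ℕ, PL.E n (fun l => (l.rowLen r : ℝ)) / √(n:ℝ) ≤ 2 := by
    intro n
    apply div_le_of_le_mul₀ (Real.sqrt_nonneg _) (by norm_num)
    refine le_trans (PL.E_mono ?_) (PL.E_row_le n)
    intro l _
    exact_mod_cast l.rowLen_anti _ _ (Nat.zero_le _)
  have hcob : Filter.IsCoboundedUnder (· ≥ ·) Filter.atTop (fun n : ℕ => PL.E n (fun l => (l.rowLen r : ℝ)) / √(n:ℝ)) :=
    (Filter.isBoundedUnder_of ⟨2, hub⟩ : Filter.IsBoundedUnder (· ≤ ·) _ _).isCoboundedUnder_ge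
  apply le_of_forall_pos_sub_le
  intro δ hδ
  set ε := min 1 (δ/4) with hε
  have he0 : 0 < ε := lt_min one_pos (by positivity)
  have he1 : ε ≤ 1 := min_le_left _ _
  have he2 : ε ≤ δ/4 := min_le_right _ _
  apply Filter.le_liminf_of_le hcob
  filter_upwards [PL.main_ev r he0 he1] with n hn
  linarith
end

section
/- For each r ∈ ℕ_0, the probability that in the Plancherel growth process the box added at step n lies in row r satisfies lim_{n→∞} √n · ℙ(E_r^{(n)}) = 1. -/
open MeasureTheory Filter

/-- `lam 0 ↗ lam 1 ↗ ⋯` is a Plancherel growth process: the probability of any prescribed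
initial path `∅ = μ⁽⁰⁾ ↗ μ⁽¹⁾ ↗ ⋯ ↗ μ⁽ⁿ⁾` in the Young graph equals `d_{μ⁽ⁿ⁾} / n!`,
which characterizes the distribution of the sequence of RSK shapes of an i.i.d. uniform
sequence. -/
def IsPlancherelGrowthProcess {Ω : Type*} [MeasurableSpace Ω] (P : Measure Ω)
    (lam : ℕ → Ω → YoungDiagram) : Prop :=
  IsProbabilityMeasure P ∧
  (∀ (n : ℕ) (y : YoungDiagram), MeasurableSet {ω | lam n ω = y}) ∧
  ∀ (n : ℕ) (path : ℕ → YoungDiagram), path 0 = ⊥ →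
    (∀ i, i < n → path i ≤ path (i + 1) ∧ (path (i + 1)).card = (path i).card + 1) →
    P {ω | ∀ i ≤ n, lam i ω = path i} =
      (sytCount (path n) : ENNReal) / (Nat.factorial n : ENNReal)

/-- The event `E_r⁽ⁿ⁺¹⁾` that the box added in step `n+1` of the growth process
(i.e. the unique box of `λ⁽ⁿ⁺¹⁾ ∖ λ⁽ⁿ⁾`) lies in the row with index `r`. -/
def growthEvent {Ω : Type*} (lam : ℕ → Ω → YoungDiagram) (n r : ℕ) : Set Ω :=
  {ω | (lam (n + 1) ω).rowLen r = (lam n ω).rowLen r + 1}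

namespace PGP

open scoped Classical

theorem finite_card (n : ℕ) : {μ : YoungDiagram | μ.card = n}.Finite := by
  have hinj : Set.InjOn (fun μ : YoungDiagram => μ.cells) {μ : YoungDiagram | μ.card = n} := by
    intro a _ b _ h
    exact YoungDiagram.ext h
  refine Set.Finite.of_finite_image ?_ hinj
  refine Set.Finite.subset
    (Finset.finite_toSet (Finset.powerset (Finset.range n ×ˢ Finset.range n))) ?_
  rintro _ ⟨μ, hμ, rfl⟩
  simp only [Set.mem_ofPred_eq] at hμ
  simp only [Finset.coe_powerset, Set.mem_preimage, Set.mem_powerset_iff, Finset.coe_subset]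
  rintro ⟨i, j⟩ hij
  have h1 : (Finset.range (i+1)).image (fun a => (a, j)) ⊆ μ.cells := by
    intro x hx
    simp only [Finset.mem_image, Finset.mem_range] at hx
    obtain ⟨a, ha, rfl⟩ := hx
    exact μ.isLowerSet (a := (i, j)) (b := (a, j)) ⟨by simpa using by omega, le_rfl⟩ hij
  have h2 : (Finset.range (j+1)).image (fun a => (i, a)) ⊆ μ.cells := by
    intro x hx
    simp only [Finset.mem_image, Finset.mem_range] at hx
    obtain ⟨a, ha, rfl⟩ := hx
    exact μ.isLowerSet (a := (i, j)) (b := (i, a)) ⟨le_rfl, by simpa using by omega⟩ hij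
  have h1' := Finset.card_le_card h1
  have h2' := Finset.card_le_card h2
  rw [Finset.card_image_of_injective _ (by intro a b h; simpa using h), Finset.card_range] at h1' h2'
  have : μ.cells.card = n := hμ
  simp only [Finset.mem_product, Finset.mem_range]
  omega

/-- Diagrams with `n` boxes. -/
noncomputable def Y (n : ℕ) : Finset YoungDiagram := (finite_card n).toFinset

theorem mem_Y {n : ℕ} {μ : YoungDiagram} : μ ∈ Y n ↔ μ.card = n := by
  simp [Y]

/-- Tableaux as functions on the whole plane. -/
def SY (ν : YoungDiagram) : Set (ℕ × ℕ → ℕ) :=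
  {T | (∀ x, x ∉ ν.cells → T x = 0) ∧ (∀ x ∈ ν.cells, T x < ν.card) ∧
    (∀ x ∈ ν.cells, ∀ y ∈ ν.cells, T x = T y → x = y) ∧
    ∀ a ∈ ν.cells, ∀ b ∈ ν.cells, a.1 ≤ b.1 → a.2 ≤ b.2 → a ≠ b → T a < T b}

theorem sytCount_eq (ν : YoungDiagram) : sytCount ν = Nat.card (SY ν) := by
  unfold sytCount
  refine Nat.card_congr ?_
  refine Equiv.ofBijective
    (fun T => ⟨fun x => if h : x ∈ ν.cells then (T.1 ⟨x, h⟩ : ℕ) else 0, ?_⟩) ⟨?_, ?_⟩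
  · obtain ⟨T, hb, hm⟩ := T
    refine ⟨?_, ?_, ?_, ?_⟩
    · intro x hx; simp [hx]
    · intro x hx; simp [hx]
    · intro x hx y hy h
      simp only [hx, hy, dif_pos] at h
      have := hb.1 (Fin.ext h)
      simpa using this
    · intro a ha b hb' h1 h2 h3
      simp only [ha, hb', dif_pos]
      exact hm ⟨a, ha⟩ ⟨b, hb'⟩ h1 h2 (by simpa using h3)
  · rintro ⟨T, hb, hm⟩ ⟨T', hb', hm'⟩ h
    simp only [Subtype.mk.injEq] at h
    apply Subtype.ext
    funext x
    have := congrFun h x.1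
    simp only [x.2, dif_pos] at this
    exact Fin.ext this
  · rintro ⟨T, h0, h1, h2, h3⟩
    refine ⟨⟨fun x => ⟨T x, h1 x x.2⟩, ?_, ?_⟩, ?_⟩
    · rw [Fintype.bijective_iff_injective_and_card]
      refine ⟨?_, by simp [YoungDiagram.card]⟩
      intro x y hxy
      exact Subtype.ext (h2 x x.2 y y.2 (by simpa using hxy))
    · intro a b ha hb hab
      exact h3 a a.2 b b.2 ha hb (fun h => hab (Subtype.ext h))
    · apply Subtype.ext
      funext x
      by_cases hx : x ∈ ν.cells
      · simp [hx]
      · simp [hx, h0 x hx]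

theorem sytCount_bot : sytCount ⊥ = 1 := by
  rw [sytCount_eq, Nat.card_eq_one_iff_unique]
  constructor
  · constructor
    rintro ⟨T, h0, -⟩ ⟨T', h0', -⟩
    apply Subtype.ext
    funext x
    simp [h0 x (by simp), h0' x (by simp)]
  · refine ⟨⟨fun _ => 0, ?_⟩⟩
    refine ⟨?_, ?_, ?_, ?_⟩ <;> simp

theorem exists_box {κ ν : YoungDiagram} (h : κ ≤ ν) (hc : ν.card = κ.card + 1) :
    ∃ b, b ∉ κ.cells ∧ b ∈ ν.cells ∧ ν.cells \ κ.cells = {b} ∧ ν.cells = insert b κ.cells := by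
  have h' : κ.cells ⊆ ν.cells := h
  have h1 : (ν.cells \ κ.cells).card = 1 := by
    rw [Finset.card_sdiff_of_subset h']
    have : ν.cells.card = κ.cells.card + 1 := hc
    omega
  obtain ⟨b, hb⟩ := Finset.card_eq_one.1 h1
  have hb' : b ∈ ν.cells \ κ.cells := by rw [hb]; simp
  rw [Finset.mem_sdiff] at hb'
  refine ⟨b, hb'.2, hb'.1, hb, ?_⟩
  rw [← Finset.sdiff_union_of_subset h', hb]; rfl

theorem sytCount_succ {n : ℕ} {ν : YoungDiagram} (hν : ν.card = n + 1) :
    sytCount ν = ∑ κ ∈ (Y n).filter (· ≤ ν), sytCount κ := by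
  simp only [sytCount_eq]
  rw [← Finset.sum_coe_sort]
  have hfin : ∀ κ : YoungDiagram, Finite (SY κ) := by
    intro κ
    by_contra hcon
    rw [not_finite_iff_infinite] at hcon
    have : Function.Injective
      (fun T : SY κ => (fun x : κ.cells => (⟨T.1 x, T.2.2.1 x x.2⟩ : Fin κ.card))) := by
      rintro ⟨T, h0, h1⟩ ⟨T', h0', h1'⟩ h
      apply Subtype.ext
      funext x
      by_cases hx : x ∈ κ.cells
      · have := congrFun h ⟨x, hx⟩
        simpa using this
      · simp [h0 x hx, h0' x hx]
    exact not_finite_iff_infinite.2 hcon (Finite.of_injective _ this)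
  rw [← Nat.card_sigma]
  symm
  refine Nat.card_congr ?_
  refine Equiv.ofBijective
    (fun p => ⟨fun x => if x ∈ ν.cells \ p.1.1.cells then n else p.2.1 x, ?_⟩) ⟨?_, ?_⟩
  · obtain ⟨⟨κ, hκ⟩, T, h0, h1, h2, h3⟩ := p
    rw [Finset.mem_filter, mem_Y] at hκ
    obtain ⟨b, hbκ, hbν, hb, hins⟩ := exists_box hκ.2 (by omega)
    rw [hκ.1] at h1
    simp only [hb, Finset.mem_singleton]
    refine ⟨?_, ?_, ?_, ?_⟩ <;> beta_reduce
    · intro x hx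
      have hxb : x ≠ b := by rintro rfl; exact hx hbν
      rw [if_neg hxb]
      exact h0 x (fun h => hx (hκ.2 h))
    · intro x hx
      rw [hν]
      split_ifs with hxb
      · omega
      · have : x ∈ κ.cells := by rw [hins] at hx; simpa [hxb] using hx
        have := h1 x this
        omega
    · intro x hx y hy hxy
      rw [hins, Finset.mem_insert] at hx hy
      rcases hx with rfl | hx
      · rcases hy with rfl | hy
        · rfl
        · have hne : y ≠ x := by rintro rfl; exact hbκ hy
          rw [if_pos rfl, if_neg hne] at hxy
          have := h1 y hy
          omega
      · have hne : x ≠ b := by rintro rfl; exact hbκ hx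
        rcases hy with rfl | hy
        · rw [if_pos rfl, if_neg hne] at hxy
          have := h1 x hx
          omega
        · have hne' : y ≠ b := by rintro rfl; exact hbκ hy
          rw [if_neg hne, if_neg hne'] at hxy
          exact h2 x hx y hy hxy
    · intro x hx y hy hxy1 hxy2 hxy
      rw [hins, Finset.mem_insert] at hx hy
      rcases hx with rfl | hx
      · rcases hy with rfl | hy
        · exact absurd rfl hxy
        · exact absurd (κ.isLowerSet (a := y) (b := x) ⟨hxy1, hxy2⟩ hy) hbκ
      · have hne : x ≠ b := by rintro rfl; exact hbκ hx
        rcases hy with rfl | hy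
        · rw [if_pos rfl, if_neg hne]
          exact h1 x hx
        · have hne' : y ≠ b := by rintro rfl; exact hbκ hy
          rw [if_neg hne, if_neg hne']
          exact h3 x hx y hy hxy1 hxy2 hxy
  · rintro ⟨⟨κ, hκ⟩, T, hT⟩ ⟨⟨κ', hκ'⟩, T', hT'⟩ h
    simp only [Subtype.mk.injEq] at h
    have hk := hκ
    have hk' := hκ'
    rw [Finset.mem_filter, mem_Y] at hk hk'
    obtain ⟨b, hbκ, hbν, hb, hins⟩ := exists_box hk.2 (by omega)
    obtain ⟨b', hbκ', hbν', hb', hins'⟩ := exists_box hk'.2 (by omega)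
    simp only [hb, hb', Finset.mem_singleton] at h
    have hbb : b = b' := by
      by_contra hne
      have := congrFun h b
      rw [if_pos rfl, if_neg hne] at this
      have hm : b ∈ κ'.cells := by rw [hins'] at hbν; simpa [hne] using hbν
      have : T' b < κ'.card := hT'.2.1 b hm
      omega
    subst hbb
    have hκκ : κ = κ' := by
      apply YoungDiagram.ext
      rw [← Finset.erase_insert hbκ, ← hins, hins', Finset.erase_insert hbκ']
    subst hκκ
    have : T = T' := by
      funext x
      by_cases hx : x = b
      · subst hx
        rw [hT.1 x hbκ, hT'.1 x hbκ]
      · have := congrFun h x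
        rwa [if_neg hx, if_neg hx] at this
    subst this
    rfl
  · rintro ⟨T, h0, h1, h2, h3⟩
    have hex : ∃ b ∈ ν.cells, T b = n := by
      have := Finset.surjOn_of_injOn_of_card_le (s := ν.cells) (t := Finset.range (n+1)) T
        (by intro x hx; have := h1 x hx; simp only [Finset.coe_range, Set.mem_Iio]; omega)
        (by intro x hx y hy h; exact h2 x hx y hy h)
        (by rw [Finset.card_range]; exact hν.symm.le)
      obtain ⟨b, hb, hbn⟩ := this (show n ∈ ((Finset.range (n+1) : Finset ℕ) : Set ℕ) by simp)
      exact ⟨b, hb, hbn⟩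
    obtain ⟨b, hb, hbn⟩ := hex
    let κ : YoungDiagram := ⟨ν.cells.erase b, by
      intro x y hyx hx
      simp only [Finset.coe_erase, Set.mem_sdiff, Finset.mem_coe, Set.mem_singleton_iff] at hx ⊢
      refine ⟨ν.isLowerSet hyx hx.1, ?_⟩
      rintro rfl
      have := h3 y hb x hx.1 hyx.1 hyx.2 (Ne.symm hx.2)
      have := h1 x hx.1
      omega⟩
    have hκc : κ.cells = ν.cells.erase b := rfl
    have hκn : κ.card = n := by
      change κ.cells.card = n
      rw [hκc, Finset.card_erase_of_mem hb]
      change ν.card - 1 = n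
      omega
    have hκν : κ ≤ ν := Finset.erase_subset _ _
    have hdiff : ν.cells \ κ.cells = {b} := by
      ext x
      simp only [hκc, Finset.mem_sdiff, Finset.mem_erase, Finset.mem_singleton]
      constructor
      · tauto
      · rintro rfl; simp [hb]
    refine ⟨⟨⟨κ, ?_⟩, ⟨fun x => if x = b then 0 else T x, ?_, ?_, ?_, ?_⟩⟩, ?_⟩
    · rw [Finset.mem_filter, mem_Y]; exact ⟨hκn, hκν⟩
    · intro x hx
      simp only
      split_ifs with hxb
      · rfl
      · refine h0 x (fun h => hx ?_)
        rw [hκc]; simp [hxb, h]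
    · intro x hx
      simp only [hκc, Finset.mem_erase] at hx
      simp only [hκn, if_neg hx.1]
      have := h1 x hx.2
      have : T x ≠ n := fun h => hx.1 (h2 x hx.2 b hb (by rw [h, hbn]))
      omega
    · intro x hx y hy hxy
      simp only [hκc, Finset.mem_erase] at hx hy
      simp only [if_neg hx.1, if_neg hy.1] at hxy
      exact h2 x hx.2 y hy.2 hxy
    · intro x hx y hy
      simp only [hκc, Finset.mem_erase] at hx hy
      simp only [if_neg hx.1, if_neg hy.1]
      exact h3 x hx.2 y hy.2
    · apply Subtype.ext
      funext x
      simp only [hdiff, Finset.mem_singleton]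
      split_ifs with hxb
      · rw [hxb, hbn]
      · rfl

end PGP

namespace PGP
open scoped Classical

/-- dimension -/
noncomputable def f (κ : YoungDiagram) : ℝ := (sytCount κ : ℝ)

/-- upper neighbours -/
noncomputable def up (n : ℕ) (κ : YoungDiagram) : Finset YoungDiagram := (Y n).filter (κ ≤ ·)
/-- lower neighbours -/
noncomputable def dn (n : ℕ) (κ : YoungDiagram) : Finset YoungDiagram := (Y n).filter (· ≤ κ)
/-- weight of a skew shape -/
noncomputable def wt (w : ℕ × ℕ → ℝ) (κ ν : YoungDiagram) : ℝ := ∑ b ∈ ν.cells \ κ.cells, w b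

theorem mem_up {n : ℕ} {κ ν : YoungDiagram} : ν ∈ up n κ ↔ ν.card = n ∧ κ ≤ ν := by
  simp [up, mem_Y]
theorem mem_dn {n : ℕ} {κ ν : YoungDiagram} : ν ∈ dn n κ ↔ ν.card = n ∧ ν ≤ κ := by
  simp [dn, mem_Y]

theorem f_nonneg (κ : YoungDiagram) : 0 ≤ f κ := Nat.cast_nonneg _

theorem f_bot : f ⊥ = 1 := by simp [f, sytCount_bot]

theorem f_dn {n : ℕ} {ν : YoungDiagram} (hν : ν.card = n + 1) : ∑ κ ∈ dn n ν, f κ = f ν := by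
  unfold f dn
  rw [sytCount_succ hν]
  push_cast
  rfl

theorem Y_zero : Y 0 = {⊥} := by
  ext κ
  rw [mem_Y, Finset.mem_singleton]
  constructor
  · intro h
    apply YoungDiagram.ext
    simpa using Finset.card_eq_zero.1 h
  · rintro rfl; rfl

theorem sum_swap (n m : ℕ) (F : YoungDiagram → YoungDiagram → ℝ) :
    ∑ ν ∈ Y m, ∑ κ ∈ dn n ν, F κ ν = ∑ κ ∈ Y n, ∑ ν ∈ up m κ, F κ ν := by
  refine Finset.sum_comm' ?_
  intro x y
  simp only [mem_Y, mem_up, mem_dn]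
  tauto

theorem sum_up_dn (m n : ℕ) (κ : YoungDiagram) (F : YoungDiagram → YoungDiagram → ℝ) :
    ∑ ν ∈ up m κ, ∑ l ∈ dn n ν, F ν l
      = ∑ l ∈ Y n, ∑ ν ∈ (Y m).filter (fun ν => κ ≤ ν ∧ l ≤ ν), F ν l := by
  refine Finset.sum_comm' ?_
  intro x y
  simp only [mem_Y, mem_up, mem_dn, Finset.mem_filter]
  tauto

theorem sum_dn_up (m n : ℕ) (κ : YoungDiagram) (F : YoungDiagram → YoungDiagram → ℝ) :
    ∑ ρ ∈ dn m κ, ∑ l ∈ up n ρ, F ρ l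
      = ∑ l ∈ Y n, ∑ ρ ∈ (Y m).filter (fun ρ => ρ ≤ κ ∧ ρ ≤ l), F ρ l := by
  refine Finset.sum_comm' ?_
  intro x y
  simp only [mem_Y, mem_up, mem_dn, Finset.mem_filter]
  tauto

theorem eq_of_le_card {κ ν : YoungDiagram} (h : κ ≤ ν) (hc : ν.card ≤ κ.card) : κ = ν :=
  YoungDiagram.ext (Finset.eq_of_subset_of_card_le h hc)

theorem comm_ne (w : ℕ × ℕ → ℝ) {n : ℕ} {κ l : YoungDiagram} (hκ : κ.card = n + 1)
    (hl : l.card = n + 1) (hne : κ ≠ l) :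
    ∑ ν ∈ (Y (n+2)).filter (fun ν => κ ≤ ν ∧ l ≤ ν), wt w κ ν
      = ∑ ρ ∈ (Y n).filter (fun ρ => ρ ≤ κ ∧ ρ ≤ l), wt w ρ l := by
  have hcard : (κ ⊔ l).card + (κ ⊓ l).card = 2 * (n + 1) := by
    have := Finset.card_union_add_card_inter κ.cells l.cells
    have h1 : κ.cells.card = n + 1 := hκ
    have h2 : l.cells.card = n + 1 := hl
    change (κ ⊔ l).cells.card + (κ ⊓ l).cells.card = _
    rw [YoungDiagram.cells_sup, YoungDiagram.cells_inf, this]; omega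
  have hsup : n + 2 ≤ (κ ⊔ l).card := by
    by_contra hlt
    have h1 : κ = κ ⊔ l := eq_of_le_card le_sup_left (by omega)
    have h2 : l = κ ⊔ l := eq_of_le_card le_sup_right (by omega)
    exact hne (h1.trans h2.symm)
  by_cases hc : (κ ⊔ l).card = n + 2
  · have e1 : (Y (n+2)).filter (fun ν => κ ≤ ν ∧ l ≤ ν) = {κ ⊔ l} := by
      ext ν
      simp only [Finset.mem_filter, mem_Y, Finset.mem_singleton]
      constructor
      · rintro ⟨h1, h2, h3⟩
        exact (eq_of_le_card (sup_le h2 h3) (by omega)).symm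
      · rintro rfl
        exact ⟨hc, le_sup_left, le_sup_right⟩
    have e2 : (Y n).filter (fun ρ => ρ ≤ κ ∧ ρ ≤ l) = {κ ⊓ l} := by
      ext ν
      simp only [Finset.mem_filter, mem_Y, Finset.mem_singleton]
      constructor
      · rintro ⟨h1, h2, h3⟩
        exact eq_of_le_card (le_inf h2 h3) (by omega)
      · rintro rfl
        exact ⟨by omega, inf_le_left, inf_le_right⟩
    rw [e1, e2, Finset.sum_singleton, Finset.sum_singleton]
    unfold wt
    congr 1
    rw [YoungDiagram.cells_sup, YoungDiagram.cells_inf]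
    ext x
    simp only [Finset.mem_sdiff, Finset.mem_union, Finset.mem_inter]
    tauto
  · have e1 : (Y (n+2)).filter (fun ν => κ ≤ ν ∧ l ≤ ν) = ∅ := by
      rw [Finset.filter_eq_empty_iff]
      rintro ν hν ⟨h2, h3⟩
      rw [mem_Y] at hν
      have : (κ ⊔ l).card ≤ ν.card := Finset.card_le_card (sup_le h2 h3 : κ ⊔ l ≤ ν)
      omega
    have e2 : (Y n).filter (fun ρ => ρ ≤ κ ∧ ρ ≤ l) = ∅ := by
      rw [Finset.filter_eq_empty_iff]
      rintro ν hν ⟨h2, h3⟩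
      rw [mem_Y] at hν
      have : ν.card ≤ (κ ⊓ l).card := Finset.card_le_card (le_inf h2 h3 : ν ≤ κ ⊓ l)
      omega
    rw [e1, e2, Finset.sum_empty, Finset.sum_empty]

/-- The local difference of addable and removable weights; `κ` has `n+1` boxes. -/
noncomputable def dd (w : ℕ × ℕ → ℝ) (n : ℕ) (κ : YoungDiagram) : ℝ :=
  ∑ ν ∈ up (n+2) κ, wt w κ ν - ∑ ρ ∈ dn n κ, wt w ρ κ

theorem comm_op (w : ℕ × ℕ → ℝ) {n : ℕ} {κ : YoungDiagram} (hκ : κ.card = n + 1)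
    (g : YoungDiagram → ℝ) :
    ∑ ν ∈ up (n+2) κ, ∑ l ∈ dn (n+1) ν, wt w κ ν * g l
      = ∑ ρ ∈ dn n κ, ∑ l ∈ up (n+1) ρ, wt w ρ l * g l + dd w n κ * g κ := by
  rw [sum_up_dn, sum_dn_up]
  have hκ' : κ ∈ Y (n+1) := mem_Y.2 hκ
  rw [← Finset.add_sum_erase _ _ hκ', ← Finset.add_sum_erase (Y (n+1)) _ hκ']
  have : ∀ l ∈ (Y (n+1)).erase κ,
      ∑ ν ∈ (Y (n+2)).filter (fun ν => κ ≤ ν ∧ l ≤ ν), wt w κ ν * g l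
      = ∑ ρ ∈ (Y n).filter (fun ρ => ρ ≤ κ ∧ ρ ≤ l), wt w ρ l * g l := by
    intro l hl
    rw [Finset.mem_erase, mem_Y] at hl
    rw [← Finset.sum_mul, ← Finset.sum_mul, comm_ne w hκ hl.2 hl.1.symm]
  rw [Finset.sum_congr rfl this]
  simp only [and_self, ← Finset.sum_mul, dd, up, dn]
  ring

theorem wt_cover (w : ℕ × ℕ → ℝ) {κ ν : YoungDiagram} {b : ℕ × ℕ} (h : ν.cells = insert b κ.cells)
    (hb : b ∉ κ.cells) : wt w κ ν = w b := by
  unfold wt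
  rw [h, Finset.insert_sdiff_of_notMem _ hb, Finset.sdiff_self]
  simp

theorem wt_one {n : ℕ} {κ ν : YoungDiagram} (h1 : κ.card = n) (h2 : ν.card = n + 1)
    (h : κ ≤ ν) : wt (fun _ => 1) κ ν = 1 := by
  obtain ⟨b, h1, h2, h3, h4⟩ := exists_box h (by omega)
  rw [wt_cover _ h4 h1]

theorem mem_lt {κ : YoungDiagram} {i j : ℕ} (hij : (i, j) ∈ κ) : i < κ.card ∧ j < κ.card := by
  have h1 : (Finset.range (i+1)).image (fun a => (a, j)) ⊆ κ.cells := by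
    intro x hx
    simp only [Finset.mem_image, Finset.mem_range] at hx
    obtain ⟨a, ha, rfl⟩ := hx
    exact κ.isLowerSet (a := (i, j)) (b := (a, j)) ⟨by simpa using by omega, le_rfl⟩ hij
  have h2 : (Finset.range (j+1)).image (fun a => (i, a)) ⊆ κ.cells := by
    intro x hx
    simp only [Finset.mem_image, Finset.mem_range] at hx
    obtain ⟨a, ha, rfl⟩ := hx
    exact κ.isLowerSet (a := (i, j)) (b := (i, a)) ⟨le_rfl, by simpa using by omega⟩ hij
  have h1' := Finset.card_le_card h1
  have h2' := Finset.card_le_card h2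
  rw [Finset.card_image_of_injective _ (by intro a b h; simpa using h), Finset.card_range] at h1' h2'
  have : κ.cells.card = κ.card := rfl
  omega

theorem rowLen_zero {κ : YoungDiagram} {k : ℕ} (hk : κ.card ≤ k) : κ.rowLen k = 0 := by
  by_contra h
  have : (k, 0) ∈ κ := YoungDiagram.mem_iff_lt_rowLen.2 (by omega)
  have := (mem_lt this).1
  omega

/-- row `k` is addable -/
def Adb (κ : YoungDiagram) (k : ℕ) : Prop := k = 0 ∨ κ.rowLen k < κ.rowLen (k-1)

theorem sum_up_wt (w : ℕ × ℕ → ℝ) {n N : ℕ} {κ : YoungDiagram} (hκ : κ.card = n) (hN : n < N) :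
    ∑ ν ∈ up (n+1) κ, wt w κ ν
      = ∑ k ∈ Finset.range N, if Adb κ k then w (k, κ.rowLen k) else 0 := by
  rw [← Finset.sum_filter]
  symm
  have hnot : ∀ k, (k, κ.rowLen k) ∉ κ.cells := by
    intro k hk
    have := YoungDiagram.mem_iff_lt_rowLen.1 hk
    omega
  have hlow : ∀ k, Adb κ k → IsLowerSet ((insert (k, κ.rowLen k) κ.cells : Finset (ℕ × ℕ)) : Set (ℕ × ℕ)) := by
    rintro k hk ⟨a1, a2⟩ ⟨b1, b2⟩ hab ha
    simp only [Finset.coe_insert, Set.mem_insert_iff, Finset.mem_coe, YoungDiagram.mem_cells,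
      YoungDiagram.mem_iff_lt_rowLen, Prod.mk.injEq] at ha ⊢
    have h1 : b1 ≤ a1 := hab.1
    have h2 : b2 ≤ a2 := hab.2
    rcases ha with ⟨rfl, rfl⟩ | ha
    · by_cases hb : b1 = a1
      · subst hb
        rcases h2.lt_or_eq with h | h
        · right; exact h
        · left; exact ⟨rfl, h⟩
      · right
        rcases hk with hk | hk
        · omega
        · have := κ.rowLen_anti b1 (a1 - 1) (by omega)
          omega
    · right
      have := κ.rowLen_anti b1 a1 h1
      omega
  refine Finset.sum_bij (fun k hk => ⟨insert (k, κ.rowLen k) κ.cells,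
    hlow k (Finset.mem_filter.1 hk).2⟩) ?_ ?_ ?_ ?_
  · intro k hk
    rw [mem_up]
    refine ⟨?_, Finset.subset_insert _ _⟩
    change Finset.card (insert _ _) = _
    rw [Finset.card_insert_of_notMem (hnot k)]
    exact congrArg (· + 1) hκ
  · intro k hk k' hk' h
    have h' := congrArg YoungDiagram.cells h
    simp only at h'
    have : (k, κ.rowLen k) ∈ insert (k', κ.rowLen k') κ.cells := by rw [← h']; simp
    rw [Finset.mem_insert] at this
    rcases this with h | h
    · exact congrArg Prod.fst h
    · exact absurd h (hnot k)
  · intro ν hν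
    rw [mem_up] at hν
    obtain ⟨⟨i, j⟩, h1, h2, h3, h4⟩ := exists_box hν.2 (by omega)
    have hj : j = κ.rowLen i := by
      have h5 : ¬ j < κ.rowLen i := fun h => h1 (YoungDiagram.mem_iff_lt_rowLen.2 h)
      by_contra hne
      have : (i, κ.rowLen i) ∈ ν.cells :=
        ν.isLowerSet (a := (i, j)) (b := (i, κ.rowLen i)) ⟨le_rfl, by simpa using by omega⟩ h2
      rw [h4, Finset.mem_insert] at this
      rcases this with h | h
      · simp only [Prod.mk.injEq] at h; omega
      · exact hnot i h
    have hadd : Adb κ i := by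
      by_cases hi : i = 0
      · exact Or.inl hi
      · right
        have : (i - 1, j) ∈ ν.cells :=
          ν.isLowerSet (a := (i, j)) (b := (i - 1, j)) ⟨by simp, le_rfl⟩ h2
        rw [h4, Finset.mem_insert] at this
        rcases this with h | h
        · simp only [Prod.mk.injEq] at h; omega
        · rw [← hj]
          exact YoungDiagram.mem_iff_lt_rowLen.1 h
    subst hj
    have hiN : i < N := by
      have := (mem_lt (κ := ν) h2).1
      omega
    refine ⟨i, Finset.mem_filter.2 ⟨Finset.mem_range.2 hiN, hadd⟩, ?_⟩
    exact YoungDiagram.ext h4.symm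
  · intro k hk
    symm
    exact wt_cover w rfl (hnot k)

theorem sum_dn_wt (w : ℕ × ℕ → ℝ) {n N : ℕ} {κ : YoungDiagram} (hκ : κ.card = n + 1)
    (hN : n < N) :
    ∑ ρ ∈ dn n κ, wt w ρ κ
      = ∑ k ∈ Finset.range N, if κ.rowLen (k+1) < κ.rowLen k then w (k, κ.rowLen k - 1) else 0 := by
  rw [← Finset.sum_filter]
  symm
  have hmem : ∀ k, κ.rowLen (k+1) < κ.rowLen k → (k, κ.rowLen k - 1) ∈ κ.cells := by
    intro k hk
    rw [YoungDiagram.mem_cells, YoungDiagram.mem_iff_lt_rowLen]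
    omega
  have hlow : ∀ k, κ.rowLen (k+1) < κ.rowLen k →
      IsLowerSet ((κ.cells.erase (k, κ.rowLen k - 1) : Finset (ℕ × ℕ)) : Set (ℕ × ℕ)) := by
    rintro k hk ⟨a1, a2⟩ ⟨b1, b2⟩ hab ha
    simp only [Finset.coe_erase, Set.mem_sdiff, Set.mem_singleton_iff, Finset.mem_coe,
      YoungDiagram.mem_cells, YoungDiagram.mem_iff_lt_rowLen, Prod.mk.injEq] at ha ⊢
    have h1 : b1 ≤ a1 := hab.1
    have h2 : b2 ≤ a2 := hab.2
    refine ⟨?_, ?_⟩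
    · have := κ.rowLen_anti b1 a1 h1
      omega
    · rintro ⟨rfl, rfl⟩
      by_cases hb : b1 = a1
      · subst hb
        exact ha.2 ⟨rfl, by omega⟩
      · have := κ.rowLen_anti (b1+1) a1 (by omega)
        omega
  refine Finset.sum_bij (fun k hk => ⟨κ.cells.erase (k, κ.rowLen k - 1),
    hlow k (Finset.mem_filter.1 hk).2⟩) ?_ ?_ ?_ ?_
  · intro k hk
    rw [mem_dn]
    refine ⟨?_, Finset.erase_subset _ _⟩
    change Finset.card (Finset.erase _ _) = _
    rw [Finset.card_erase_of_mem (hmem k (Finset.mem_filter.1 hk).2)]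
    change κ.card - 1 = n
    omega
  · intro k hk k' hk' h
    have h' := congrArg YoungDiagram.cells h
    simp only at h'
    have h1 := hmem k (Finset.mem_filter.1 hk).2
    have : (k, κ.rowLen k - 1) ∉ κ.cells.erase (k', κ.rowLen k' - 1) := by rw [← h']; simp
    rw [Finset.mem_erase] at this
    have : (k, κ.rowLen k - 1) = (k', κ.rowLen k' - 1) := by
      by_contra hne
      exact this ⟨hne, h1⟩
    exact congrArg Prod.fst this
  · intro ρ hρ
    rw [mem_dn] at hρ
    obtain ⟨⟨i, j⟩, h1, h2, h3, h4⟩ := exists_box hρ.2 (by omega)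
    have hj' : j < κ.rowLen i := YoungDiagram.mem_iff_lt_rowLen.1 h2
    have hj : j = κ.rowLen i - 1 := by
      by_contra hne
      have : (i, j + 1) ∈ κ.cells := YoungDiagram.mem_iff_lt_rowLen.2 (by omega)
      rw [h4, Finset.mem_insert] at this
      rcases this with h | h
      · simp only [Prod.mk.injEq] at h; omega
      · exact h1 (ρ.isLowerSet (a := (i, j+1)) (b := (i, j)) ⟨le_rfl, by simp⟩ h)
    have hrem : κ.rowLen (i+1) < κ.rowLen i := by
      by_contra hne
      have : (i + 1, j) ∈ κ.cells := YoungDiagram.mem_iff_lt_rowLen.2 (by omega)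
      rw [h4, Finset.mem_insert] at this
      rcases this with h | h
      · simp only [Prod.mk.injEq] at h; omega
      · exact h1 (ρ.isLowerSet (a := (i+1, j)) (b := (i, j)) ⟨by simp, le_rfl⟩ h)
    subst hj
    have hiN : i < N := by
      have := (mem_lt (κ := κ) h2).1
      omega
    refine ⟨i, Finset.mem_filter.2 ⟨Finset.mem_range.2 hiN, hrem⟩, ?_⟩
    apply YoungDiagram.ext
    change κ.cells.erase _ = _
    rw [h4, Finset.erase_insert h1]
  · intro k hk
    symm
    have h1 := hmem k (Finset.mem_filter.1 hk).2
    exact wt_cover w (Finset.insert_erase h1).symm (Finset.notMem_erase _ _)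

end PGP

namespace PGP
open scoped Classical

/-- indicator of addability -/
noncomputable def ai (κ : YoungDiagram) (k : ℕ) : ℝ := if Adb κ k then 1 else 0

theorem ai_nonneg (κ : YoungDiagram) (k : ℕ) : 0 ≤ ai κ k := by unfold ai; split_ifs <;> norm_num
theorem ai_le_one (κ : YoungDiagram) (k : ℕ) : ai κ k ≤ 1 := by unfold ai; split_ifs <;> norm_num
theorem ai_zero (κ : YoungDiagram) : ai κ 0 = 1 := by simp [ai, Adb]
theorem ai_succ (κ : YoungDiagram) (k : ℕ) :
    ai κ (k+1) = if κ.rowLen (k+1) < κ.rowLen k then 1 else 0 := by simp [ai, Adb]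
theorem ai_big {κ : YoungDiagram} {k : ℕ} (h : κ.card ≤ k) : ai κ (k+1) = 0 := by
  rw [ai_succ, rowLen_zero h]; simp

theorem dd_eq (w : ℕ × ℕ → ℝ) {n N : ℕ} {κ : YoungDiagram} (hκ : κ.card = n + 1)
    (hN : n < N) :
    dd w n κ = ∑ k ∈ Finset.range (N+1), ai κ k * w (k, κ.rowLen k)
      - ∑ k ∈ Finset.range N, ai κ (k+1) * w (k, κ.rowLen k - 1) := by
  unfold dd
  rw [sum_up_wt w hκ (N := N+1) (by omega), sum_dn_wt w hκ hN]
  simp only [ai_succ, ite_mul, one_mul, zero_mul]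
  congr 1
  simp only [ai, ite_mul, one_mul, zero_mul]

theorem dd_one {n : ℕ} {κ : YoungDiagram} (hκ : κ.card = n + 1) : dd (fun _ => 1) n κ = 1 := by
  rw [dd_eq _ hκ (N := n+1) (by omega), Finset.sum_range_succ']
  simp [ai_zero]

theorem dd_le_row (r : ℕ) {n : ℕ} {κ : YoungDiagram} (hκ : κ.card = n + 1) :
    0 ≤ dd (fun b => if b.1 ≤ r then 1 else 0) n κ := by
  rw [dd_eq _ hκ (N := n+1+r+1) (by omega)]
  simp only [mul_ite, mul_one, mul_zero]
  rw [← Finset.sum_filter, ← Finset.sum_filter]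
  have e1 : (Finset.range (n+1+r+1+1)).filter (fun k => k ≤ r) = Finset.range (r+1) := by
    ext k; simp only [Finset.mem_filter, Finset.mem_range]; omega
  have e2 : (Finset.range (n+1+r+1)).filter (fun k => k ≤ r) = Finset.range (r+1) := by
    ext k; simp only [Finset.mem_filter, Finset.mem_range]; omega
  rw [e1, e2, ← Finset.sum_sub_distrib, Finset.sum_range_sub', ai_zero]
  have := ai_le_one κ (r+1)
  linarith

theorem up_row_le_one (r : ℕ) {n : ℕ} {κ : YoungDiagram} (hκ : κ.card = n) :
    ∑ ν ∈ up (n+1) κ, wt (fun b => if b.1 = r then 1 else 0) κ ν ≤ 1 := by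
  rw [sum_up_wt _ hκ (N := n+1+r) (by omega)]
  have : ∀ k ∈ Finset.range (n+1+r), (if Adb κ k then (if k = r then (1:ℝ) else 0) else 0)
      = if k = r then ai κ r else 0 := by
    intro k _
    by_cases h : k = r
    · subst h; simp [ai]
    · simp [h]
  rw [Finset.sum_congr rfl this, Finset.sum_ite_eq']
  split_ifs
  · exact ai_le_one _ _
  · norm_num

theorem dn_row_le_one (r : ℕ) {n : ℕ} {κ : YoungDiagram} (hκ : κ.card = n + 1) :
    ∑ ρ ∈ dn n κ, wt (fun b => if b.1 = r then 1 else 0) ρ κ ≤ 1 := by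
  rw [sum_dn_wt _ hκ (N := n+1+r) (by omega)]
  have : ∀ k ∈ Finset.range (n+1+r),
      (if κ.rowLen (k+1) < κ.rowLen k then (if k = r then (1:ℝ) else 0) else 0)
      = if k = r then ai κ (r+1) else 0 := by
    intro k _
    by_cases h : k = r
    · subst h; simp [ai_succ]
    · simp [h]
  rw [Finset.sum_congr rfl this, Finset.sum_ite_eq']
  split_ifs
  · exact ai_le_one _ _
  · norm_num

/-- sum of weights of the cells -/
noncomputable def K (w : ℕ × ℕ → ℝ) (κ : YoungDiagram) : ℝ := ∑ b ∈ κ.cells, w b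

theorem K_rows (w : ℕ × ℕ → ℝ) {κ : YoungDiagram} {N : ℕ} (hN : κ.card ≤ N) :
    K w κ = ∑ k ∈ Finset.range N, ∑ j ∈ Finset.range (κ.rowLen k), w (k, j) := by
  unfold K
  rw [← Finset.sum_fiberwise_of_maps_to (t := Finset.range N) (g := fun b : ℕ × ℕ => b.1)]
  · refine Finset.sum_congr rfl fun k _ => ?_
    have : κ.cells.filter (fun b => b.1 = k) = {k} ×ˢ Finset.range (κ.rowLen k) := by
      rw [← YoungDiagram.row_eq_prod]; rfl
    rw [this, Finset.sum_product, Finset.sum_singleton]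
  · rintro ⟨i, j⟩ hb
    have := (mem_lt (κ := κ) hb).1
    simp only [Finset.mem_range]; omega

theorem K_row (r : ℕ) (κ : YoungDiagram) :
    K (fun b => if b.1 = r then 1 else 0) κ = κ.rowLen r := by
  unfold K
  rw [YoungDiagram.rowLen_eq_card, ← Finset.sum_filter]
  simp [YoungDiagram.row]

theorem K_cover (w : ℕ × ℕ → ℝ) {κ ν : YoungDiagram} (h : κ ≤ ν) :
    K w ν = K w κ + wt w κ ν := by
  unfold K wt
  have h' : κ.cells ⊆ ν.cells := h
  rw [add_comm, Finset.sum_sdiff h']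

theorem geom_aux (u : ℝ) (k m : ℕ) :
    (Real.exp u + Real.exp (-u) - 2) * ∑ j ∈ Finset.range m, Real.exp (u * ((j:ℝ) - k))
      = (1 - Real.exp (-u)) * (Real.exp (u * ((m:ℝ) - k)) - Real.exp (u * (0 - k))) := by
  induction m with
  | zero => simp
  | succ m ih =>
    rw [Finset.sum_range_succ, mul_add, ih]
    have h1 : Real.exp (u * (((m+1 : ℕ):ℝ) - k)) = Real.exp u * Real.exp (u * ((m:ℝ) - k)) := by
      rw [← Real.exp_add]; congr 1; push_cast; ring
    have h2 : Real.exp u * Real.exp (-u) = 1 := by rw [← Real.exp_add]; simp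
    rw [h1]
    linear_combination (Real.exp (u * ((m:ℝ) - k))) * h2

theorem dd_content (u : ℝ) {n : ℕ} {κ : YoungDiagram} (hκ : κ.card = n + 1) :
    dd (fun b => Real.exp (u * ((b.2:ℝ) - b.1))) n κ
      = 1 + (Real.exp u + Real.exp (-u) - 2) * K (fun b => Real.exp (u * ((b.2:ℝ) - b.1))) κ := by
  rw [dd_eq _ hκ (N := n+1) (by omega), K_rows _ (N := n+1) (by omega), Finset.mul_sum]
  simp only [geom_aux]
  rw [Finset.sum_range_succ', ai_zero]
  have key : ∀ k, ai κ (k+1) * Real.exp (u * ((κ.rowLen (k+1) : ℝ) - ((k+1 : ℕ):ℝ)))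
      - ai κ (k+1) * Real.exp (u * (((κ.rowLen k - 1 : ℕ) : ℝ) - (k:ℝ)))
      = Real.exp (u * ((κ.rowLen (k+1) : ℝ) - ((k+1 : ℕ):ℝ)))
        - Real.exp (-u) * Real.exp (u * ((κ.rowLen k : ℝ) - (k:ℝ))) := by
    intro k
    rw [ai_succ]
    split_ifs with h
    · rw [Nat.cast_sub (by omega), ← Real.exp_add, one_mul, one_mul]
      congr 2
      push_cast; ring
    · have : κ.rowLen (k+1) = κ.rowLen k := le_antisymm (κ.rowLen_anti _ _ (by omega)) (by omega)
      rw [this, ← Real.exp_add, zero_mul, zero_mul, sub_zero, eq_comm, sub_eq_zero]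
      congr 1
      push_cast; ring
  have e1 : ∀ (A B C : ℝ), A + B - C = (A - C) + B := by intros; ring
  rw [e1, ← Finset.sum_sub_distrib, Finset.sum_congr rfl (fun k _ => key k)]
  have hz : κ.rowLen (n+1) = 0 := rowLen_zero (by omega)
  have t1 := Finset.sum_range_succ' (fun k => Real.exp (u * ((κ.rowLen k : ℝ) - (k:ℝ)))) (n+1)
  rw [Finset.sum_range_succ, hz] at t1
  have t2 := Finset.sum_range_sub' (fun k : ℕ => Real.exp (u * (0 - (k:ℝ)))) (n+1)
  have t3 : ∀ k : ℕ, Real.exp (u * (0 - ((k+1 : ℕ):ℝ))) = Real.exp (-u) * Real.exp (u * (0 - (k:ℝ))) := by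
    intro k; rw [← Real.exp_add]; congr 1; push_cast; ring
  have t4 := t3 n
  simp only [t3] at t2
  simp only [mul_sub, sub_mul, one_mul, Finset.sum_sub_distrib, ← Finset.mul_sum] at *
  simp only [Nat.cast_zero, mul_zero, sub_zero, Real.exp_zero] at *
  rw [← Real.exp_zero]
  simp only [Real.exp_zero] at *
  linarith

theorem f_up {n : ℕ} : ∀ {κ : YoungDiagram}, κ.card = n →
    ∑ ν ∈ up (n+1) κ, f ν = (n+1) * f κ := by
  induction n with
  | zero =>
    intro κ hκ
    have h1 := sum_up_wt (fun _ => 1) hκ (N := 1) (by omega)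
    simp only [Finset.sum_range_one, Adb, true_or, if_true] at h1
    have hb : κ = ⊥ := by
      have := mem_Y.2 hκ; rw [Y_zero] at this; simpa using this
    subst hb
    rw [f_bot]
    have : ∀ ν ∈ up 1 ⊥, f ν = wt (fun _ => 1) ⊥ ν := by
      intro ν hν
      rw [mem_up] at hν
      rw [wt_one hκ hν.1 hν.2, ← f_dn (n := 0) hν.1]
      have : dn 0 ν = {⊥} := by
        ext ρ
        simp only [dn, Y_zero, Finset.mem_filter, Finset.mem_singleton]
        constructor
        · tauto
        · rintro rfl; simp
      rw [this, Finset.sum_singleton, f_bot]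
    rw [Finset.sum_congr rfl this, h1]; simp
  | succ n ih =>
    intro κ hκ
    have h := comm_op (fun _ => 1) hκ f
    rw [dd_one hκ] at h
    have e1 : ∑ ν ∈ up (n+2) κ, ∑ l ∈ dn (n+1) ν, wt (fun _ => 1) κ ν * f l
        = ∑ ν ∈ up (n+2) κ, f ν := by
      refine Finset.sum_congr rfl fun ν hν => ?_
      rw [mem_up] at hν
      rw [wt_one hκ hν.1 hν.2, ← f_dn hν.1]
      simp
    have e2 : ∑ ρ ∈ dn n κ, ∑ l ∈ up (n+1) ρ, wt (fun _ => 1) ρ l * f l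
        = (n+1) * f κ := by
      rw [← f_dn hκ, Finset.mul_sum]
      refine Finset.sum_congr rfl fun ρ hρ => ?_
      rw [mem_dn] at hρ
      rw [← ih hρ.1]
      refine Finset.sum_congr rfl fun l hl => ?_
      rw [mem_up] at hl
      rw [wt_one hρ.1 hl.1 hl.2, one_mul]
    rw [e1, e2] at h
    rw [h]; push_cast; ring

theorem sum_sq (n : ℕ) : ∑ κ ∈ Y n, f κ ^ 2 = (n.factorial : ℝ) := by
  induction n with
  | zero => simp [Y_zero, f_bot]
  | succ n ih =>
    have e1 : ∑ κ ∈ Y (n+1), f κ ^ 2 = ∑ ν ∈ Y (n+1), ∑ κ ∈ dn n ν, f κ * f ν := by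
      refine Finset.sum_congr rfl fun ν hν => ?_
      rw [← Finset.sum_mul, f_dn (mem_Y.1 hν)]; ring
    rw [e1, sum_swap, Nat.factorial_succ]
    push_cast
    rw [← ih, Finset.mul_sum]
    refine Finset.sum_congr rfl fun κ hκ => ?_
    rw [← Finset.mul_sum, f_up (mem_Y.1 hκ)]; ring

/-- unnormalised expectation of a weight of the next box -/
noncomputable def X (w : ℕ × ℕ → ℝ) (n : ℕ) : ℝ :=
  ∑ κ ∈ Y n, ∑ ν ∈ up (n+1) κ, wt w κ ν * (f κ * f ν)

/-- expectation of a weight of the next box -/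
noncomputable def Ex (w : ℕ × ℕ → ℝ) (n : ℕ) : ℝ := X w n / ((n+1).factorial : ℝ)

/-- expectation of a function of the diagram -/
noncomputable def En (h : YoungDiagram → ℝ) (n : ℕ) : ℝ :=
  (∑ κ ∈ Y n, h κ * f κ ^ 2) / (n.factorial : ℝ)

theorem X_rec (w : ℕ × ℕ → ℝ) (n : ℕ) :
    X w (n+1) = (n+1) * X w n + ∑ κ ∈ Y (n+1), dd w n κ * f κ ^ 2 := by
  have e1 : X w (n+1) = ∑ κ ∈ Y (n+1), f κ * ∑ ν ∈ up (n+2) κ, ∑ l ∈ dn (n+1) ν, wt w κ ν * f l := by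
    unfold X
    refine Finset.sum_congr rfl fun κ hκ => ?_
    rw [Finset.mul_sum]
    refine Finset.sum_congr rfl fun ν hν => ?_
    rw [mem_up] at hν
    rw [← Finset.mul_sum, f_dn hν.1]; ring
  have e2 : (n+1) * X w n
      = ∑ κ ∈ Y (n+1), f κ * ∑ ρ ∈ dn n κ, ∑ l ∈ up (n+1) ρ, wt w ρ l * f l := by
    have : ∑ κ ∈ Y (n+1), f κ * ∑ ρ ∈ dn n κ, ∑ l ∈ up (n+1) ρ, wt w ρ l * f l
      = ∑ κ ∈ Y (n+1), ∑ ρ ∈ dn n κ, f κ * ∑ l ∈ up (n+1) ρ, wt w ρ l * f l := by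
      simp only [Finset.mul_sum]
    rw [this, sum_swap n (n+1) (fun ρ κ => f κ * ∑ l ∈ up (n+1) ρ, wt w ρ l * f l)]
    unfold X
    rw [Finset.mul_sum]
    refine Finset.sum_congr rfl fun ρ hρ => ?_
    rw [← Finset.sum_mul, f_up (mem_Y.1 hρ), Finset.mul_sum, Finset.mul_sum]
    refine Finset.sum_congr rfl fun l hl => ?_
    ring
  rw [e1, e2, ← Finset.sum_add_distrib]
  refine Finset.sum_congr rfl fun κ hκ => ?_
  rw [comm_op w (mem_Y.1 hκ) f]; ring

theorem Ex_rec (w : ℕ × ℕ → ℝ) (n : ℕ) :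
    ((n:ℝ)+2) * Ex w (n+1) = (n+1) * Ex w n + En (dd w n) (n+1) := by
  unfold Ex En
  rw [X_rec, Nat.factorial_succ (n+1)]
  have h1 : ((n+1).factorial : ℝ) ≠ 0 := by positivity
  have h2 : ((n:ℝ)+2) ≠ 0 := by positivity
  push_cast
  have h3 : ((n:ℝ)+1+1) ≠ 0 := by positivity
  field_simp
  ring

theorem En_cover (h : YoungDiagram → ℝ) (n : ℕ) :
    En h (n+1) = (∑ κ ∈ Y n, ∑ ν ∈ up (n+1) κ, h ν * (f κ * f ν)) / ((n+1).factorial : ℝ) := by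
  unfold En
  congr 1
  rw [← sum_swap n (n+1) (fun κ ν => h ν * (f κ * f ν))]
  refine Finset.sum_congr rfl fun ν hν => ?_
  rw [← Finset.mul_sum, ← Finset.sum_mul, f_dn (mem_Y.1 hν)]; ring

theorem En_cover' (h : YoungDiagram → ℝ) (n : ℕ) :
    En h n = (∑ κ ∈ Y n, ∑ ν ∈ up (n+1) κ, h κ * (f κ * f ν)) / ((n+1).factorial : ℝ) := by
  unfold En
  rw [Nat.factorial_succ]
  have h1 : (n.factorial : ℝ) ≠ 0 := by positivity
  have h2 : ((n:ℝ)+1) ≠ 0 := by positivity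
  push_cast
  rw [div_eq_div_iff h1 (by positivity), Finset.sum_mul, Finset.sum_mul]
  refine Finset.sum_congr rfl fun κ hκ => ?_
  rw [← Finset.mul_sum, ← Finset.mul_sum, f_up (mem_Y.1 hκ)]; ring

theorem En_K_succ (w : ℕ × ℕ → ℝ) (n : ℕ) : En (K w) (n+1) = En (K w) n + Ex w n := by
  rw [En_cover, En_cover', Ex, X, ← add_div, ← Finset.sum_add_distrib]
  congr 1
  refine Finset.sum_congr rfl fun κ hκ => ?_
  rw [← Finset.sum_add_distrib]
  refine Finset.sum_congr rfl fun ν hν => ?_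
  rw [K_cover w (mem_up.1 hν).2]; ring

theorem En_K (w : ℕ × ℕ → ℝ) (n : ℕ) : En (K w) n = ∑ j ∈ Finset.range n, Ex w j := by
  induction n with
  | zero => simp [En, Y_zero, K]
  | succ n ih => rw [En_K_succ, ih, Finset.sum_range_succ]

theorem Ex_one (n : ℕ) : Ex (fun _ => 1) n = 1 := by
  have h : Ex (fun _ => 1) n = En (fun _ => 1) n := by
    rw [En_cover', Ex, X]
    congr 1
    refine Finset.sum_congr rfl fun κ hκ => Finset.sum_congr rfl fun ν hν => ?_
    rw [wt_one (mem_Y.1 hκ) (mem_up.1 hν).1 (mem_up.1 hν).2]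
  rw [h, En]
  simp only [one_mul, sum_sq]
  exact div_self (by positivity)

theorem Ex_mono {w w' : ℕ × ℕ → ℝ} (h : ∀ b, w b ≤ w' b) (n : ℕ) : Ex w n ≤ Ex w' n := by
  unfold Ex X wt
  have := f_nonneg
  gcongr with κ hκ ν hν b hb
  · exact mul_nonneg (this _) (this _)
  · exact h b

theorem Ex_add (w w' : ℕ × ℕ → ℝ) (n : ℕ) :
    Ex (fun b => w b + w' b) n = Ex w n + Ex w' n := by
  unfold Ex X wt
  simp only [Finset.sum_add_distrib, add_mul, add_div]

theorem Ex_smul (c : ℝ) (w : ℕ × ℕ → ℝ) (n : ℕ) :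
    Ex (fun b => c * w b) n = c * Ex w n := by
  unfold Ex X wt
  simp only [← Finset.mul_sum, mul_assoc, mul_div_assoc]

theorem Ex_sum {ι : Type*} (s : Finset ι) (w : ι → ℕ × ℕ → ℝ) (n : ℕ) :
    Ex (fun b => ∑ i ∈ s, w i b) n = ∑ i ∈ s, Ex (w i) n := by
  induction s using Finset.induction_on with
  | empty => simp [Ex, X, wt]
  | insert a s ha ih =>
    simp only [Finset.sum_insert ha]
    rw [Ex_add, ih]

end PGP

namespace PGP
open scoped Classical

/-- row indicator -/
noncomputable def ri (r : ℕ) : ℕ × ℕ → ℝ := fun b => if b.1 = r then 1 else 0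

theorem ri_nonneg (r : ℕ) (b : ℕ × ℕ) : 0 ≤ ri r b := by unfold ri; split_ifs <;> norm_num

theorem wt_nonneg {w : ℕ × ℕ → ℝ} (h : ∀ b, 0 ≤ w b) (κ ν : YoungDiagram) : 0 ≤ wt w κ ν :=
  Finset.sum_nonneg fun b _ => h b

theorem p_le (r n : ℕ) : Ex (ri r) n ≤ 1 / Real.sqrt (n+1) := by
  have ht : 0 < Real.sqrt ((n:ℝ)+1) := Real.sqrt_pos.2 (by positivity)
  have ht2 : Real.sqrt ((n:ℝ)+1) ^ 2 = n + 1 := Real.sq_sqrt (by positivity)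
  set t := Real.sqrt ((n:ℝ)+1) with htdef
  have h1 : X (ri r) n ≤ ∑ κ ∈ Y n, ∑ ν ∈ up (n+1) κ,
      (t/2 * (wt (ri r) κ ν * f κ ^ 2) + 1/(2*t) * (wt (ri r) κ ν * f ν ^ 2)) := by
    unfold X
    refine Finset.sum_le_sum fun κ _ => Finset.sum_le_sum fun ν _ => ?_
    have hw := wt_nonneg (ri_nonneg r) κ ν
    have : f κ * f ν ≤ t/2 * f κ ^ 2 + 1/(2*t) * f ν ^ 2 := by
      have h : t/2 * f κ ^ 2 + 1/(2*t) * f ν ^ 2 - f κ * f ν = (t * f κ - f ν)^2 / (2*t) := by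
        field_simp; ring
      have : 0 ≤ (t * f κ - f ν)^2 / (2*t) := by positivity
      linarith
    calc _ ≤ wt (ri r) κ ν * (t/2 * f κ ^ 2 + 1/(2*t) * f ν ^ 2) :=
          mul_le_mul_of_nonneg_left this hw
      _ = _ := by ring
  simp only [Finset.sum_add_distrib, ← Finset.mul_sum] at h1
  have h2 : ∑ κ ∈ Y n, ∑ ν ∈ up (n+1) κ, wt (ri r) κ ν * f κ ^ 2 ≤ n.factorial := by
    rw [← sum_sq]
    refine Finset.sum_le_sum fun κ hκ => ?_
    rw [← Finset.sum_mul]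
    have := up_row_le_one r (mem_Y.1 hκ)
    calc _ ≤ 1 * f κ ^ 2 := mul_le_mul_of_nonneg_right this (by positivity)
      _ = _ := one_mul _
  have h3 : ∑ κ ∈ Y n, ∑ ν ∈ up (n+1) κ, wt (ri r) κ ν * f ν ^ 2 ≤ (n+1).factorial := by
    rw [← sum_sq, ← sum_swap n (n+1) (fun κ ν => wt (ri r) κ ν * f ν ^ 2)]
    refine Finset.sum_le_sum fun κ hκ => ?_
    rw [← Finset.sum_mul]
    have := dn_row_le_one r (mem_Y.1 hκ)
    calc _ ≤ 1 * f κ ^ 2 := mul_le_mul_of_nonneg_right this (by positivity)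
      _ = _ := one_mul _
  have hfac : ((n+1).factorial : ℝ) = t^2 * n.factorial := by
    rw [ht2, Nat.factorial_succ]; push_cast; ring
  have hp : (0:ℝ) < n.factorial := by positivity
  have h4 : X (ri r) n ≤ t * n.factorial := by
    calc _ ≤ _ := h1
      _ ≤ t/2 * n.factorial + 1/(2*t) * (n+1).factorial := by gcongr
      _ = _ := by rw [hfac]; field_simp; ring
  unfold Ex
  rw [hfac, div_le_div_iff₀ (by positivity) ht]
  calc _ ≤ t * n.factorial * t := by gcongr
    _ = _ := by ring

theorem poincare (n : ℕ) : ∀ g : YoungDiagram → ℝ, ∑ l ∈ Y (n+1), g l * f l = 0 →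
    ∑ κ ∈ Y n, (∑ l ∈ up (n+1) κ, g l)^2 ≤ n * ∑ l ∈ Y (n+1), g l ^ 2 := by
  induction n with
  | zero =>
    intro g hg
    rw [Y_zero, Finset.sum_singleton]
    have : ∑ l ∈ up (0+1) ⊥, g l = ∑ l ∈ Y (0+1), g l * f l := by
      have h1 : up (0+1) ⊥ = Y (0+1) := by ext; simp [up]
      rw [h1]
      refine Finset.sum_congr rfl fun l hl => ?_
      have hb : dn 0 l = {⊥} := by
        ext ρ
        simp only [dn, Y_zero, Finset.mem_filter, Finset.mem_singleton]
        constructor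
        · tauto
        · rintro rfl; simp
      rw [← f_dn (mem_Y.1 hl), hb, Finset.sum_singleton, f_bot, mul_one]
    rw [this, hg]; simp
  | succ n ih =>
    intro g hg
    set h : YoungDiagram → ℝ := fun κ => ∑ l ∈ up (n+2) κ, g l with hh
    have hperp : ∑ κ ∈ Y (n+1), h κ * f κ = 0 := by
      rw [← hg]
      simp only [hh, Finset.sum_mul]
      rw [← sum_swap (n+1) (n+2) (fun κ l => g l * f κ)]
      refine Finset.sum_congr rfl fun l hl => ?_
      rw [← Finset.mul_sum, f_dn (mem_Y.1 hl)]
    have hU : ∑ ν ∈ Y (n+2), (∑ κ ∈ dn (n+1) ν, h κ)^2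
        = ∑ ρ ∈ Y n, (∑ l ∈ up (n+1) ρ, h l)^2 + ∑ κ ∈ Y (n+1), h κ ^ 2 := by
      have e1 : ∑ ν ∈ Y (n+2), (∑ κ ∈ dn (n+1) ν, h κ)^2
          = ∑ κ ∈ Y (n+1), h κ * ∑ ν ∈ up (n+2) κ, ∑ l ∈ dn (n+1) ν, wt (fun _ => 1) κ ν * h l := by
        have : ∑ κ ∈ Y (n+1), h κ * ∑ ν ∈ up (n+2) κ, ∑ l ∈ dn (n+1) ν, wt (fun _ => 1) κ ν * h l
          = ∑ κ ∈ Y (n+1), ∑ ν ∈ up (n+2) κ, h κ * ∑ l ∈ dn (n+1) ν, h l := by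
          refine Finset.sum_congr rfl fun κ hκ => ?_
          rw [Finset.mul_sum]
          refine Finset.sum_congr rfl fun ν hν => ?_
          rw [wt_one (mem_Y.1 hκ) (mem_up.1 hν).1 (mem_up.1 hν).2]
          simp
        rw [this, ← sum_swap (n+1) (n+2) (fun κ ν => h κ * ∑ l ∈ dn (n+1) ν, h l)]
        refine Finset.sum_congr rfl fun ν hν => ?_
        rw [← Finset.sum_mul, sq]
      have e2 : ∑ ρ ∈ Y n, (∑ l ∈ up (n+1) ρ, h l)^2
          = ∑ κ ∈ Y (n+1), h κ * ∑ ρ ∈ dn n κ, ∑ l ∈ up (n+1) ρ, wt (fun _ => 1) ρ l * h l := by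
        have : ∑ κ ∈ Y (n+1), h κ * ∑ ρ ∈ dn n κ, ∑ l ∈ up (n+1) ρ, wt (fun _ => 1) ρ l * h l
          = ∑ κ ∈ Y (n+1), ∑ ρ ∈ dn n κ, h κ * ∑ l ∈ up (n+1) ρ, h l := by
          refine Finset.sum_congr rfl fun κ hκ => ?_
          rw [Finset.mul_sum]
          refine Finset.sum_congr rfl fun ρ hρ => ?_
          congr 1
          refine Finset.sum_congr rfl fun l hl => ?_
          rw [wt_one (mem_dn.1 hρ).1 (mem_up.1 hl).1 (mem_up.1 hl).2, one_mul]
        rw [this, sum_swap n (n+1) (fun ρ κ => h κ * ∑ l ∈ up (n+1) ρ, h l)]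
        refine Finset.sum_congr rfl fun ν hν => ?_
        rw [← Finset.sum_mul, sq]
      rw [e1, e2, ← Finset.sum_add_distrib]
      refine Finset.sum_congr rfl fun κ hκ => ?_
      rw [comm_op _ (mem_Y.1 hκ) h, dd_one (mem_Y.1 hκ)]; ring
    have hih := ih h hperp
    have hU2 : ∑ ν ∈ Y (n+2), (∑ κ ∈ dn (n+1) ν, h κ)^2 ≤ (n+1) * ∑ κ ∈ Y (n+1), h κ ^ 2 := by
      rw [hU]; linarith
    have hinner : ∑ κ ∈ Y (n+1), h κ ^ 2 = ∑ ν ∈ Y (n+2), g ν * ∑ κ ∈ dn (n+1) ν, h κ := by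
      simp only [Finset.mul_sum]
      rw [sum_swap (n+1) (n+2) (fun κ ν => g ν * h κ)]
      refine Finset.sum_congr rfl fun κ hκ => ?_
      rw [← Finset.sum_mul, sq]
    have hcs := Finset.sum_mul_sq_le_sq_mul_sq (Y (n+2)) g (fun ν => ∑ κ ∈ dn (n+1) ν, h κ)
    rw [← hinner] at hcs
    have hg0 : 0 ≤ ∑ l ∈ Y (n+2), g l ^ 2 := Finset.sum_nonneg fun _ _ => sq_nonneg _
    have hh0 : 0 ≤ ∑ κ ∈ Y (n+1), h κ ^ 2 := Finset.sum_nonneg fun _ _ => sq_nonneg _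
    push_cast
    change ∑ κ ∈ Y (n+1), h κ ^ 2 ≤ (n+1) * ∑ l ∈ Y (n+2), g l ^ 2
    set H := ∑ κ ∈ Y (n+1), h κ ^ 2
    set G := ∑ l ∈ Y (n+2), g l ^ 2
    have h5 : H ^ 2 ≤ G * ((n+1) * H) := hcs.trans (mul_le_mul_of_nonneg_left hU2 hg0)
    rcases hh0.eq_or_lt with h0 | h0
    · rw [← h0]; positivity
    · have : H * H ≤ ((n+1) * G) * H := by nlinarith
      exact le_of_mul_le_mul_right this h0

theorem wt_ri_sq {r n : ℕ} {κ ν : YoungDiagram} (h1 : κ.card = n) (h2 : ν.card = n + 1)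
    (h : κ ≤ ν) : wt (ri r) κ ν ^ 2 = wt (ri r) κ ν := by
  obtain ⟨b, h1, h2, h3, h4⟩ := exists_box h (by omega)
  rw [wt_cover _ h4 h1]
  unfold ri; split_ifs <;> norm_num

theorem var_le (r n : ℕ) (μ : ℝ) (hμ : μ = En (K (ri r)) (n+1)) :
    En (fun κ => (K (ri r) κ - μ)^2) (n+1) ≤ Real.sqrt (n+1) := by
  have hfac : (0:ℝ) < ((n+1).factorial : ℝ) := by positivity
  set x := K (ri r) with hx
  have hg : ∑ l ∈ Y (n+1), ((x l - μ) * f l) * f l = 0 := by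
    have h1 : ∑ l ∈ Y (n+1), x l * f l ^ 2 = μ * (n+1).factorial := by
      rw [hμ, En, div_mul_cancel₀ _ hfac.ne']
    have h2 := sum_sq (n+1)
    calc _ = ∑ l ∈ Y (n+1), x l * f l ^ 2 - μ * ∑ l ∈ Y (n+1), f l ^ 2 := by
          rw [Finset.mul_sum, ← Finset.sum_sub_distrib]
          exact Finset.sum_congr rfl fun l _ => by ring
      _ = 0 := by rw [h1, h2]; ring
  have hP := poincare n (fun l => (x l - μ) * f l) hg
  set B : YoungDiagram → ℝ := fun κ => ∑ ν ∈ up (n+1) κ, wt (ri r) κ ν * f ν with hB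
  have hD : ∀ κ ∈ Y n, ∑ l ∈ up (n+1) κ, (x l - μ) * f l = (x κ - μ) * ((n+1) * f κ) + B κ := by
    intro κ hκ
    rw [← f_up (mem_Y.1 hκ), Finset.mul_sum, hB, ← Finset.sum_add_distrib]
    refine Finset.sum_congr rfl fun l hl => ?_
    rw [hx, K_cover _ (mem_up.1 hl).2]; ring
  have hN : ∑ l ∈ Y (n+1), ((x l - μ) * f l)^2
      = ∑ κ ∈ Y n, f κ * ((x κ - μ)^2 * ((n+1) * f κ) + 2 * (x κ - μ) * B κ + B κ) := by
    have e1 : ∑ l ∈ Y (n+1), ((x l - μ) * f l)^2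
        = ∑ l ∈ Y (n+1), ∑ κ ∈ dn n l, (x l - μ)^2 * f l * f κ := by
      refine Finset.sum_congr rfl fun l hl => ?_
      rw [← Finset.mul_sum, f_dn (mem_Y.1 hl)]; ring
    rw [e1, sum_swap n (n+1) (fun κ l => (x l - μ)^2 * f l * f κ)]
    refine Finset.sum_congr rfl fun κ hκ => ?_
    rw [← f_up (mem_Y.1 hκ), hB, Finset.mul_sum, Finset.mul_sum, ← Finset.sum_add_distrib,
      ← Finset.sum_add_distrib, Finset.mul_sum]
    refine Finset.sum_congr rfl fun l hl => ?_
    rw [hx, K_cover _ (mem_up.1 hl).2]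
    have := wt_ri_sq (r := r) (mem_Y.1 hκ) (mem_up.1 hl).1 (mem_up.1 hl).2
    linear_combination (f l * f κ) * this
  have hX : X (ri r) n = ∑ κ ∈ Y n, f κ * B κ := by
    unfold X
    refine Finset.sum_congr rfl fun κ hκ => ?_
    rw [hB, Finset.mul_sum]
    exact Finset.sum_congr rfl fun l _ => by ring
  have hmain : (n+1) * ∑ l ∈ Y (n+1), ((x l - μ) * f l)^2 - (n+1) * X (ri r) n
      ≤ ∑ κ ∈ Y n, (∑ l ∈ up (n+1) κ, (x l - μ) * f l)^2 := by
    rw [hN, hX, Finset.mul_sum, Finset.mul_sum, ← Finset.sum_sub_distrib]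
    refine Finset.sum_le_sum fun κ hκ => ?_
    rw [hD κ hκ]
    nlinarith [sq_nonneg (B κ)]
  have hV : ∑ l ∈ Y (n+1), ((x l - μ) * f l)^2 ≤ (n+1) * X (ri r) n := by linarith
  have hV' : ∑ l ∈ Y (n+1), (x l - μ)^2 * f l ^2 ≤ (n+1) * X (ri r) n := by
    simpa only [mul_pow] using hV
  have hp := p_le r n
  have ht : 0 < Real.sqrt ((n:ℝ)+1) := Real.sqrt_pos.2 (by positivity)
  have ht2 : Real.sqrt ((n:ℝ)+1) ^ 2 = n + 1 := Real.sq_sqrt (by positivity)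
  unfold En
  calc _ ≤ ((n+1) * X (ri r) n) / (n+1).factorial := by gcongr
    _ = (n+1) * Ex (ri r) n := by rw [Ex, mul_div_assoc]
    _ ≤ (n+1) * (1 / Real.sqrt (n+1)) := by gcongr
    _ = Real.sqrt (n+1) := by rw [← ht2]; field_simp; rw [Real.sqrt_sq ht.le]

end PGP

namespace PGP
open scoped Classical

/-- exponential of content -/
noncomputable def ew (u : ℝ) : ℕ × ℕ → ℝ := fun b => Real.exp (u * ((b.2:ℝ) - b.1))
/-- omega -/
noncomputable def om (u : ℝ) : ℝ := Real.exp u + Real.exp (-u) - 2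

theorem En_congr {h h' : YoungDiagram → ℝ} {n : ℕ} (H : ∀ κ, κ.card = n → h κ = h' κ) :
    En h n = En h' n := by
  unfold En
  congr 1
  exact Finset.sum_congr rfl fun κ hκ => by rw [H κ (mem_Y.1 hκ)]

theorem En_mono {h h' : YoungDiagram → ℝ} {n : ℕ} (H : ∀ κ, κ.card = n → h κ ≤ h' κ) :
    En h n ≤ En h' n := by
  unfold En
  gcongr with κ hκ
  exact H κ (mem_Y.1 hκ)

theorem En_one (n : ℕ) : En (fun _ => 1) n = 1 := by
  unfold En
  simp only [one_mul, sum_sq]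
  exact div_self (by positivity)

theorem En_add (h h' : YoungDiagram → ℝ) (n : ℕ) :
    En (fun κ => h κ + h' κ) n = En h n + En h' n := by
  unfold En
  simp only [add_mul, Finset.sum_add_distrib, add_div]

theorem En_smul (c : ℝ) (h : YoungDiagram → ℝ) (n : ℕ) :
    En (fun κ => c * h κ) n = c * En h n := by
  unfold En
  simp only [mul_assoc, ← Finset.mul_sum, mul_div_assoc]

theorem G_rec (u : ℝ) (n : ℕ) :
    ((n:ℝ)+2) * Ex (ew u) (n+1) = (n+1) * Ex (ew u) n + (1 + om u * En (K (ew u)) (n+1)) := by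
  rw [Ex_rec]
  congr 1
  rw [En_congr (h := dd (ew u) n) (h' := fun κ => 1 + om u * K (ew u) κ)
    (fun κ hκ => dd_content u hκ), En_add,
    En_one, En_smul]

theorem G_zero (u : ℝ) : Ex (ew u) 0 = 1 := by
  have h := sum_up_wt (ew u) (κ := ⊥) (n := 0) (N := 1) (by simp) (by simp)
  have hf : ∀ ν ∈ up 1 ⊥, f ν = 1 := by
    intro ν hν
    have h0 : dn 0 ν = {⊥} := by
      ext κ
      rw [mem_dn, ← mem_Y, Y_zero, Finset.mem_singleton]
      constructor
      · exact fun h => h.1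
      · rintro rfl; exact ⟨rfl, bot_le⟩
    have := f_dn (mem_up.1 hν).1
    rw [h0] at this
    simpa [f_bot] using this.symm
  unfold Ex X
  rw [Y_zero]
  simp only [Finset.sum_singleton, f_bot]
  rw [Finset.sum_congr rfl (g := fun ν => wt (ew u) ⊥ ν) (fun ν hν => by rw [hf ν hν]; ring)]
  rw [h]
  have : (⊥ : YoungDiagram).rowLen 0 = 0 := rowLen_zero (by simp)
  simp [Adb, ew, this]

theorem choose_id (n k : ℕ) :
    ((n:ℝ)+2) * ((n+1).choose k : ℝ) = (n+1) * (n.choose k : ℝ) + (k+1) * ((n+1).choose k : ℝ) := by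
  have h := Nat.add_one_mul_choose_eq n k
  have h2 := Nat.choose_succ_succ n k
  have h3 := Nat.choose_succ_right_eq (n+1) k
  rcases le_or_gt k (n+1) with hk | hk
  · have e : ((n+1-k : ℕ):ℝ) = n + 1 - k := by rw [Nat.cast_sub hk]; push_cast; ring
    have h3' : ((n+1).choose (k+1) : ℝ) * (k+1) = (n+1).choose k * (n+1-k) := by
      rw [← e]; exact_mod_cast h3
    have h' : ((n:ℝ)+1) * n.choose k = (n+1).choose (k+1) * (k+1) := by exact_mod_cast h
    linarith
  · rw [Nat.choose_eq_zero_of_lt hk, Nat.choose_eq_zero_of_lt (by omega : n < k)]; simp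

theorem GT_eq (u : ℝ) (N : ℕ) : ∀ n ≤ N,
    Ex (ew u) n = ∑ k ∈ Finset.range (N+1), (n.choose k : ℝ) * om u ^ k / (k+1).factorial ∧
    En (K (ew u)) n = ∑ k ∈ Finset.range (N+1), (n.choose (k+1) : ℝ) * om u ^ k / (k+1).factorial := by
  intro n
  induction n with
  | zero =>
    intro _
    constructor
    · rw [G_zero, Finset.sum_range_succ']; simp
    · rw [En_K]; simp
  | succ n ih =>
    intro hn
    obtain ⟨h1, h2⟩ := ih (by omega)
    have hT : En (K (ew u)) (n+1)
        = ∑ k ∈ Finset.range (N+1), ((n+1).choose (k+1) : ℝ) * om u ^ k / (k+1).factorial := by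
      rw [En_K_succ, h1, h2, ← Finset.sum_add_distrib]
      refine Finset.sum_congr rfl fun k _ => ?_
      rw [Nat.choose_succ_succ]; push_cast; ring
    refine ⟨?_, hT⟩
    have hr := G_rec u n
    have h3 : 1 + om u * En (K (ew u)) (n+1)
        = ∑ k ∈ Finset.range (N+1), ((n+1).choose k : ℝ) * om u ^ k / k.factorial := by
      have : ∑ k ∈ Finset.range (N+2), ((n+1).choose k : ℝ) * om u ^ k / k.factorial
        = ∑ k ∈ Finset.range (N+1), ((n+1).choose k : ℝ) * om u ^ k / k.factorial := by
        rw [Finset.sum_range_succ, Nat.choose_eq_zero_of_lt (by omega : n+1 < N+1)]; simp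
      rw [← this, Finset.sum_range_succ', hT, Finset.mul_sum, add_comm]
      congr 1
      · refine Finset.sum_congr rfl fun k _ => ?_
        rw [pow_succ]; ring
      · simp
    rw [h3, h1, Finset.mul_sum, ← Finset.sum_add_distrib] at hr
    have hne : ((n:ℝ)+2) ≠ 0 := by positivity
    refine mul_left_cancel₀ hne ?_
    rw [hr, Finset.mul_sum]
    refine Finset.sum_congr rfl fun k _ => ?_
    have hc := choose_id n k
    rw [Nat.factorial_succ]
    have : (k.factorial : ℝ) ≠ 0 := by positivity
    have : ((k:ℝ)+1) ≠ 0 := by positivity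
    push_cast
    field_simp
    linear_combination (-1) * om u ^ k * hc

theorem om_ge (u : ℝ) : u^2 ≤ om u := by
  have h1 : om u = 4 * Real.sinh (u/2) ^ 2 := by
    have h2 : Real.exp u = Real.exp (u/2) ^ 2 := by rw [← Real.exp_nat_mul]; congr 1; push_cast; ring
    have h3 : Real.exp (-u) = Real.exp (-(u/2)) ^ 2 := by
      rw [← Real.exp_nat_mul]; congr 1; push_cast; ring
    have h4 : Real.exp (u/2) * Real.exp (-(u/2)) = 1 := by rw [← Real.exp_add]; simp
    rw [om, Real.sinh_eq, h2, h3]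
    linear_combination 2 * h4
  have h5 : |u/2| ≤ |Real.sinh (u/2)| := by
    rw [Real.abs_sinh]
    exact Real.self_le_sinh_iff.2 (abs_nonneg _)
  have := sq_le_sq.2 h5
  rw [h1]; nlinarith

theorem om_le {u : ℝ} (hu : |u| ≤ 1) : om u ≤ 2 * u^2 := by
  have h1 := abs_le.1 (Real.abs_exp_sub_one_sub_id_le hu)
  have h2 := abs_le.1 (Real.abs_exp_sub_one_sub_id_le (x := -u) (by rwa [abs_neg]))
  unfold om; nlinarith

theorem G_lower (u : ℝ) (n k : ℕ) :
    (n.choose k : ℝ) * (u^2) ^ k / (k+1).factorial ≤ Ex (ew u) n := by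
  have h0 : 0 ≤ om u := (sq_nonneg u).trans (om_ge u)
  rw [(GT_eq u (n+k) n (by omega)).1]
  calc _ ≤ (n.choose k : ℝ) * om u ^ k / (k+1).factorial := by
        gcongr; exact om_ge u
    _ ≤ _ := Finset.single_le_sum (f := fun k => (n.choose k : ℝ) * om u ^ k / (k+1).factorial)
        (fun i _ => by positivity) (by simp)

theorem G_upper (u : ℝ) (n : ℕ) : Ex (ew u) n ≤ Real.exp (n * om u) := by
  have h0 : 0 ≤ om u := (sq_nonneg u).trans (om_ge u)
  rw [(GT_eq u n n le_rfl).1]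
  calc _ ≤ ∑ k ∈ Finset.range (n+1), om u ^ k * 1 ^ (n-k) * (n.choose k : ℝ) := by
        refine Finset.sum_le_sum fun k _ => ?_
        rw [one_pow, mul_one, mul_comm (om u ^ k)]
        exact div_le_self (by positivity) (by exact_mod_cast Nat.factorial_pos _)
    _ = (om u + 1)^n := (add_pow _ _ _).symm
    _ ≤ (Real.exp (om u))^n := by gcongr; exact Real.add_one_le_exp _
    _ = _ := by rw [← Real.exp_nat_mul]

theorem fact_le {k : ℕ} (hk : 1 ≤ k) :
    (k.factorial : ℝ) ≤ Real.exp 1 * Real.sqrt k * (k / Real.exp 1)^k := by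
  obtain ⟨m, rfl⟩ : ∃ m, k = m + 1 := ⟨k-1, by omega⟩
  have h := Stirling.stirlingSeq'_antitone (Nat.zero_le m)
  simp only [Function.comp, Nat.succ_eq_add_one, zero_add, Stirling.stirlingSeq_one] at h
  unfold Stirling.stirlingSeq at h
  rw [div_le_iff₀ (by positivity), Real.sqrt_mul (by norm_num)] at h
  refine h.trans (le_of_eq ?_)
  have : Real.sqrt 2 ≠ 0 := by positivity
  field_simp

theorem exists_k {b : ℝ} (hb0 : 0 ≤ b) (hb : b < 2) : ∃ k : ℕ, 1 ≤ k ∧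
    Real.exp (k * b) + 1 < (k:ℝ)^(2*k) / (k.factorial * (k+1).factorial) := by
  set c := 2 - b with hc
  have hc0 : 0 < c := by linarith
  obtain ⟨k, hk⟩ := exists_nat_gt (192 / c^3 + 1)
  have hk0 : 0 < 192 / c^3 := by positivity
  have hk1 : (1:ℝ) < k := by linarith
  have hk' : 1 ≤ k := by exact_mod_cast hk1.le
  refine ⟨k, hk', ?_⟩
  have hkey : 192 < c^3 * k := by
    have : 192 / c^3 < k := by linarith
    rw [div_lt_iff₀ (by positivity)] at this; linarith
  have he : Real.exp 1 < 2.8 := by linarith [Real.exp_one_lt_d9]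
  have he0 := Real.exp_pos 1
  have he2 : Real.exp 1 ^ 2 < 8 := by nlinarith
  have h3 : (c*k)^3/6 ≤ Real.exp (c*k) := by
    have := Real.pow_div_factorial_le_exp (x := c*k) (by positivity) 3
    simpa [Nat.factorial] using this
  have hfac := fact_le hk'
  have hs : Real.sqrt k ^ 2 = k := Real.sq_sqrt (by positivity)
  have hden : (k.factorial : ℝ) * (k+1).factorial
      ≤ (Real.exp 1 ^ 2 * k * (k+1)) * (((k:ℝ)^(2*k)) / Real.exp (2*k)) := by
    rw [Nat.factorial_succ]
    push_cast
    calc _ = (k+1) * (k.factorial : ℝ)^2 := by ring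
      _ ≤ (k+1) * (Real.exp 1 * Real.sqrt k * (k / Real.exp 1)^k)^2 := by gcongr
      _ = _ := by
        have e1 : Real.exp (2*k) = (Real.exp 1 ^ k)^2 := by
          rw [← Real.exp_nat_mul, ← Real.exp_nat_mul]; push_cast; congr 1; ring
        rw [e1, mul_pow, mul_pow, hs, div_pow, div_pow, pow_mul' (k:ℝ) 2 k]
        ring
  have hkp : (0:ℝ) < k := by linarith
  have hB : 1 ≤ Real.exp (k*b) := Real.one_le_exp (by positivity)
  rw [lt_div_iff₀ (by positivity)]
  have e2 : Real.exp (2*k) = Real.exp (k*b) * Real.exp (c*k) := by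
    rw [← Real.exp_add, hc]; congr 1; ring
  have hmain : (Real.exp (k*b) + 1) * (Real.exp 1 ^ 2 * k * (k+1)) < Real.exp (2*k) := by
    rw [e2]
    calc _ ≤ (2 * Real.exp (k*b)) * (8 * k * (2 * k)) := by
          gcongr
          · linarith
          · linarith
      _ = Real.exp (k*b) * (32 * k^2) := by ring
      _ < Real.exp (k*b) * ((c*k)^3/6) := by
          gcongr
          have : 192 * (k:ℝ)^2 < c^3 * k * k^2 := by gcongr
          nlinarith
      _ ≤ _ := by gcongr
  calc _ ≤ (Real.exp (k*b) + 1) * ((Real.exp 1 ^ 2 * k * (k+1)) * (((k:ℝ)^(2*k)) / Real.exp (2*k))) := by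
        gcongr
    _ = ((Real.exp (k*b) + 1) * (Real.exp 1 ^ 2 * k * (k+1))) * (((k:ℝ)^(2*k)) / Real.exp (2*k)) := by ring
    _ < Real.exp (2*k) * (((k:ℝ)^(2*k)) / Real.exp (2*k)) := by gcongr
    _ = _ := by field_simp

end PGP

namespace PGP
open scoped Classical

theorem sqrt_nat_tendsto : Tendsto (fun n : ℕ => Real.sqrt n) atTop atTop :=
  Real.tendsto_sqrt_atTop.comp tendsto_natCast_atTop_atTop

theorem tail {b : ℝ} (hb0 : 0 ≤ b) (hb : b < 2) : ∃ M : ℝ, 0 < M ∧ ∀ᶠ n : ℕ in atTop,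
    1 / M ≤ Ex (fun c => if b * Real.sqrt n ≤ (c.2:ℝ) - c.1 then 1 else 0) n := by
  obtain ⟨k, hk1, hk⟩ := exists_k hb0 hb
  have hkp : (0:ℝ) < k := by exact_mod_cast hk1
  set M := Real.exp (8 * (k:ℝ)^2) with hM
  have hM0 : 0 < M := Real.exp_pos _
  refine ⟨M, hM0, ?_⟩
  have hlim : Tendsto (fun n : ℕ => (n.choose k : ℝ) * ((k:ℝ)^2 / n)^k / (k+1).factorial) atTop
      (nhds ((k:ℝ)^(2*k) / (k.factorial * (k+1).factorial))) := by
    have h1 : Tendsto (fun n : ℕ => (n:ℝ) * ((k:ℝ)^2/n)) atTop (nhds ((k:ℝ)^2)) := by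
      refine tendsto_const_nhds.congr' ?_
      filter_upwards [eventually_gt_atTop 0] with n hn
      have : (n:ℝ) ≠ 0 := by positivity
      field_simp
    have h2 := (ProbabilityTheory.tendsto_choose_mul_pow_atTop k h1).div_const ((k+1).factorial : ℝ)
    rw [div_div, ← pow_mul] at h2
    exact h2
  filter_upwards [hlim.eventually (lt_mem_nhds hk), eventually_gt_atTop 0,
    sqrt_nat_tendsto.eventually_ge_atTop (2*(k:ℝ))] with n hn hn0 hns
  have hn0' : (0:ℝ) < n := by exact_mod_cast hn0
  have hs0 : 0 < Real.sqrt n := Real.sqrt_pos.2 hn0'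
  have hs2 : Real.sqrt n ^ 2 = n := Real.sq_sqrt hn0'.le
  set s := Real.sqrt n with hs
  set u := (k:ℝ) / s with hu
  have hu0 : 0 < u := by positivity
  have hu2 : u^2 = (k:ℝ)^2 / n := by rw [hu, div_pow, hs2]
  have hG1 := G_lower u n k
  rw [hu2] at hG1
  have hG2 : Ex (ew (2*u)) n ≤ M := by
    refine (G_upper _ _).trans (Real.exp_le_exp.2 ?_)
    have h1 : |2*u| ≤ 1 := by
      rw [abs_of_pos (by positivity), hu, ← mul_div_assoc, div_le_one hs0]; exact hns
    calc (n:ℝ) * om (2*u) ≤ n * (2 * (2*u)^2) := by gcongr; exact om_le h1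
      _ = 8 * (n * u^2) := by ring
      _ = 8 * (k:ℝ)^2 := by rw [hu2]; field_simp
  set I : ℕ × ℕ → ℝ := fun c => if b * s ≤ (c.2:ℝ) - c.1 then 1 else 0 with hI
  have hpt : ∀ c, ew u c ≤ (Real.exp (k*b) * 1 + 1/(2*M) * ew (2*u) c) + M/2 * I c := by
    intro c
    have hew : ew (2*u) c = ew u c ^ 2 := by
      unfold ew; rw [← Real.exp_nat_mul]; congr 1; push_cast; ring
    have hp : 0 < ew u c := Real.exp_pos _
    by_cases hc : b * s ≤ (c.2:ℝ) - c.1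
    · have : I c = 1 := by simp only [hI, if_pos hc]
      rw [this, hew]
      have h1 : 1/(2*M) * ew u c ^ 2 + M/2 - ew u c = (ew u c - M)^2/(2*M) := by
        field_simp; ring
      have h2 : 0 ≤ (ew u c - M)^2/(2*M) := by positivity
      have := Real.exp_pos (k*b)
      linarith
    · have : I c = 0 := by simp only [hI, if_neg hc]
      rw [this]
      have h1 : ew u c ≤ Real.exp (k*b) := by
        apply Real.exp_le_exp.2
        push Not at hc
        calc u * ((c.2:ℝ) - c.1) ≤ u * (b * s) := by gcongr
          _ = k * b := by rw [hu]; field_simp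
      have h2 : 0 ≤ ew (2*u) c := (Real.exp_pos _).le
      have h3 : 0 ≤ 1/(2*M) * ew (2*u) c := by positivity
      linarith
  have hE := Ex_mono hpt n
  rw [Ex_add, Ex_add, Ex_smul, Ex_smul, Ex_smul, Ex_one] at hE
  have h4 : 1/(2*M) * Ex (ew (2*u)) n ≤ 1/2 := by
    calc _ ≤ 1/(2*M) * M := by gcongr
      _ = 1/2 := by field_simp
  rw [div_le_iff₀ hM0]
  linarith

theorem tail2 (r : ℕ) {b : ℝ} (hb0 : 0 ≤ b) (hb : b < 2) : ∃ M : ℝ, 0 < M ∧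
    ∀ᶠ n : ℕ in atTop,
    1 / M ≤ En (fun κ => if b * Real.sqrt n ≤ K (ri r) κ then 1 else 0) n := by
  obtain ⟨M, hM, hev⟩ := tail hb0 hb
  refine ⟨2*M, by positivity, ?_⟩
  filter_upwards [hev, sqrt_nat_tendsto.eventually_ge_atTop (2*M*((r:ℝ)+1)),
    eventually_gt_atTop 0] with n hn hns hn0
  have hn0' : (0:ℝ) < n := by exact_mod_cast hn0
  have hs0 : 0 < Real.sqrt n := Real.sqrt_pos.2 hn0'
  have hkey : Ex (fun c => if b * Real.sqrt n ≤ (c.2:ℝ) - c.1 then 1 else 0) n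
      ≤ Ex (fun c => ∑ k ∈ Finset.range (r+1), ri k c) n
        + En (fun κ => if b * Real.sqrt n ≤ K (ri r) κ then 1 else 0) n := by
    rw [En_cover', Ex, Ex, ← add_div]
    gcongr
    unfold X
    rw [← Finset.sum_add_distrib]
    refine Finset.sum_le_sum fun κ hκ => ?_
    rw [← Finset.sum_add_distrib]
    refine Finset.sum_le_sum fun ν hν => ?_
    rw [← add_mul]
    refine mul_le_mul_of_nonneg_right ?_ (mul_nonneg (f_nonneg _) (f_nonneg _))
    obtain ⟨h1, h2⟩ := mem_up.1 hν
    obtain ⟨⟨i, j⟩, g1, g2, g3, g4⟩ := exists_box h2 (by rw [h1, mem_Y.1 hκ])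
    rw [wt_cover _ g4 g1, wt_cover _ g4 g1]
    by_cases hi : i ≤ r
    · have : ∑ k ∈ Finset.range (r+1), ri k (i, j) = 1 := by
        simp only [ri]
        rw [Finset.sum_ite_eq, if_pos (by simp; omega)]
      rw [this]
      split_ifs <;> norm_num
    · have h0 : 0 ≤ ∑ k ∈ Finset.range (r+1), ri k (i, j) :=
        Finset.sum_nonneg fun k _ => ri_nonneg k _
      refine le_add_of_nonneg_of_le h0 ?_
      have hrj : (r, j) ∈ κ := by
        have hm : (r, j) ∈ ν.cells := ν.isLowerSet (a := (i, j)) ⟨by simpa using by omega, le_rfl⟩ g2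
        rw [g4, Finset.mem_insert] at hm
        rcases hm with hm | hm
        · have := congrArg Prod.fst hm; simp at this; omega
        · exact hm
      have hlt : j < κ.rowLen r := YoungDiagram.mem_iff_lt_rowLen.1 hrj
      have hK : K (ri r) κ = κ.rowLen r := K_row r κ
      rw [hK]
      have hlt' : (j:ℝ) < κ.rowLen r := by exact_mod_cast hlt
      simp only
      by_cases hc : b * Real.sqrt n ≤ (j:ℝ) - i
      · rw [if_pos hc, if_pos]
        have : (0:ℝ) ≤ i := by positivity
        linarith
      · rw [if_neg hc]; split_ifs <;> norm_num
  have hp : Ex (fun c => ∑ k ∈ Finset.range (r+1), ri k c) n ≤ 1/(2*M) := by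
    rw [Ex_sum]
    have hle : 1 / Real.sqrt (n+1) ≤ 1 / (2*M*((r:ℝ)+1)) := by
      gcongr
      exact hns.trans (Real.sqrt_le_sqrt (by linarith))
    calc _ ≤ ∑ k ∈ Finset.range (r+1), 1 / (2*M*((r:ℝ)+1)) :=
          Finset.sum_le_sum fun k _ => (p_le k n).trans hle
      _ = _ := by
        rw [Finset.sum_const, Finset.card_range, nsmul_eq_mul]; push_cast; field_simp
  have : 1/M = 1/(2*M) + 1/(2*M) := by field_simp; norm_num
  linarith

theorem mean_lower (r : ℕ) {b : ℝ} (hb0 : 0 ≤ b) (hb : b < 2) :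
    ∀ᶠ n : ℕ in atTop, b * Real.sqrt n ≤ En (K (ri r)) n := by
  set b' := (b+2)/2 with hb'
  obtain ⟨M, hM, hev⟩ := tail2 r (b := b') (by linarith) (by linarith)
  have hd : 0 < b' - b := by linarith
  filter_upwards [hev, sqrt_nat_tendsto.eventually_gt_atTop (M/(b'-b)^2),
    eventually_gt_atTop 0] with n hn hns hn0
  have hn0' : (0:ℝ) < n := by exact_mod_cast hn0
  have hs0 : 0 < Real.sqrt n := Real.sqrt_pos.2 hn0'
  by_contra hcon
  push Not at hcon
  set μ := En (K (ri r)) n with hμ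
  have hv : En (fun κ => (K (ri r) κ - μ)^2) n ≤ Real.sqrt n := by
    obtain ⟨m, rfl⟩ : ∃ m, n = m + 1 := ⟨n-1, by omega⟩
    have := var_le r m μ hμ
    push_cast
    exact this
  set s := Real.sqrt n
  have hge : (b'*s - μ)^2 * En (fun κ => if b' * s ≤ K (ri r) κ then 1 else 0) n
      ≤ En (fun κ => (K (ri r) κ - μ)^2) n := by
    rw [← En_smul]
    refine En_mono fun κ _ => ?_
    split_ifs with h
    · rw [mul_one]
      have : 0 ≤ b'*s - μ := by nlinarith
      gcongr
    · rw [mul_zero]; positivity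
  have h1 : ((b'-b)*s)^2 * (1/M) ≤ s := by
    refine le_trans ?_ (hge.trans hv)
    have : (b'-b)*s ≤ b'*s - μ := by nlinarith
    gcongr
  rw [div_lt_iff₀ (by positivity)] at hns
  rw [mul_one_div, div_le_iff₀ hM] at h1
  nlinarith

end PGP

namespace PGP
open scoped Classical

theorem S_upper {R : ℝ} (hR : 0 < R) {A : ℕ → ℝ} (hA : ∀ n : ℕ, A n ≤ R / Real.sqrt (n+1)) (m : ℕ) :
    ∑ j ∈ Finset.range m, A j ≤ 2 * R * Real.sqrt m := by
  induction m with
  | zero => simp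
  | succ m ih =>
    rw [Finset.sum_range_succ]
    have h1 := hA m
    push_cast
    have hx0 : 0 ≤ Real.sqrt m := Real.sqrt_nonneg _
    have hx : Real.sqrt m ^ 2 = m := Real.sq_sqrt (by positivity)
    have hy0 : 0 < Real.sqrt ((m:ℝ)+1) := Real.sqrt_pos.2 (by positivity)
    have hy : Real.sqrt ((m:ℝ)+1) ^ 2 = m + 1 := Real.sq_sqrt (by positivity)
    set x := Real.sqrt m
    set y := Real.sqrt ((m:ℝ)+1)
    have : R / y ≤ 2 * R * (y - x) := by
      rw [div_le_iff₀ hy0]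
      have : 0 ≤ (y - x)^2 := sq_nonneg _
      nlinarith
    linarith

theorem taub {R : ℝ} (hR : 0 < R) {A : ℕ → ℝ} (hA0 : ∀ n, 0 ≤ A n)
    (hA : ∀ n : ℕ, A n ≤ R / Real.sqrt (n+1))
    (hmono : ∀ n : ℕ, ((n:ℝ)+1) * A n ≤ ((n:ℝ)+2) * A (n+1))
    (hS : ∀ b < 2, ∀ᶠ n : ℕ in atTop, R * b * Real.sqrt n ≤ ∑ j ∈ Finset.range n, A j)
    {η : ℝ} (hη : 0 < η) (hη1 : η < 1) :
    ∀ᶠ n : ℕ in atTop, R * (1 - η) ≤ Real.sqrt (n+1) * A n := by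
  have hmono' : Monotone fun n : ℕ => ((n:ℝ)+1) * A n := by
    refine monotone_nat_of_le_succ fun n => ?_
    have := hmono n
    push_cast
    rw [add_assoc, one_add_one_eq_two]; exact this
  set q := 1 - η/2 with hq
  have hq0 : 0 < q := by linarith
  have hq1 : q < 1 := by linarith
  have hq2 : 0 < 1 - q^2 := by nlinarith
  set D := η^2/8 * ((1-q^2)/q^2) with hD
  have hD0 : 0 < D := by positivity
  have hev := (tendsto_add_atTop_nat 1).eventually (hS (2 - D) (by linarith))
  have hev2 := (tendsto_add_atTop_nat 1).eventually (sqrt_nat_tendsto.eventually_ge_atTop (2/D))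
  filter_upwards [hev, hev2] with n h1 h2
  push_cast at h1 h2
  have ht0 : 0 < Real.sqrt ((n:ℝ)+1) := Real.sqrt_pos.2 (by positivity)
  have ht : Real.sqrt ((n:ℝ)+1) ^ 2 = n + 1 := Real.sq_sqrt (by positivity)
  set t := Real.sqrt ((n:ℝ)+1) with htd
  set m := ⌈q^2 * ((n:ℝ)+1)⌉₊ with hm
  have hm1 : q^2 * ((n:ℝ)+1) ≤ m := Nat.le_ceil _
  have hm2 : (m:ℝ) < q^2 * ((n:ℝ)+1) + 1 := Nat.ceil_lt_add_one (by positivity)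
  have hmn : m ≤ n + 1 := by
    rw [hm, Nat.ceil_le]; push_cast
    have : (0:ℝ) < n + 1 := by positivity
    nlinarith
  have hSm := S_upper hR hA m
  have hsm : Real.sqrt m ≤ q * t + 1 := by
    rw [Real.sqrt_le_left (by positivity)]
    nlinarith [mul_pos hq0 ht0]
  have hmp : (0:ℝ) < m := lt_of_lt_of_le (by positivity) hm1
  have hdiff : ∑ j ∈ Finset.range (n+1), A j
      ≤ ∑ j ∈ Finset.range m, A j + ((n:ℝ)+1-m) * (((n:ℝ)+1) * A n / m) := by
    rw [← Finset.sum_range_add_sum_Ico _ hmn]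
    gcongr
    calc _ ≤ ∑ j ∈ Finset.Ico m (n+1), ((n:ℝ)+1) * A n / m := by
          refine Finset.sum_le_sum fun j hj => ?_
          obtain ⟨hj1, hj2⟩ := Finset.mem_Ico.1 hj
          rw [le_div_iff₀ hmp]
          have := hmono' (show j ≤ n by omega)
          simp only at this
          have h3 : (m:ℝ) ≤ j + 1 := by exact_mod_cast (by omega : m ≤ j + 1)
          nlinarith [hA0 j]
      _ = _ := by
        rw [Finset.sum_const, Nat.card_Ico, nsmul_eq_mul, Nat.cast_sub hmn]; push_cast; rfl
  have hdiff2 : ((n:ℝ)+1-m) * (((n:ℝ)+1) * A n / m) ≤ (1-q^2)/q^2 * (t^2 * A n) := by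
    have e1 : (n:ℝ)+1-m ≤ (1-q^2) * t^2 := by rw [ht]; linarith
    have e2 : ((n:ℝ)+1) * A n / m ≤ t^2 * A n / (q^2 * t^2) := by
      rw [ht]
      have := hA0 n
      gcongr
    have e3 : 0 ≤ ((n:ℝ)+1) * A n / m := by have := hA0 n; positivity
    calc _ ≤ ((1-q^2) * t^2) * (t^2 * A n / (q^2 * t^2)) := by gcongr
      _ = _ := by field_simp
  have hfin : R * (2 - D) * t ≤ 2 * R * (q*t+1) + (1-q^2)/q^2 * (t^2 * A n) := by
    have : 2 * R * Real.sqrt m ≤ 2 * R * (q*t+1) := by gcongr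
    linarith
  have hDt : 2 ≤ D * t := by rw [div_le_iff₀ hD0] at h2; linarith
  have h5 : R * (2 - 2*q - 2*D) * t ≤ ((1-q^2)/q^2 * (t * A n)) * t := by nlinarith
  have h6 : R * (2 - 2*q - 2*D) ≤ (1-q^2)/q^2 * (t * A n) := le_of_mul_le_mul_right h5 ht0
  have h7 : q^2/(1-q^2) * (R * (2 - 2*q - 2*D)) ≤ t * A n := by
    calc _ ≤ q^2/(1-q^2) * ((1-q^2)/q^2 * (t * A n)) := by gcongr
      _ = _ := by field_simp
  refine le_trans ?_ h7
  have h8 : q^2/(1-q^2) * (R * (2 - 2*q - 2*D)) = R * (2*q^2/(1+q) - η^2/4) := by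
    rw [hD]
    have : 1 - q^2 = (1-q)*(1+q) := by ring
    have h9 : 1 - q ≠ 0 := by linarith
    have h10 : 1 + q ≠ 0 := by linarith
    rw [this]
    field_simp
    ring
  rw [h8]
  have h11 : q^2 ≤ 2*q^2/(1+q) := by
    rw [le_div_iff₀ (by linarith)]
    nlinarith [sq_nonneg q]
  refine mul_le_mul_of_nonneg_left ?_ hR.le
  have : q^2 = 1 - η + η^2/4 := by rw [hq]; ring
  linarith

theorem Ex_nonneg {w : ℕ × ℕ → ℝ} (h : ∀ b, 0 ≤ w b) (n : ℕ) : 0 ≤ Ex w n := by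
  unfold Ex X
  refine div_nonneg (Finset.sum_nonneg fun κ _ => Finset.sum_nonneg fun ν _ => ?_) (by positivity)
  exact mul_nonneg (wt_nonneg h _ _) (mul_nonneg (f_nonneg _) (f_nonneg _))

theorem p_tendsto (r : ℕ) :
    Tendsto (fun n : ℕ => Real.sqrt (n+1) * Ex (ri r) n) atTop (nhds 1) := by
  set A : ℕ → ℝ := fun n => Ex (fun b => if b.1 ≤ r then 1 else 0) n with hAdef
  have hAs : ∀ n, A n = ∑ k ∈ Finset.range (r+1), Ex (ri k) n := by
    intro n
    have he : (fun b : ℕ × ℕ => if b.1 ≤ r then (1:ℝ) else 0)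
        = fun c => ∑ k ∈ Finset.range (r+1), ri k c := by
      funext c
      simp only [ri]
      rw [Finset.sum_ite_eq]
      simp [Nat.lt_succ_iff]
    simp only [hAdef]
    rw [he, Ex_sum]
  have hup : ∀ n : ℕ, Real.sqrt (n+1) * Ex (ri r) n ≤ 1 := by
    intro n
    have ht0 : 0 < Real.sqrt ((n:ℝ)+1) := Real.sqrt_pos.2 (by positivity)
    have := p_le r n
    rw [le_div_iff₀ ht0] at this
    linarith
  have hR : (0:ℝ) < (r:ℝ)+1 := by positivity
  have h0 : ∀ n, 0 ≤ A n := fun n => Ex_nonneg (fun b => by split_ifs <;> norm_num) n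
  have h1 : ∀ n : ℕ, A n ≤ ((r:ℝ)+1) / Real.sqrt (n+1) := by
    intro n
    rw [hAs]
    calc _ ≤ ∑ k ∈ Finset.range (r+1), 1 / Real.sqrt (n+1) :=
          Finset.sum_le_sum fun k _ => p_le k n
      _ = _ := by rw [Finset.sum_const, Finset.card_range, nsmul_eq_mul]; push_cast; ring
  have h2 : ∀ n : ℕ, ((n:ℝ)+1) * A n ≤ ((n:ℝ)+2) * A (n+1) := by
    intro n
    simp only [hAdef]
    rw [Ex_rec]
    have : En (fun _ => 0) (n+1) ≤ En (dd (fun b => if b.1 ≤ r then 1 else 0) n) (n+1) :=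
      En_mono fun κ hκ => dd_le_row r hκ
    have h0 : En (fun _ => 0) (n+1) = 0 := by simp [En]
    linarith
  have h3 : ∀ b < 2, ∀ᶠ n : ℕ in atTop,
      ((r:ℝ)+1) * b * Real.sqrt n ≤ ∑ j ∈ Finset.range n, A j := by
    intro b hb
    have hall : ∀ᶠ n : ℕ in atTop, ∀ k ∈ Finset.range (r+1),
        max b 0 * Real.sqrt n ≤ En (K (ri k)) n := by
      rw [Filter.eventually_all_finset]
      exact fun k _ => mean_lower k (le_max_right _ _) (max_lt hb (by norm_num))
    filter_upwards [hall] with n hn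
    have : ∑ j ∈ Finset.range n, A j = ∑ k ∈ Finset.range (r+1), En (K (ri k)) n := by
      simp only [En_K, hAs]
      exact Finset.sum_comm
    rw [this]
    calc _ = ∑ k ∈ Finset.range (r+1), b * Real.sqrt n := by
          rw [Finset.sum_const, Finset.card_range, nsmul_eq_mul]; push_cast; ring
      _ ≤ _ := Finset.sum_le_sum fun k hk => le_trans (by gcongr; exact le_max_left _ _) (hn k hk)
  rw [tendsto_order]
  constructor
  · intro a ha
    set η := min (1/2) ((1-a)/(2*((r:ℝ)+1))) with hη
    have hη0 : 0 < η := lt_min (by norm_num) (div_pos (by linarith) (by positivity))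
    have hη1 : η < 1 := (min_le_left _ _).trans_lt (by norm_num)
    have hη2 : ((r:ℝ)+1) * η ≤ (1-a)/2 := by
      calc _ ≤ ((r:ℝ)+1) * ((1-a)/(2*((r:ℝ)+1))) := by gcongr; exact min_le_right _ _
        _ = _ := by field_simp
    filter_upwards [taub hR h0 h1 h2 h3 hη0 hη1] with n hn
    rw [hAs, Finset.sum_range_succ, mul_add] at hn
    have ht0 : 0 < Real.sqrt ((n:ℝ)+1) := Real.sqrt_pos.2 (by positivity)
    have : Real.sqrt ((n:ℝ)+1) * ∑ k ∈ Finset.range r, Ex (ri k) n ≤ r := by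
      calc _ ≤ Real.sqrt ((n:ℝ)+1) * ∑ k ∈ Finset.range r, 1 / Real.sqrt (n+1) := by
            gcongr with k hk; exact p_le k n
        _ = r := by rw [Finset.sum_const, Finset.card_range, nsmul_eq_mul]; field_simp
    linarith
  · intro a ha
    exact Eventually.of_forall fun n => (hup n).trans_lt ha

end PGP

namespace PGP
open scoped Classical

theorem meas_seg {Ω : Type*} [MeasurableSpace Ω] {lam : ℕ → Ω → YoungDiagram}
    (hm : ∀ (n : ℕ) (y : YoungDiagram), MeasurableSet {ω | lam n ω = y}) (m n : ℕ)
    (path : ℕ → YoungDiagram) :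
    MeasurableSet {ω | ∀ i, m ≤ i → i ≤ n → lam i ω = path i} := by
  have : {ω | ∀ i, m ≤ i → i ≤ n → lam i ω = path i}
      = ⋂ i, ⋂ (_ : m ≤ i), ⋂ (_ : i ≤ n), {ω | lam i ω = path i} := by
    ext ω; simp
  rw [this]
  exact MeasurableSet.iInter fun i => MeasurableSet.iInter fun _ => MeasurableSet.iInter fun _ =>
    hm i _

theorem seg_lower {Ω : Type*} [MeasurableSpace Ω] {P : Measure Ω}
    {lam : ℕ → Ω → YoungDiagram} (hPGP : IsPlancherelGrowthProcess P lam) (n : ℕ) (m : ℕ) :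
    m ≤ n → ∀ path : ℕ → YoungDiagram, (path m).card = m →
    (∀ i, m ≤ i → i < n → path i ≤ path (i+1) ∧ (path (i+1)).card = (path i).card + 1) →
    f (path m) * f (path n) / n.factorial
      ≤ P.real {ω | ∀ i, m ≤ i → i ≤ n → lam i ω = path i} := by
  obtain ⟨hP, hm, hpath⟩ := hPGP
  induction m with
  | zero =>
    intro _ path h0 hp
    have hb : path 0 = ⊥ := by
      have := mem_Y.2 h0
      rwa [Y_zero, Finset.mem_singleton] at this
    have h := hpath n path hb (fun i hi => hp i (Nat.zero_le _) hi)
    have e : {ω | ∀ i, 0 ≤ i → i ≤ n → lam i ω = path i} = {ω | ∀ i ≤ n, lam i ω = path i} := by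
      ext ω; simp
    rw [e, Measure.real, h, ENNReal.toReal_div, hb, f_bot, one_mul]
    simp [f]
  | succ m ih =>
    intro hmn path h0 hp
    have hle : ∀ κ ∈ dn m (path (m+1)), f κ * f (path n) / n.factorial
        ≤ P.real {ω | ∀ i, m ≤ i → i ≤ n → lam i ω = Function.update path m κ i} := by
      intro κ hκ
      obtain ⟨k1, k2⟩ := mem_dn.1 hκ
      have := ih (by omega) (Function.update path m κ) (by simpa using k1) (by
        intro i hi hin
        rw [Function.update_of_ne (by omega : i + 1 ≠ m)]
        rcases hi.eq_or_lt with rfl | hlt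
        · rw [Function.update_self]; exact ⟨k2, by rw [h0, k1]⟩
        · rw [Function.update_of_ne (by omega : i ≠ m)]
          exact hp i (by omega) hin)
      rwa [Function.update_self, Function.update_of_ne (by omega : n ≠ m)] at this
    calc f (path (m+1)) * f (path n) / n.factorial
        = ∑ κ ∈ dn m (path (m+1)), f κ * f (path n) / n.factorial := by
          rw [← f_dn h0, Finset.sum_mul, Finset.sum_div]
      _ ≤ ∑ κ ∈ dn m (path (m+1)),
          P.real {ω | ∀ i, m ≤ i → i ≤ n → lam i ω = Function.update path m κ i} :=
          Finset.sum_le_sum hle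
      _ = P.real (⋃ κ ∈ dn m (path (m+1)),
          {ω | ∀ i, m ≤ i → i ≤ n → lam i ω = Function.update path m κ i}) := by
          rw [measureReal_biUnion_finset]
          · intro κ _ κ' _ hne
            rw [Function.onFun, Set.disjoint_left]
            intro ω h1 h2
            have a1 := h1 m le_rfl (by omega)
            have a2 := h2 m le_rfl (by omega)
            rw [Function.update_self] at a1 a2
            exact hne (a1.symm.trans a2)
          · intro κ _
            exact meas_seg hm _ _ _
      _ ≤ _ := by
          refine measureReal_mono ?_
          intro ω hω
          simp only [Set.mem_iUnion] at hω
          obtain ⟨κ, _, hω⟩ := hω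
          intro i h1 h2
          have := hω i (by omega) h2
          rwa [Function.update_of_ne (by omega : i ≠ m)] at this

/-- pairs -/
noncomputable def prs (n : ℕ) : Finset (YoungDiagram × YoungDiagram) :=
  (Y n ×ˢ Y (n+1)).filter fun p => p.1 ≤ p.2

theorem sum_prs (n : ℕ) (F : YoungDiagram → YoungDiagram → ℝ) :
    ∑ p ∈ prs n, F p.1 p.2 = ∑ κ ∈ Y n, ∑ ν ∈ up (n+1) κ, F κ ν := by
  unfold prs up
  rw [Finset.sum_filter, Finset.sum_product]
  refine Finset.sum_congr rfl fun κ _ => ?_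
  rw [Finset.sum_filter]

theorem union_lower {Ω : Type*} [MeasurableSpace Ω] {P : Measure Ω}
    {lam : ℕ → Ω → YoungDiagram} (hPGP : IsPlancherelGrowthProcess P lam) (n : ℕ)
    (c : YoungDiagram × YoungDiagram → Prop) :
    MeasurableSet (⋃ p ∈ (prs n).filter c, {ω | lam n ω = p.1 ∧ lam (n+1) ω = p.2}) ∧
    ∑ p ∈ prs n, (if c p then 1 else 0) * (f p.1 * f p.2 / (n+1).factorial)
      ≤ P.real (⋃ p ∈ (prs n).filter c, {ω | lam n ω = p.1 ∧ lam (n+1) ω = p.2}) := by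
  have hP := hPGP.1
  have hm := hPGP.2.1
  have hms : ∀ p : YoungDiagram × YoungDiagram,
      MeasurableSet {ω | lam n ω = p.1 ∧ lam (n+1) ω = p.2} := fun p =>
    (hm n p.1).inter (hm (n+1) p.2)
  refine ⟨Finset.measurableSet_biUnion _ fun p _ => hms p, ?_⟩
  rw [measureReal_biUnion_finset]
  · simp only [ite_mul, one_mul, zero_mul]
    rw [← Finset.sum_filter]
    refine Finset.sum_le_sum fun p hp => ?_
    have hp' := (Finset.mem_filter.1 hp).1
    unfold prs at hp'
    simp only [Finset.mem_filter, Finset.mem_product, mem_Y] at hp'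
    obtain ⟨⟨h1, h2⟩, h3⟩ := hp'
    have := seg_lower hPGP (n+1) n (by omega) (fun i => if i = n then p.1 else p.2)
      (by simpa using h1) (by
        intro i hi hi2
        have : i = n := by omega
        subst this
        simp [h1, h2, h3])
    simp only [if_true, Nat.succ_ne_self, if_false] at this
    refine this.trans (measureReal_mono ?_)
    intro ω hω
    have a1 := hω n le_rfl (by omega)
    have a2 := hω (n+1) (by omega) le_rfl
    simp at a1 a2
    exact ⟨a1, a2⟩
  · intro p _ p' _ hne
    rw [Function.onFun, Set.disjoint_left]
    rintro ω ⟨a1, a2⟩ ⟨b1, b2⟩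
    exact hne (Prod.ext (a1.symm.trans b1) (a2.symm.trans b2))
  · exact fun p _ => hms p

theorem prob_eq {Ω : Type*} [MeasurableSpace Ω] {P : Measure Ω}
    {lam : ℕ → Ω → YoungDiagram} (hPGP : IsPlancherelGrowthProcess P lam) (n r : ℕ) :
    (P (growthEvent lam n r)).toReal = Ex (ri r) n := by
  have hP := hPGP.1
  obtain ⟨c, hc⟩ : ∃ c : YoungDiagram × YoungDiagram → Prop,
      ∀ p, c p ↔ p.2.rowLen r = p.1.rowLen r + 1 := ⟨_, fun p => Iff.rfl⟩
  obtain ⟨d, hd⟩ : ∃ d : YoungDiagram × YoungDiagram → Prop,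
      ∀ p, d p ↔ ¬ c p := ⟨_, fun p => Iff.rfl⟩
  have hwt : ∀ p ∈ prs n, wt (ri r) p.1 p.2 = if c p then 1 else 0 := by
    intro p hp
    unfold prs at hp
    simp only [Finset.mem_filter, Finset.mem_product, mem_Y] at hp
    obtain ⟨⟨h1, h2⟩, h3⟩ := hp
    have hsq := wt_ri_sq (r := r) h1 h2 h3
    have hK := K_cover (ri r) h3
    rw [show K (ri r) p.2 = p.2.rowLen r from K_row r _,
      show K (ri r) p.1 = p.1.rowLen r from K_row r _] at hK
    split_ifs with h
    · rw [hc] at h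
      rw [h] at hK; push_cast at hK; linarith
    · have h01 : wt (ri r) p.1 p.2 * (wt (ri r) p.1 p.2 - 1) = 0 := by linarith
      rcases mul_eq_zero.1 h01 with h0 | h0
      · exact h0
      · exfalso; apply h; rw [hc]
        have h0' : wt (ri r) p.1 p.2 = 1 := by linarith
        rw [h0'] at hK
        exact_mod_cast hK
  have hEx : Ex (ri r) n = ∑ p ∈ prs n, (if c p then 1 else 0) * (f p.1 * f p.2 / (n+1).factorial) := by
    rw [Ex, X, ← sum_prs, Finset.sum_div]
    refine Finset.sum_congr rfl fun p hp => ?_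
    rw [hwt p hp]; ring
  have hone : (1:ℝ) = ∑ p ∈ prs n, (f p.1 * f p.2 / (n+1).factorial) := by
    rw [← En_one n, En_cover', ← sum_prs n (fun κ ν => 1 * (f κ * f ν)), Finset.sum_div]
    exact Finset.sum_congr rfl fun p hp => by ring
  have hEx' : 1 - Ex (ri r) n
      = ∑ p ∈ prs n, (if d p then 1 else 0) * (f p.1 * f p.2 / (n+1).factorial) := by
    rw [hEx, sub_eq_iff_eq_add, ← Finset.sum_add_distrib]
    refine hone.trans (Finset.sum_congr rfl fun p hp => ?_)
    by_cases h : c p <;> simp [h, hd]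
  obtain ⟨m1, l1⟩ := union_lower hPGP n c
  obtain ⟨m2, l2⟩ := union_lower hPGP n d
  rw [← hEx] at l1
  rw [← hEx'] at l2
  change P.real _ = _
  refine le_antisymm ?_ ?_
  · have hsub : growthEvent lam n r
        ⊆ (⋃ p ∈ (prs n).filter d, {ω | lam n ω = p.1 ∧ lam (n+1) ω = p.2})ᶜ := by
      intro ω hω hu
      simp only [Set.mem_iUnion, Finset.mem_filter] at hu
      obtain ⟨p, ⟨_, hp⟩, h1, h2⟩ := hu
      apply (hd p).1 hp
      rw [hc]
      rw [← h1, ← h2]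
      exact hω
    have h1 := measureReal_mono (μ := P) hsub
    rw [probReal_compl_eq_one_sub m2] at h1
    linarith
  · refine l1.trans (measureReal_mono ?_)
    intro ω hu
    simp only [Set.mem_iUnion, Finset.mem_filter] at hu
    obtain ⟨p, ⟨_, hp⟩, h1, h2⟩ := hu
    change (lam (n + 1) ω).rowLen r = (lam n ω).rowLen r + 1
    rw [h1, h2]
    exact (hc p).1 hp

end PGP

theorem sqrt_mul_growth_prob_tendsto_one {Ω : Type*} [MeasurableSpace Ω] (P : Measure Ω)
    (lam : ℕ → Ω → YoungDiagram) (hPGP : IsPlancherelGrowthProcess P lam) (r : ℕ) :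
    Filter.Tendsto (fun n : ℕ => Real.sqrt (n + 1) * (P (growthEvent lam n r)).toReal)
      Filter.atTop (nhds 1) := by
  simp only [PGP.prob_eq hPGP]
  exact PGP.p_tendsto r
end
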